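/- Let ν ∈ (−1/2,1), β > 7 and w(v) = (1+|v|)^β. Assume F₀ : ℝ³×ℝ³ → ℝ is measurable with F₀ ≥ 0, ∥wF₀∥_{L∞} < ∞, that F₀lnF₀ − μlnμ, F₀ − μ and |v|²(F₀−μ) are integrable on ℝ³×ℝ³, and that there is C₀ > 0 with inf_{t≥0, x∈ℝ³} ∫_{ℝ³} F₀(x−vt,v)dv ≥ C₀. Then there exist constants ε₀ > 0 and C̃₁, C̃₂ ≥ 1, depending only on ν, C₀ and ∥wF₀∥_{L∞}, such that if ℰ(F₀) + sup_{t ≥ t₁, x∈ℝ³} e^{−t/(1−ν)} |∫_{ℝ³}(1, v, |v|², v⊗v)[F₀(x−vt,v) − μ(v)]dv| ≤ ε₀, where t₁ = (C̃₁∥wF₀∥_{L∞})^{−1}, then there exists a unique global-in-time nonnegative mild solution F of the ES-BGK equation with initial datum F₀ satisfying sup_{t≥0} ∥wF(t)∥_{L∞} ≤ C̃₂. -/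

import Mathlib

open MeasureTheory Real Matrix ENNReal

noncomputable section

/-- Velocity/position space `ℝ³`. -/
abbrev E3 : Type := EuclideanSpace ℝ (Fin 3)

/-- The normalized global Maxwellian `μ(v) = (2π)^{-3/2} exp(-|v|²/2)`. -/
def Mw (v : E3) : ℝ := (2 * π) ^ (-(3 : ℝ) / 2) * Real.exp (-‖v‖ ^ 2 / 2)

/-- Density `ρ = ∫ g dv`. -/
def dens (g : E3 → ℝ) : ℝ := ∫ v, g v

/-- Bulk velocity `u = ρ⁻¹ ∫ v g dv`. -/
def bulk (g : E3 → ℝ) : E3 := (dens g)⁻¹ • ∫ v, g v • v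

/-- Temperature `T = (3ρ)⁻¹ ∫ |v-u|² g dv`. -/
def temp (g : E3 → ℝ) : ℝ := (3 * dens g)⁻¹ * ∫ v, ‖v - bulk g‖ ^ 2 * g v

/-- Stress tensor `Θ = ρ⁻¹ ∫ (v-u)⊗(v-u) g dv`. -/
def stress (g : E3 → ℝ) : Matrix (Fin 3) (Fin 3) ℝ :=
  Matrix.of fun i j => (dens g)⁻¹ * ∫ v, (v - bulk g) i * (v - bulk g) j * g v

/-- Temperature tensor `𝒯_ν = (1-ν) T Id + ν Θ`. -/
def tempTensor (g : E3 → ℝ) (ν : ℝ) : Matrix (Fin 3) (Fin 3) ℝ :=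
  ((1 - ν) * temp g) • (1 : Matrix (Fin 3) (Fin 3) ℝ) + ν • stress g

/-- Anisotropic Gaussian `M_ν = ρ det(2π𝒯_ν)^{-1/2} exp(-½ (v-u)ᵀ𝒯_ν⁻¹(v-u))`. -/
def aGauss (g : E3 → ℝ) (ν : ℝ) (v : E3) : ℝ :=
  dens g / Real.sqrt (((2 * π) • tempTensor g ν).det) *
    Real.exp (-(1 / 2) *
      ((fun i => (v - bulk g) i) ⬝ᵥ ((tempTensor g ν)⁻¹ *ᵥ fun i => (v - bulk g) i)))

/-- Collision frequency `A_ν = ρT/(1-ν)`. -/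
def collFreq (g : E3 → ℝ) (ν : ℝ) : ℝ := dens g * temp g / (1 - ν)

/-- Weighted sup-norm `‖w f‖_{L^∞} = sup_{x,v} (1+|v|)^β f(x,v)`. -/
def wSup (β : ℝ) (f : E3 → E3 → ℝ) : ℝ :=
  ⨆ p : E3 × E3, (1 + ‖p.2‖) ^ β * f p.1 p.2

/-- Finiteness of the weighted sup-norm. -/
def WBdd (β : ℝ) (f : E3 → E3 → ℝ) : Prop :=
  BddAbove (Set.range fun p : E3 × E3 => (1 + ‖p.2‖) ^ β * f p.1 p.2)

/-- A (global-in-time) mild solution of the ES-BGK equation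
`∂ₜF + v·∇ₓF = A_ν (M_ν - F)` with initial datum `F₀`. -/
structure IsMildSolution (ν β : ℝ) (F₀ : E3 → E3 → ℝ) (F : ℝ → E3 → E3 → ℝ) : Prop where
  nonneg : ∀ t, 0 ≤ t → ∀ x v, 0 ≤ F t x v
  meas : ∀ t, 0 ≤ t → Measurable fun p : E3 × E3 => F t p.1 p.2
  integrable : ∀ t, 0 ≤ t → ∀ x, Integrable (F t x)
  moment2 : ∀ t, 0 ≤ t → ∀ x, Integrable fun v => ‖v‖ ^ 2 * F t x v
  dens_pos : ∀ t, 0 ≤ t → ∀ x, 0 < dens (F t x)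
  temp_pos : ∀ t, 0 ≤ t → ∀ x, 0 < temp (F t x)
  wnorm_bdd : ∀ t, 0 ≤ t → WBdd β (F t)
  wnorm_cont : ContinuousOn (fun t => wSup β (F t)) (Set.Ici 0)
  mild : ∀ t, 0 ≤ t → ∀ x v,
    F t x v = F₀ (x - t • v) v *
        Real.exp (-(∫ τ in (0 : ℝ)..t, collFreq (F τ (x - (t - τ) • v)) ν))
      + ∫ s in (0 : ℝ)..t,
          Real.exp (-(∫ τ in s..t, collFreq (F τ (x - (t - τ) • v)) ν)) *
            collFreq (F s (x - (t - s) • v)) ν * aGauss (F s (x - (t - s) • v)) ν v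

/-- The entropy functional `ℰ(F₀)`. -/
def entE (F₀ : E3 → E3 → ℝ) : ℝ :=
  (∫ p : E3 × E3, (F₀ p.1 p.2 * Real.log (F₀ p.1 p.2) - Mw p.2 * Real.log (Mw p.2)))
    + (3 / 2 * Real.log (2 * π) - 1) * (∫ p : E3 × E3, (F₀ p.1 p.2 - Mw p.2))
    + 1 / 2 * ∫ p : E3 × E3, ‖p.2‖ ^ 2 * (F₀ p.1 p.2 - Mw p.2)

/-- Componentwise absolute value of `∫ (1, v, |v|², v⊗v) (f - μ) dv`. -/
def momentGap (f : E3 → ℝ) : ℝ :=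
  |∫ v, (f v - Mw v)| ⊔ (⨆ i : Fin 3, |∫ v, v i * (f v - Mw v)|) ⊔
    |∫ v, ‖v‖ ^ 2 * (f v - Mw v)| ⊔
    ⨆ ij : Fin 3 × Fin 3, |∫ v, v ij.1 * v ij.2 * (f v - Mw v)|

/-- `N_q(g) = sup_v (1+|v|)^q g(v)`, valued in `ℝ≥0∞`. -/
def Nq (q : ℝ) (g : E3 → ℝ) : ℝ≥0∞ :=
  ⨆ v : E3, ENNReal.ofReal ((1 + ‖v‖) ^ q * g v)

end

namespace ESBGK

/-! ### Scalar linear relaxation equations along a characteristic -/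

theorem measurable_setIntegral_Ioc {Z : Type*} [MeasurableSpace Z] {f : Z → ℝ → ℝ} {s t : Z → ℝ}
    (hf : Measurable (Function.uncurry f)) (hs : Measurable s) (ht : Measurable t) :
    Measurable fun z => ∫ τ in Set.Ioc (s z) (t z), f z τ := by
  have hset : MeasurableSet {p : Z × ℝ | s p.1 < p.2 ∧ p.2 ≤ t p.1} :=
    (measurableSet_lt (hs.comp measurable_fst) measurable_snd).inter
      (measurableSet_le measurable_snd (ht.comp measurable_fst))
  have h : Measurable ({p : Z × ℝ | s p.1 < p.2 ∧ p.2 ≤ t p.1}.indicator (Function.uncurry f)) :=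
    hf.indicator hset
  have h2 := (h.stronglyMeasurable.integral_prod_right' (ν := (volume : Measure ℝ))).measurable
  convert h2 using 2 with z
  rw [← integral_indicator measurableSet_Ioc]
  rfl

/-- The damping factor `exp (-∫ₛᵗ a)`. -/
noncomputable def expI (a : ℝ → ℝ) (s t : ℝ) : ℝ := Real.exp (-∫ τ in Set.Ioc s t, a τ)

/-- Duhamel's formula for `y' = a (m - y)`, `y r = y₀`. -/
noncomputable def duh (a m : ℝ → ℝ) (r y₀ t : ℝ) : ℝ :=
  y₀ * expI a r t + ∫ s in Set.Ioc r t, expI a s t * a s * m s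

/-- A measurable collision frequency with values in `[0, K]`. -/
structure Freq (K : ℝ) (a : ℝ → ℝ) : Prop where
  meas : Measurable a
  nonneg : ∀ τ, 0 ≤ a τ
  le : ∀ τ, a τ ≤ K

theorem integrableOn_Ioc_of_bdd {f : ℝ → ℝ} {s t B : ℝ} (hf : Measurable f)
    (hB : ∀ τ ∈ Set.Ioc s t, |f τ| ≤ B) : IntegrableOn f (Set.Ioc s t) := by
  refine Measure.integrableOn_of_bounded (M := B) (by simp) hf.aestronglyMeasurable ?_
  exact (ae_restrict_iff' measurableSet_Ioc).2 (Filter.Eventually.of_forall hB)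

namespace Freq

variable {K : ℝ} {a : ℝ → ℝ}

theorem K_nonneg (h : Freq K a) : 0 ≤ K := (h.nonneg 0).trans (h.le 0)

theorem abs_le (h : Freq K a) (τ : ℝ) : |a τ| ≤ K := by
  rw [abs_of_nonneg (h.nonneg τ)]; exact h.le τ

theorem integrableOn (h : Freq K a) (s t : ℝ) : IntegrableOn a (Set.Ioc s t) :=
  integrableOn_Ioc_of_bdd h.meas fun τ _ => h.abs_le τ

theorem intervalIntegrable (h : Freq K a) (s t : ℝ) : IntervalIntegrable a volume s t :=
  ⟨h.integrableOn s t, h.integrableOn t s⟩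

theorem integral_nonneg (h : Freq K a) (s t : ℝ) : 0 ≤ ∫ τ in Set.Ioc s t, a τ :=
  setIntegral_nonneg measurableSet_Ioc fun τ _ => h.nonneg τ

theorem integral_le (h : Freq K a) {s t : ℝ} (hst : s ≤ t) :
    ∫ τ in Set.Ioc s t, a τ ≤ K * (t - s) := by
  calc ∫ τ in Set.Ioc s t, a τ ≤ ∫ _ in Set.Ioc s t, K :=
        setIntegral_mono (h.integrableOn s t) (by simp) fun τ => h.le τ
    _ = K * (t - s) := by simp [hst]; ring

theorem expI_pos (_ : Freq K a) (s t : ℝ) : 0 < expI a s t := Real.exp_pos _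

theorem expI_le_one (h : Freq K a) (s t : ℝ) : expI a s t ≤ 1 := by
  unfold expI; rw [Real.exp_le_one_iff]; linarith [h.integral_nonneg s t]

theorem le_expI (h : Freq K a) {s t : ℝ} (hst : s ≤ t) : Real.exp (-(K * (t - s))) ≤ expI a s t := by
  unfold expI; rw [Real.exp_le_exp]; linarith [h.integral_le hst]

theorem expI_mul (h : Freq K a) {r s t : ℝ} (hrs : r ≤ s) (hst : s ≤ t) :
    expI a r s * expI a s t = expI a r t := by
  unfold expI
  rw [← Real.exp_add, ← Set.Ioc_union_Ioc_eq_Ioc hrs hst,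
    setIntegral_union (Set.Ioc_disjoint_Ioc_of_le le_rfl) measurableSet_Ioc
      (h.integrableOn r s) (h.integrableOn s t)]
  ring_nf

theorem measurable_expI_left (h : Freq K a) (t : ℝ) : Measurable fun s => expI a s t := by
  unfold expI
  exact Real.measurable_exp.comp (measurable_setIntegral_Ioc (f := fun _ τ => a τ)
    (h.meas.comp measurable_snd) measurable_id measurable_const).neg

theorem measurable_expI_right (h : Freq K a) (s : ℝ) : Measurable fun t => expI a s t := by
  unfold expI
  exact Real.measurable_exp.comp (measurable_setIntegral_Ioc (f := fun _ τ => a τ)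
    (h.meas.comp measurable_snd) measurable_const measurable_id).neg

theorem measurable_expI (h : Freq K a) : Measurable fun p : ℝ × ℝ => expI a p.1 p.2 := by
  unfold expI
  exact Real.measurable_exp.comp (measurable_setIntegral_Ioc (f := fun _ τ => a τ)
    (h.meas.comp measurable_snd) measurable_fst measurable_snd).neg

theorem lipschitz_primitive (h : Freq K a) (r : ℝ) :
    LipschitzWith ⟨K, h.K_nonneg⟩ fun t => ∫ τ in r..t, a τ := by
  refine LipschitzWith.of_dist_le_mul fun x y => ?_
  rw [Real.dist_eq, intervalIntegral.integral_interval_sub_left (h.intervalIntegrable _ _)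
    (h.intervalIntegrable _ _), Real.dist_eq]
  have := intervalIntegral.norm_integral_le_of_norm_le_const (a := y) (b := x) (f := a) (C := K)
    fun τ _ => by rw [Real.norm_eq_abs]; exact h.abs_le τ
  exact this

/-- Absolute continuity of `exp (c ∫ᵣᵗ a)` and the fundamental theorem of calculus for it. -/
theorem integral_exp_primitive (h : Freq K a) (c : ℝ) {r t : ℝ} (hrt : r ≤ t) :
    ∫ s in Set.Ioc r t, c * a s * Real.exp (c * ∫ τ in r..s, a τ)
      = Real.exp (c * ∫ τ in r..t, a τ) - 1 := by
  set g : ℝ → ℝ := fun s => Real.exp (c * ∫ τ in r..s, a τ) with hg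
  have hlip : LipschitzWith (‖c‖₊ * ⟨K, h.K_nonneg⟩) fun s => c * ∫ τ in r..s, a τ := by
    have := (lipschitzWith_smul c).comp (h.lipschitz_primitive r)
    simpa [Function.comp_def] using this
  have hb : ∀ s ∈ Set.Icc r t, (c * ∫ τ in r..s, a τ) ∈ Set.Icc (-(|c| * (K * (t - r))))
      (|c| * (K * (t - r))) := by
    intro s hs
    rw [Set.mem_Icc, ← _root_.abs_le, abs_mul]
    gcongr
    rw [intervalIntegral.integral_of_le hs.1, abs_of_nonneg (h.integral_nonneg _ _)]
    refine (h.integral_le hs.1).trans ?_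
    have := hs.2; have := h.K_nonneg
    gcongr
  obtain ⟨L, hL⟩ : ∃ L, LipschitzOnWith L Real.exp (Set.Icc (-(|c| * (K * (t - r))))
      (|c| * (K * (t - r)))) := by
    exact (Real.contDiff_exp.contDiffOn (s := Set.Icc (-(|c| * (K * (t - r))))
      (|c| * (K * (t - r))))).exists_lipschitzOnWith (n := 1) (by simp) (convex_Icc _ _) isCompact_Icc
  have hgl : LipschitzOnWith (L * (‖c‖₊ * ⟨K, h.K_nonneg⟩)) g (Set.uIcc r t) := by
    rw [Set.uIcc_of_le hrt]
    exact hL.comp hlip.lipschitzOnWith hb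
  have hac := hgl.absolutelyContinuousOnInterval
  have hder : ∀ᵐ s : ℝ, s ∈ Set.uIcc r t → HasDerivAt g (c * a s * g s) s := by
    filter_upwards [(h.intervalIntegrable r t).ae_hasDerivAt_integral] with s hs hmem
    have := ((hs hmem r (by simp)).const_mul c).exp
    convert this using 1
    simp only [hg]; ring
  have h1 := hac.integral_deriv_eq_sub
  rw [← intervalIntegral.integral_of_le hrt]
  have h2 : ∫ s in r..t, deriv g s = ∫ s in r..t, c * a s * g s := by
    refine intervalIntegral.integral_congr_ae ?_
    filter_upwards [hder] with s hs hm
    exact (hs (Set.uIoc_subset_uIcc hm)).deriv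
  rw [← h2, h1]
  simp [hg]

theorem mass_right (h : Freq K a) {r t : ℝ} (hrt : r ≤ t) :
    ∫ s in Set.Ioc r t, a s * expI a r s = 1 - expI a r t := by
  have := h.integral_exp_primitive (-1) hrt
  rw [← neg_inj, ← integral_neg]
  have e : ∀ s, r ≤ s → Real.exp (-1 * ∫ τ in r..s, a τ) = expI a r s := by
    intro s hs; unfold expI; rw [intervalIntegral.integral_of_le hs]; ring_nf
  rw [e t hrt] at this
  rw [neg_sub, ← this]
  refine setIntegral_congr_fun measurableSet_Ioc fun s hs => ?_
  simp only [e s hs.1.le]; ring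

theorem mass_left (h : Freq K a) {r t : ℝ} (hrt : r ≤ t) :
    ∫ s in Set.Ioc r t, expI a s t * a s = 1 - expI a r t := by
  have := h.integral_exp_primitive 1 hrt
  have e : ∀ s, r ≤ s → Real.exp (1 * ∫ τ in r..s, a τ) = (expI a r s)⁻¹ := by
    intro s hs; unfold expI; rw [intervalIntegral.integral_of_le hs, ← Real.exp_neg]; ring_nf
  rw [e t hrt] at this
  have hp := h.expI_pos r t
  have h3 : ∫ s in Set.Ioc r t, expI a s t * a s
      = ∫ s in Set.Ioc r t, expI a r t * (1 * a s * Real.exp (1 * ∫ τ in r..s, a τ)) := by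
    refine setIntegral_congr_fun measurableSet_Ioc fun s hs => ?_
    simp only [e s hs.1.le]
    rw [← h.expI_mul hs.1.le hs.2]
    have := h.expI_pos r s
    field_simp
  rw [h3, integral_const_mul, this]
  field_simp

end Freq

end ESBGK

namespace ESBGK

section Duhamel

variable {K B r s t y : ℝ} {a m : ℝ → ℝ}

theorem Freq.integrableOn_kernel_mul (h : Freq K a) (hm : Measurable m)
    (hB : ∀ τ ∈ Set.Ioc r t, |m τ| ≤ B) :
    IntegrableOn (fun s => expI a s t * a s * m s) (Set.Ioc r t) := by
  refine integrableOn_Ioc_of_bdd (B := 1 * K * B) (((h.measurable_expI_left t).mul h.meas).mul hm) ?_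
  intro τ hτ
  rw [abs_mul, abs_mul]
  have h1 : |expI a τ t| ≤ 1 := by rw [abs_of_pos (h.expI_pos _ _)]; exact h.expI_le_one _ _
  have h2 := h.abs_le τ
  have h3 := hB τ hτ
  have := h.K_nonneg
  gcongr

theorem Freq.integrableOn_mul (h : Freq K a) (hm : Measurable m)
    (hB : ∀ τ ∈ Set.Ioc r t, |m τ| ≤ B) :
    IntegrableOn (fun s => a s * m s) (Set.Ioc r t) := by
  refine integrableOn_Ioc_of_bdd (B := K * B) (h.meas.mul hm) ?_
  intro τ hτ
  rw [abs_mul]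
  have h2 := h.abs_le τ
  have h3 := hB τ hτ
  have := h.K_nonneg
  gcongr

theorem duh_of_le (hrt : t ≤ r) : duh a m r y t = y := by
  simp [duh, expI, Set.Ioc_eq_empty_of_le hrt]

theorem duh_semigroup (h : Freq K a) (hm : Measurable m) (hB : ∀ τ ∈ Set.Ioc r t, |m τ| ≤ B)
    (hrs : r ≤ s) (hst : s ≤ t) : duh a m r y t = duh a m s (duh a m r y s) t := by
  unfold duh
  have hi := h.integrableOn_kernel_mul hm hB
  rw [← Set.Ioc_union_Ioc_eq_Ioc hrs hst] at hi
  rw [← Set.Ioc_union_Ioc_eq_Ioc hrs hst,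
    setIntegral_union (Set.Ioc_disjoint_Ioc_of_le le_rfl) measurableSet_Ioc
      (hi.mono_set Set.subset_union_left) (hi.mono_set Set.subset_union_right),
    ← h.expI_mul hrs hst]
  have : ∫ x in Set.Ioc r s, expI a x t * a x * m x
      = (∫ x in Set.Ioc r s, expI a x s * a x * m x) * expI a s t := by
    rw [← integral_mul_const]
    refine setIntegral_congr_fun measurableSet_Ioc fun x hx => ?_
    simp only [← h.expI_mul hx.2 hst]; ring
  rw [this]; ring

theorem duh_sub_const (h : Freq K a) (hm : Measurable m) (hB : ∀ τ ∈ Set.Ioc r t, |m τ| ≤ B)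
    (hrt : r ≤ t) (c : ℝ) :
    duh a m r y t - c = (y - c) * expI a r t
      + ∫ s in Set.Ioc r t, expI a s t * a s * (m s - c) := by
  have hi := h.integrableOn_kernel_mul hm hB
  have hc := h.integrableOn_kernel_mul (m := fun _ => c) (r := r) (t := t) (B := |c|)
    measurable_const (fun _ _ => le_rfl)
  have e : ∫ s in Set.Ioc r t, expI a s t * a s * (m s - c)
      = (∫ s in Set.Ioc r t, expI a s t * a s * m s)
        - (∫ s in Set.Ioc r t, expI a s t * a s * c) := by
    rw [← integral_sub hi hc]; simp only [mul_sub]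
  rw [e, integral_mul_const, h.mass_left hrt]; unfold duh; ring

theorem le_duh (h : Freq K a) (hy : 0 ≤ y) (hm0 : ∀ τ ∈ Set.Ioc r t, 0 ≤ m τ) (hrt : r ≤ t) :
    y * Real.exp (-(K * (t - r))) ≤ duh a m r y t := by
  unfold duh
  have h1 : 0 ≤ ∫ s in Set.Ioc r t, expI a s t * a s * m s :=
    setIntegral_nonneg measurableSet_Ioc fun τ hτ =>
      mul_nonneg (mul_nonneg (h.expI_pos _ _).le (h.nonneg _)) (hm0 τ hτ)
  have h2 := mul_le_mul_of_nonneg_left (h.le_expI hrt) hy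
  linarith

theorem duh_nonneg (h : Freq K a) (hy : 0 ≤ y) (hm0 : ∀ τ ∈ Set.Ioc r t, 0 ≤ m τ) :
    0 ≤ duh a m r y t := by
  rcases le_total r t with hrt | hrt
  · exact (mul_nonneg hy (Real.exp_pos _).le).trans (le_duh h hy hm0 hrt)
  · rwa [duh_of_le hrt]

theorem duh_le_const (h : Freq K a) (hm : Measurable m) (hB : ∀ τ ∈ Set.Ioc r t, |m τ| ≤ B)
    (hrt : r ≤ t) {c : ℝ} (hy : y ≤ c) (hmc : ∀ τ ∈ Set.Ioc r t, m τ ≤ c) :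
    duh a m r y t ≤ c := by
  have e := duh_sub_const (y := y) h hm hB hrt c
  have h1 : ∫ s in Set.Ioc r t, expI a s t * a s * (m s - c) ≤ 0 :=
    setIntegral_nonpos measurableSet_Ioc fun τ hτ =>
      mul_nonpos_of_nonneg_of_nonpos (mul_nonneg (h.expI_pos _ _).le (h.nonneg _))
        (sub_nonpos.2 (hmc τ hτ))
  have h2 : (y - c) * expI a r t ≤ 0 :=
    mul_nonpos_of_nonpos_of_nonneg (sub_nonpos.2 hy) (h.expI_pos _ _).le
  linarith

theorem duh_le_add (h : Freq K a) (hm : Measurable m) (hB : ∀ τ ∈ Set.Ioc r t, |m τ| ≤ B)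
    (hy : 0 ≤ y) (hm0 : ∀ τ ∈ Set.Ioc r t, 0 ≤ m τ) :
    duh a m r y t ≤ y + ∫ s in Set.Ioc r t, K * m s := by
  unfold duh
  have h1 : y * expI a r t ≤ y * 1 := mul_le_mul_of_nonneg_left (h.expI_le_one _ _) hy
  have h2 : ∫ s in Set.Ioc r t, expI a s t * a s * m s ≤ ∫ s in Set.Ioc r t, K * m s := by
    refine setIntegral_mono_on (h.integrableOn_kernel_mul hm hB)
      ((integrableOn_Ioc_of_bdd hm hB).const_mul K) measurableSet_Ioc fun τ hτ => ?_
    refine mul_le_mul_of_nonneg_right ?_ (hm0 τ hτ)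
    calc expI a τ t * a τ ≤ 1 * K :=
          mul_le_mul (h.expI_le_one _ _) (h.le _) (h.nonneg _) zero_le_one
      _ = K := one_mul K
  linarith

theorem abs_expI_sub_expI_le {a₁ a₂ D : ℝ → ℝ} (h₁ : Freq K a₁) (h₂ : Freq K a₂)
    (hD : IntegrableOn D (Set.Ioc s t)) (hle : ∀ τ ∈ Set.Ioc s t, |a₁ τ - a₂ τ| ≤ D τ) :
    |expI a₁ s t - expI a₂ s t| ≤ ∫ τ in Set.Ioc s t, D τ := by
  have key : ∀ x z : ℝ, 0 ≤ x → 0 ≤ z → |Real.exp (-x) - Real.exp (-z)| ≤ |x - z| := by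
    have : ∀ x z : ℝ, 0 ≤ x → x ≤ z → |Real.exp (-x) - Real.exp (-z)| ≤ |x - z| := by
      intro x z hx hxz
      rw [abs_of_nonneg (sub_nonneg.2 (Real.exp_le_exp.2 (by linarith))),
        abs_of_nonpos (by linarith)]
      have e : Real.exp (-z) = Real.exp (-x) * Real.exp (x - z) := by
        rw [← Real.exp_add]; ring_nf
      rw [e]
      have h1 := Real.add_one_le_exp (x - z)
      have h2 : Real.exp (-x) ≤ 1 := Real.exp_le_one_iff.2 (by linarith)
      have h3 := Real.exp_pos (-x)
      nlinarith
    intro x z hx hz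
    rcases le_total x z with hxz | hxz
    · exact this x z hx hxz
    · rw [abs_sub_comm, abs_sub_comm x]; exact this z x hz hxz
  unfold expI
  refine (key _ _ (h₁.integral_nonneg _ _) (h₂.integral_nonneg _ _)).trans ?_
  rw [← integral_sub (h₁.integrableOn s t) (h₂.integrableOn s t)]
  refine (abs_integral_le_integral_abs).trans ?_
  exact setIntegral_mono_on ((h₁.integrableOn s t).sub (h₂.integrableOn s t)).abs hD
    measurableSet_Ioc hle

theorem abs_duh_sub_duh_le {a₁ a₂ m₁ m₂ D : ℝ → ℝ} {W P : ℝ} (h₁ : Freq K a₁) (h₂ : Freq K a₂)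
    (hm₁ : Measurable m₁) (hm₂ : Measurable m₂) (hW : 0 ≤ W) (hP : 0 ≤ P) (hrt : r ≤ t)
    (hD : IntegrableOn D (Set.Ioc r t)) (hD0 : ∀ τ ∈ Set.Ioc r t, 0 ≤ D τ)
    (hy : |y| ≤ W * P) (hb₁ : ∀ τ ∈ Set.Ioc r t, |m₁ τ| ≤ W * P)
    (hb₂ : ∀ τ ∈ Set.Ioc r t, |m₂ τ| ≤ W * P)
    (ha : ∀ τ ∈ Set.Ioc r t, |a₁ τ - a₂ τ| ≤ D τ)
    (hm : ∀ τ ∈ Set.Ioc r t, |m₁ τ - m₂ τ| ≤ W * D τ) :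
    |duh a₁ m₁ r y t - duh a₂ m₂ r y t|
      ≤ W * (2 * P + K * P * (t - r) + K) * ∫ τ in Set.Ioc r t, D τ := by
  set J := ∫ τ in Set.Ioc r t, D τ with hJ
  have hJ0 : 0 ≤ J := setIntegral_nonneg measurableSet_Ioc hD0
  have hE : ∀ s ∈ Set.Icc r t, |expI a₁ s t - expI a₂ s t| ≤ J := by
    intro s hs
    have hsub : Set.Ioc s t ⊆ Set.Ioc r t := Set.Ioc_subset_Ioc_left hs.1
    refine (abs_expI_sub_expI_le h₁ h₂ (hD.mono_set hsub) fun τ hτ => ha τ (hsub hτ)).trans ?_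
    exact setIntegral_mono_set hD ((ae_restrict_iff' measurableSet_Ioc).2
      (Filter.Eventually.of_forall hD0)) (Filter.Eventually.of_forall hsub)
  have i1 := h₁.integrableOn_kernel_mul hm₁ hb₁
  have i2 := h₂.integrableOn_kernel_mul hm₂ hb₂
  have e : duh a₁ m₁ r y t - duh a₂ m₂ r y t = y * (expI a₁ r t - expI a₂ r t)
      + ∫ s in Set.Ioc r t, (expI a₁ s t * a₁ s * m₁ s - expI a₂ s t * a₂ s * m₂ s) := by
    rw [integral_sub i1 i2]; unfold duh; ring
  have hK := h₁.K_nonneg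
  have hpt : ∀ s ∈ Set.Ioc r t, |expI a₁ s t * a₁ s * m₁ s - expI a₂ s t * a₂ s * m₂ s|
      ≤ J * K * (W * P) + (W * P + K * W) * D s := by
    intro s hs
    have q1 := hE s ⟨hs.1.le, hs.2⟩
    have q2 := ha s hs
    have q3 := hm s hs
    have q4 := hb₁ s hs
    have q5 := h₁.abs_le s
    have q6 := h₂.abs_le s
    have q7 : |expI a₂ s t| ≤ 1 := by
      rw [abs_of_pos (h₂.expI_pos _ _)]; exact h₂.expI_le_one _ _
    have hWP : 0 ≤ W * P := mul_nonneg hW hP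
    calc |expI a₁ s t * a₁ s * m₁ s - expI a₂ s t * a₂ s * m₂ s|
        = |(expI a₁ s t - expI a₂ s t) * a₁ s * m₁ s + (expI a₂ s t * (a₁ s - a₂ s) * m₁ s
            + expI a₂ s t * a₂ s * (m₁ s - m₂ s))| := by ring_nf
      _ ≤ |(expI a₁ s t - expI a₂ s t) * a₁ s * m₁ s| + (|expI a₂ s t * (a₁ s - a₂ s) * m₁ s|
            + |expI a₂ s t * a₂ s * (m₁ s - m₂ s)|) :=
          (abs_add_le _ _).trans (add_le_add le_rfl (abs_add_le _ _))
      _ ≤ J * K * (W * P) + (1 * D s * (W * P) + 1 * K * (W * D s)) := by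
          simp only [abs_mul]
          have := hD0 s hs
          gcongr
      _ = _ := by ring
  rw [e]
  have hIntegral : |∫ s in Set.Ioc r t, (expI a₁ s t * a₁ s * m₁ s - expI a₂ s t * a₂ s * m₂ s)|
      ≤ J * K * (W * P) * (t - r) + (W * P + K * W) * J := by
    refine (abs_integral_le_integral_abs).trans ?_
    have c1 : Integrable (fun _ : ℝ => J * K * (W * P)) (volume.restrict (Set.Ioc r t)) :=
      integrable_const _
    have c2 : Integrable (fun s => (W * P + K * W) * D s) (volume.restrict (Set.Ioc r t)) :=
      Integrable.const_mul hD _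
    refine (setIntegral_mono_on (i1.sub i2).abs (c1.add c2) measurableSet_Ioc hpt).trans
      (le_of_eq ?_)
    simp only [Pi.add_apply]
    rw [integral_add c1 c2, integral_const, integral_const_mul, ← hJ]
    simp [hrt]; ring
  have h0 : |y * (expI a₁ r t - expI a₂ r t)| ≤ W * P * J := by
    rw [abs_mul]
    have := hE r ⟨le_rfl, hrt⟩
    gcongr
  refine (abs_add_le _ _).trans ((add_le_add h0 hIntegral).trans (le_of_eq ?_))
  ring

end Duhamel

end ESBGK

namespace ESBGK

/-! ### The relative entropy integrand -/

/-- Relative entropy density `z log (z / m) - z + m`. -/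
noncomputable def hent (m z : ℝ) : ℝ := z * Real.log z - (1 + Real.log m) * z + m

theorem young_mul_log {z : ℝ} (hz : 0 ≤ z) (p : ℝ) : p * z - Real.exp p ≤ z * Real.log z - z := by
  rcases hz.eq_or_lt with rfl | hz
  · simp [(Real.exp_pos p).le]
  · have h := Real.add_one_le_exp (p - Real.log z)
    rw [Real.exp_sub, Real.exp_log hz, le_div_iff₀ hz] at h
    linarith

theorem hent_young {m z : ℝ} (hz : 0 ≤ z) (p : ℝ) :
    (p - Real.log m) * z - Real.exp p + m ≤ hent m z := by
  have := young_mul_log hz p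
  unfold hent; linarith

theorem hent_nonneg {m z : ℝ} (hm : 0 < m) (hz : 0 ≤ z) : 0 ≤ hent m z := by
  have := hent_young (m := m) hz (Real.log m)
  rw [Real.exp_log hm] at this; linarith

theorem abs_sub_le_hent {m z η : ℝ} (hm : 0 < m) (hz : 0 ≤ z) (hη : 0 < η) (hη1 : η ≤ 1) :
    |z - m| ≤ η * m + η⁻¹ * hent m z := by
  have key : ∀ σ : ℝ, |σ| = η → σ * (z - m) ≤ hent m z + m * η ^ 2 := by
    intro σ hσ
    have h := hent_young (m := m) hz (Real.log m + σ)
    rw [Real.exp_add, Real.exp_log hm] at h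
    have h2 := (abs_le.1 (Real.abs_exp_sub_one_sub_id_le (x := σ) (by rw [hσ]; exact hη1))).2
    rw [← sq_abs, hσ] at h2
    nlinarith
  have h1 := key η (abs_of_pos hη)
  have h2 := key (-η) (by rw [abs_neg, abs_of_pos hη])
  have h3 : |z - m| * η ≤ hent m z + m * η ^ 2 := by
    rcases abs_cases (z - m) with h | h <;> rw [h.1] <;> linarith
  calc |z - m| = η⁻¹ * (|z - m| * η) := by field_simp
    _ ≤ η⁻¹ * (hent m z + m * η ^ 2) := by gcongr
    _ = _ := by field_simp; ring

theorem hent_le_of_forall {m y X : ℝ} (hy : 0 ≤ y)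
    (h : ∀ p : ℝ, (p - Real.log m) * y - Real.exp p + m ≤ X) : hent m y ≤ X := by
  rcases hy.eq_or_lt with rfl | hy
  · simp only [hent, zero_mul, mul_zero, sub_zero, zero_add]
    refine le_of_forall_pos_le_add fun ε hε => ?_
    have := h (Real.log ε)
    rw [Real.exp_log hε] at this; linarith
  · have := h (Real.log y)
    rw [Real.exp_log hy] at this
    unfold hent; linarith

theorem continuous_hent (m : ℝ) : Continuous (hent m) := by
  unfold hent
  have := Real.continuous_mul_log
  fun_prop

theorem measurable_hent : Measurable fun p : ℝ × ℝ => hent p.1 p.2 := by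
  unfold hent
  fun_prop

theorem exists_hent_bound (m B : ℝ) : ∃ C, ∀ z ∈ Set.Icc 0 B, |hent m z| ≤ C := by
  obtain ⟨C, hC⟩ := isCompact_Icc.exists_bound_of_continuousOn (s := Set.Icc 0 B)
    (continuous_hent m).continuousOn
  exact ⟨C, hC⟩

section Duhamel

variable {K B r s t y : ℝ} {a m : ℝ → ℝ}

theorem hent_duh_le {q : ℝ} (h : Freq K a) (hm : Measurable m) (hrt : r ≤ t) (hy : 0 ≤ y)
    (hB : ∀ τ ∈ Set.Ioc r t, m τ ∈ Set.Icc 0 B) :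
    hent q (duh a m r y t) ≤ duh a (fun s => hent q (m s)) r (hent q y) t := by
  have hB' : ∀ τ ∈ Set.Ioc r t, |m τ| ≤ B := fun τ hτ => by
    rw [abs_of_nonneg (hB τ hτ).1]; exact (hB τ hτ).2
  obtain ⟨C, hC⟩ := exists_hent_bound q B
  have hmh : Measurable fun s => hent q (m s) := (continuous_hent q).measurable.comp hm
  have hCh : ∀ τ ∈ Set.Ioc r t, |hent q (m τ)| ≤ C := fun τ hτ => hC _ (hB τ hτ)
  refine hent_le_of_forall (duh_nonneg h hy fun τ hτ => (hB τ hτ).1) fun p => ?_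
  have e1 := duh_sub_const (y := hent q y) h hmh hCh hrt (-Real.exp p + q)
  have e2 := duh_sub_const (y := y) h hm hB' hrt 0
  have i1 := h.integrableOn_kernel_mul (hmh.sub_const (-Real.exp p + q)) (r := r) (t := t)
    (B := C + |-Real.exp p + q|) (fun τ hτ => (abs_sub _ _).trans
      (add_le_add (hCh τ hτ) le_rfl))
  have i2 := h.integrableOn_kernel_mul hm hB'
  have hIntegral : (p - Real.log q) * ∫ s in Set.Ioc r t, expI a s t * a s * m s
      ≤ ∫ s in Set.Ioc r t, expI a s t * a s * (hent q (m s) - (-Real.exp p + q)) := by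
    rw [← integral_const_mul]
    refine setIntegral_mono_on (Integrable.const_mul i2 _) i1 measurableSet_Ioc fun τ hτ => ?_
    have h1 := hent_young (m := q) (hB τ hτ).1 p
    have h2 : 0 ≤ expI a τ t * a τ := mul_nonneg (h.expI_pos _ _).le (h.nonneg _)
    nlinarith [mul_le_mul_of_nonneg_left h1 h2]
  have h0 : (p - Real.log q) * (y * expI a r t)
      ≤ (hent q y - (-Real.exp p + q)) * expI a r t := by
    have h1 := hent_young (m := q) hy p
    nlinarith [mul_le_mul_of_nonneg_right h1 (h.expI_pos r t).le]
  have e3 : duh a m r y t = y * expI a r t + ∫ s in Set.Ioc r t, expI a s t * a s * m s := rfl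
  have e4 : (p - Real.log q) * duh a m r y t = (p - Real.log q) * (y * expI a r t)
    + (p - Real.log q) * ∫ s in Set.Ioc r t, expI a s t * a s * m s := by rw [e3]; ring
  linarith

theorem measurable_duh (h : Freq K a) (hm : Measurable m) (r y : ℝ) :
    Measurable fun t => duh a m r y t := by
  unfold duh
  refine ((h.measurable_expI_right r).const_mul y).add ?_
  refine measurable_setIntegral_Ioc (f := fun t s => expI a s t * a s * m s) ?_
    measurable_const measurable_id
  exact ((h.measurable_expI.comp measurable_swap).mul (h.meas.comp measurable_snd)).mul
    (hm.comp measurable_snd)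

theorem abs_duh_le (h : Freq K a) (hm : Measurable m) (hB : ∀ τ ∈ Set.Ioc r t, |m τ| ≤ B)
    (hrt : r ≤ t) : |duh a m r y t| ≤ |y| + |B| := by
  have hB' : ∀ τ ∈ Set.Ioc r t, |m τ| ≤ |B| := fun τ hτ => (hB τ hτ).trans (le_abs_self B)
  rw [abs_le]
  constructor
  · have := duh_le_const (y := -y) (m := fun s => -m s) (c := |y| + |B|) h hm.neg
      (by simpa using hB') hrt (by linarith [neg_le_abs y, abs_nonneg B])
      (fun τ hτ => by linarith [neg_le_abs (m τ), hB' τ hτ, abs_nonneg y])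
    have e : duh a (fun s => -m s) r (-y) t = -duh a m r y t := by
      simp only [duh, mul_neg, neg_mul, integral_neg]; ring
    linarith
  · exact duh_le_const h hm hB' hrt (by linarith [le_abs_self y, abs_nonneg B])
      (fun τ hτ => by linarith [le_abs_self (m τ), hB' τ hτ, abs_nonneg y])

theorem duh_add_integral (h : Freq K a) (hm : Measurable m) (hB : ∀ τ ∈ Set.Ioc r t, |m τ| ≤ B)
    (hrt : r ≤ t) :
    duh a m r y t + ∫ s in Set.Ioc r t, a s * duh a m r y s = y + ∫ s in Set.Ioc r t, a s * m s := by
  set ν := (volume : Measure ℝ).restrict (Set.Ioc r t) with hν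
  set f : ℝ → ℝ → ℝ := fun s x => {p : ℝ × ℝ | p.2 ≤ p.1}.indicator
    (fun p => a p.1 * (expI a p.2 p.1 * a p.2 * m p.2)) (s, x) with hf
  have hfm : Measurable (Function.uncurry f) := by
    have : Measurable ({p : ℝ × ℝ | p.2 ≤ p.1}.indicator
      (fun p => a p.1 * (expI a p.2 p.1 * a p.2 * m p.2))) :=
      ((h.meas.comp measurable_fst).mul (((h.measurable_expI.comp measurable_swap).mul
        (h.meas.comp measurable_snd)).mul (hm.comp measurable_snd))).indicator
        (measurableSet_le measurable_snd measurable_fst)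
    exact this
  have hK := h.K_nonneg
  have hfb : ∀ᵐ p ∂(ν.prod ν), ‖Function.uncurry f p‖ ≤ K * (1 * K * |B|) := by
    rw [hν, Measure.prod_restrict, ae_restrict_iff' (measurableSet_Ioc.prod measurableSet_Ioc)]
    refine Filter.Eventually.of_forall fun p hp => ?_
    simp only [Function.uncurry, hf]
    refine (norm_indicator_le_norm_self _ _).trans ?_
    rw [Real.norm_eq_abs, abs_mul, abs_mul, abs_mul]
    have h1 : |expI a p.2 p.1| ≤ 1 := by rw [abs_of_pos (h.expI_pos _ _)]; exact h.expI_le_one _ _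
    have h2 := h.abs_le p.1
    have h3 := h.abs_le p.2
    have h4 := (hB p.2 hp.2).trans (le_abs_self B)
    gcongr
  have hfi : Integrable (Function.uncurry f) (ν.prod ν) := by
    refine Integrable.mono' (integrable_const (K * (1 * K * |B|))) hfm.aestronglyMeasurable hfb
  have hswap := integral_integral_swap hfi
  have hB1 := h.integrableOn_mul hm hB
  have i2 : Integrable (fun s => a s * (y * expI a r s)) ν := by
    refine integrableOn_Ioc_of_bdd (B := K * (|y| * 1))
      (h.meas.mul ((h.measurable_expI_right r).const_mul y)) fun τ _ => ?_
    rw [abs_mul, abs_mul, abs_of_pos (h.expI_pos _ _)]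
    have h1 := h.expI_le_one r τ
    have h2 := h.abs_le τ
    have := (h.expI_pos r τ).le
    gcongr
  have l1 : ∀ s ∈ Set.Ioc r t, ∫ x, f s x ∂ν
      = a s * ∫ x in Set.Ioc r s, expI a x s * a x * m x := by
    intro s hs
    rw [← integral_const_mul, hν, ← integral_indicator measurableSet_Ioc,
      ← integral_indicator measurableSet_Ioc]
    congr 1; ext x
    by_cases hx : x ≤ s
    · by_cases hx' : r < x
      · simp [Set.indicator, hf, hx, hx', hx.trans hs.2]
      · simp [Set.indicator, hx']
    · simp [Set.indicator, hf, hx]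
  have l2 : ∀ x ∈ Set.Ioc r t, ∫ s, f s x ∂ν = a x * m x * (1 - expI a x t) := by
    intro x hx
    rw [← h.mass_right hx.2, ← integral_const_mul,
      ← integral_Icc_eq_integral_Ioc (x := x), hν, ← integral_indicator measurableSet_Ioc,
      ← integral_indicator measurableSet_Icc]
    congr 1; ext s
    by_cases hs : x ≤ s
    · by_cases hs' : s ≤ t
      · simp [Set.indicator, hf, hs, hs', hx.1.trans_le hs]; ring
      · simp [Set.indicator, hs']
    · simp [Set.indicator, hf, hs]
  have e1 : ∫ s in Set.Ioc r t, a s * duh a m r y s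
      = (∫ s, a s * (y * expI a r s) ∂ν) + ∫ s, (∫ x, f s x ∂ν) ∂ν := by
    have i4 : Integrable (fun s => ∫ x, f s x ∂ν) ν := hfi.integral_prod_left
    rw [← integral_add i2 i4]
    refine setIntegral_congr_fun measurableSet_Ioc fun s hs => ?_
    rw [show ∫ x, f s x ∂ν = _ from l1 s hs]; unfold duh; ring
  have e2 : ∫ s, a s * (y * expI a r s) ∂ν = y * (1 - expI a r t) := by
    rw [← h.mass_right hrt, ← integral_const_mul]; congr 1; ext s; ring
  have e3 : ∫ x, (∫ s, f s x ∂ν) ∂ν = (∫ s in Set.Ioc r t, a s * m s)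
      - ∫ s in Set.Ioc r t, expI a s t * a s * m s := by
    rw [← integral_sub hB1 (h.integrableOn_kernel_mul hm hB)]
    refine setIntegral_congr_fun measurableSet_Ioc fun x hx => ?_
    rw [show ∫ s, f s x ∂ν = _ from l2 x hx]; ring
  rw [e1, hswap, e2, e3]; unfold duh; ring

/-- Entropy inequality along a characteristic. -/
theorem hent_duh_add_lintegral_le {q : ℝ} (hq : 0 < q) (h : Freq K a) (hm : Measurable m)
    (hrt : r ≤ t) (hy : 0 ≤ y) (hB : ∀ τ ∈ Set.Ioc r t, m τ ∈ Set.Icc 0 B) :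
    ENNReal.ofReal (hent q (duh a m r y t))
        + ∫⁻ s in Set.Ioc r t, ENNReal.ofReal (a s * hent q (duh a m r y s))
      ≤ ENNReal.ofReal (hent q y) + ∫⁻ s in Set.Ioc r t, ENNReal.ofReal (a s * hent q (m s)) := by
  obtain ⟨C, hC⟩ := exists_hent_bound q B
  obtain ⟨C', hC'⟩ := exists_hent_bound q (|y| + |B|)
  have hmh : Measurable fun s => hent q (m s) := (continuous_hent q).measurable.comp hm
  have hCh : ∀ τ ∈ Set.Ioc r t, |hent q (m τ)| ≤ C := fun τ hτ => hC _ (hB τ hτ)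
  have hB' : ∀ τ ∈ Set.Ioc r t, |m τ| ≤ B := fun τ hτ => by
    rw [abs_of_nonneg (hB τ hτ).1]; exact (hB τ hτ).2
  have sub : ∀ s ≤ t, Set.Ioc r s ⊆ Set.Ioc r t := fun s hs => Set.Ioc_subset_Ioc_right hs
  have hG0 : ∀ s ≤ t, 0 ≤ duh a m r y s := fun s hs =>
    duh_nonneg h hy fun τ hτ => (hB τ (sub s hs hτ)).1
  have hGb : ∀ s ∈ Set.Ioc r t, |hent q (duh a m r y s)| ≤ C' := fun s hs => by
    refine hC' _ ⟨hG0 s hs.2, (le_abs_self _).trans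
      (abs_duh_le h hm (fun τ hτ => hB' τ (sub s hs.2 hτ)) hs.1.le)⟩
  have i1 : IntegrableOn (fun s => a s * hent q (duh a m r y s)) (Set.Ioc r t) :=
    h.integrableOn_mul ((continuous_hent q).measurable.comp (measurable_duh h hm r y)) hGb
  have i2 := h.integrableOn_mul hmh hCh
  have i3 := h.integrableOn_mul (measurable_duh h hmh r (hent q y)) (r := r) (t := t)
    (B := |hent q y| + |C|) fun τ hτ => abs_duh_le h hmh (fun x hx => hCh x (sub τ hτ.2 hx)) hτ.1.le
  have key := duh_add_integral (y := hent q y) h hmh hCh hrt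
  have k1 := hent_duh_le (q := q) h hm hrt hy hB
  have k2 : ∫ s in Set.Ioc r t, a s * hent q (duh a m r y s)
      ≤ ∫ s in Set.Ioc r t, a s * duh a (fun s => hent q (m s)) r (hent q y) s := by
    refine setIntegral_mono_on i1 i3 measurableSet_Ioc fun s hs => ?_
    exact mul_le_mul_of_nonneg_left
      (hent_duh_le h hm hs.1.le hy fun τ hτ => hB τ (sub s hs.2 hτ)) (h.nonneg s)
  rw [← ofReal_integral_eq_lintegral_ofReal i1 ((ae_restrict_iff' measurableSet_Ioc).2
      (Filter.Eventually.of_forall fun s hs => mul_nonneg (h.nonneg s)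
        (hent_nonneg hq (hG0 s hs.2)))),
    ← ofReal_integral_eq_lintegral_ofReal i2 ((ae_restrict_iff' measurableSet_Ioc).2
      (Filter.Eventually.of_forall fun s hs => mul_nonneg (h.nonneg s)
        (hent_nonneg hq (hB s hs).1))),
    ← ENNReal.ofReal_add (hent_nonneg hq (hG0 t le_rfl)) (setIntegral_nonneg measurableSet_Ioc
      fun s hs => mul_nonneg (h.nonneg s) (hent_nonneg hq (hG0 s hs.2))),
    ← ENNReal.ofReal_add (hent_nonneg hq hy) (setIntegral_nonneg measurableSet_Ioc
      fun s hs => mul_nonneg (h.nonneg s) (hent_nonneg hq (hB s hs).1))]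
  refine ENNReal.ofReal_le_ofReal ?_
  linarith

theorem ofReal_hent_duh_le {q : ℝ} (hq : 0 < q) (h : Freq K a) (hm : Measurable m)
    (hrt : r ≤ t) (hy : 0 ≤ y) (hB : ∀ τ ∈ Set.Ioc r t, m τ ∈ Set.Icc 0 B) :
    ENNReal.ofReal (hent q (duh a m r y t))
      ≤ ENNReal.ofReal (hent q y)
        + ∫⁻ s in Set.Ioc r t, ENNReal.ofReal K * ENNReal.ofReal (hent q (m s)) := by
  refine (le_self_add.trans (hent_duh_add_lintegral_le hq h hm hrt hy hB)).trans ?_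
  gcongr 1
  refine setLIntegral_mono' measurableSet_Ioc fun s hs => ?_
  rw [← ENNReal.ofReal_mul h.K_nonneg]
  exact ENNReal.ofReal_le_ofReal
    (mul_le_mul_of_nonneg_right (h.le s) (hent_nonneg hq (hB s hs).1))

end Duhamel

end ESBGK

namespace ESBGK

/-! ### Gaussian integrals -/

theorem integrable_pow_mul_gaussian (n : ℕ) :
    Integrable fun x : ℝ => x ^ n * ProbabilityTheory.gaussianPDFReal 0 1 x := by
  have h := integrable_rpow_mul_exp_neg_mul_sq (b := 1 / 2) (s := n) (by norm_num) (by
    have : (0 : ℝ) ≤ n := Nat.cast_nonneg n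
    linarith)
  have := h.const_mul (√(2 * π))⁻¹
  refine this.congr (Filter.Eventually.of_forall fun x => ?_)
  simp only [ProbabilityTheory.gaussianPDFReal, Real.rpow_natCast]
  norm_num
  ring_nf

theorem integral_pow_mul_gaussian {n : ℕ} (hn : n ≤ 2) :
    ∫ x : ℝ, x ^ n * ProbabilityTheory.gaussianPDFReal 0 1 x = if n = 1 then 0 else 1 := by
  have e : ∀ n : ℕ, ∫ x : ℝ, x ^ n * ProbabilityTheory.gaussianPDFReal 0 1 x
      = ∫ x, x ^ n ∂(ProbabilityTheory.gaussianReal 0 1) := by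
    intro n
    rw [ProbabilityTheory.integral_gaussianReal_eq_integral_smul (by norm_num)]
    simp [mul_comm]
  rw [e]
  interval_cases n
  · simp
  · simp
  · have h := ProbabilityTheory.variance_id_gaussianReal (μ := 0) (v := 1)
    rw [ProbabilityTheory.variance_eq_integral aemeasurable_id] at h
    simpa using h

theorem Mw_eq_prod (v : E3) :
    Mw v = ∏ i, ProbabilityTheory.gaussianPDFReal 0 1 (v i) := by
  have h3 : (√(2 * π))⁻¹ * (√(2 * π))⁻¹ * (√(2 * π))⁻¹ = (2 * π) ^ (-(3 : ℝ) / 2) := by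
    rw [Real.sqrt_eq_rpow, ← Real.rpow_neg (by positivity), ← Real.rpow_add (by positivity),
      ← Real.rpow_add (by positivity)]
    norm_num
  simp only [Mw, ProbabilityTheory.gaussianPDFReal, Fin.prod_univ_three, EuclideanSpace.norm_sq_eq,
    Fin.sum_univ_three, Real.norm_eq_abs, sq_abs, ← h3]
  simp only [sub_zero, NNReal.coe_one, mul_one]
  rw [show -(v 0 ^ 2 + v 1 ^ 2 + v 2 ^ 2) / 2 = -v 0 ^ 2 / 2 + -v 1 ^ 2 / 2 + -v 2 ^ 2 / 2 by ring,
    Real.exp_add, Real.exp_add]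
  ring

theorem Mw_pos (v : E3) : 0 < Mw v := by
  unfold Mw; positivity

theorem continuous_Mw : Continuous Mw := by
  unfold Mw; fun_prop

theorem log_Mw (v : E3) : Real.log (Mw v) = -(3 / 2) * Real.log (2 * π) - ‖v‖ ^ 2 / 2 := by
  unfold Mw
  rw [Real.log_mul (by positivity) (by positivity), Real.log_rpow (by positivity), Real.log_exp]
  ring

theorem integral_prod_mul_Mw (p : Fin 3 → ℝ → ℝ) :
    ∫ v : E3, (∏ i, p i (v i)) * Mw v
      = ∏ i, ∫ x, p i x * ProbabilityTheory.gaussianPDFReal 0 1 x := by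
  simp_rw [Mw_eq_prod, ← Finset.prod_mul_distrib]
  rw [← integral_fintype_prod_volume_eq_prod
    (fun i x => p i x * ProbabilityTheory.gaussianPDFReal 0 1 x),
    ← (EuclideanSpace.volume_preserving_symm_measurableEquiv_toLp (Fin 3)).symm.integral_comp
      (MeasurableEquiv.measurableEmbedding _)]
  rfl

theorem integrable_prod_mul_Mw {p : Fin 3 → ℝ → ℝ}
    (hp : ∀ i, Integrable fun x => p i x * ProbabilityTheory.gaussianPDFReal 0 1 x) :
    Integrable fun v : E3 => (∏ i, p i (v i)) * Mw v := by
  simp_rw [Mw_eq_prod, ← Finset.prod_mul_distrib]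
  have := Integrable.fintype_prod hp
  exact ((EuclideanSpace.volume_preserving_symm_measurableEquiv_toLp (Fin 3)).integrable_comp_emb
    (MeasurableEquiv.measurableEmbedding _)).2 this

theorem prod_pow_indicator (i j : Fin 3) (v : E3) :
    v i * v j = ∏ k, v k ^ ((if k = i then 1 else 0) + if k = j then 1 else 0 : ℕ) := by
  simp_rw [pow_add, Finset.prod_mul_distrib]
  simp [Finset.prod_ite_eq', pow_ite]

theorem integrable_Mw : Integrable Mw := by
  have := integrable_prod_mul_Mw (p := fun _ _ => 1) fun i => by
    simpa using integrable_pow_mul_gaussian 0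
  simpa using this

theorem integral_Mw : ∫ v, Mw v = 1 := by
  have := integral_prod_mul_Mw fun _ _ => 1
  have h := integral_pow_mul_gaussian (n := 0) (by norm_num)
  simp at h
  simpa [h] using this

theorem coord_eq_prod (i : Fin 3) (v : E3) :
    v i = ∏ k, v k ^ (if k = i then 1 else 0 : ℕ) := by
  simp [Finset.prod_ite_eq', pow_ite]

theorem integrable_coord_mul_Mw (i : Fin 3) : Integrable fun v : E3 => v i * Mw v := by
  have := integrable_prod_mul_Mw (p := fun k x => x ^ (if k = i then 1 else 0 : ℕ)) fun k =>
    integrable_pow_mul_gaussian _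
  simpa only [← coord_eq_prod] using this

theorem integral_coord_mul_Mw (i : Fin 3) : ∫ v : E3, v i * Mw v = 0 := by
  have := integral_prod_mul_Mw fun k x => x ^ (if k = i then 1 else 0 : ℕ)
  simp only [← coord_eq_prod] at this
  rw [this]
  refine Finset.prod_eq_zero (Finset.mem_univ i) ?_
  rw [integral_pow_mul_gaussian (by simp)]
  simp

theorem integrable_coord_mul_coord_mul_Mw (i j : Fin 3) :
    Integrable fun v : E3 => v i * v j * Mw v := by
  have := integrable_prod_mul_Mw
    (p := fun k x => x ^ ((if k = i then 1 else 0) + if k = j then 1 else 0 : ℕ)) fun k =>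
    integrable_pow_mul_gaussian _
  simpa only [← prod_pow_indicator] using this

theorem integral_coord_mul_coord_mul_Mw (i j : Fin 3) :
    ∫ v : E3, v i * v j * Mw v = if i = j then 1 else 0 := by
  have := integral_prod_mul_Mw
    fun k x => x ^ ((if k = i then 1 else 0) + if k = j then 1 else 0 : ℕ)
  simp only [← prod_pow_indicator] at this
  rw [this]
  split_ifs with h
  · subst h
    refine Finset.prod_eq_one fun k _ => ?_
    rw [integral_pow_mul_gaussian (by split_ifs <;> norm_num)]
    by_cases hk : k = i <;> simp [hk]
  · refine Finset.prod_eq_zero (Finset.mem_univ i) ?_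
    rw [integral_pow_mul_gaussian (by split_ifs <;> norm_num)]
    simp [h]

end ESBGK

namespace ESBGK

/-- The quadratic form `xᵀ A x`. -/
noncomputable def quad (A : Matrix (Fin 3) (Fin 3) ℝ) (x : E3) : ℝ :=
  (fun i => x i) ⬝ᵥ (A *ᵥ fun i => x i)

/-- The Gaussian with mass `ρ`, mean `u` and covariance `A`. -/
noncomputable def gauss (ρ : ℝ) (u : E3) (A : Matrix (Fin 3) (Fin 3) ℝ) (v : E3) : ℝ :=
  ρ / Real.sqrt (((2 * π) • A).det) * Real.exp (-(1 / 2) * quad A⁻¹ (v - u))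

theorem aGauss_eq_gauss (g : E3 → ℝ) (ν : ℝ) :
    aGauss g ν = gauss (dens g) (bulk g) (tempTensor g ν) := rfl

theorem quad_eq_sum (A : Matrix (Fin 3) (Fin 3) ℝ) (x : E3) :
    quad A x = ∑ i, ∑ j, A i j * (x i * x j) := by
  simp only [quad, dotProduct, mulVec, Finset.mul_sum]
  refine Finset.sum_congr rfl fun i _ => Finset.sum_congr rfl fun j _ => by ring

theorem sqrt_det_two_pi_smul (A : Matrix (Fin 3) (Fin 3) ℝ) :
    Real.sqrt (((2 * π) • A).det) = (2 * π) ^ ((3 : ℝ) / 2) * Real.sqrt A.det := by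
  rw [det_smul, Fintype.card_fin, Real.sqrt_mul (by positivity)]
  congr 1
  rw [Real.sqrt_eq_rpow, ← Real.rpow_natCast, ← Real.rpow_mul (by positivity)]
  norm_num

section ChangeOfVariables

variable {A B : Matrix (Fin 3) (Fin 3) ℝ}

theorem exists_mul_transpose_of_posDef (hA : A.PosDef) :
    ∃ B : Matrix (Fin 3) (Fin 3) ℝ, A = B * Bᵀ ∧ B.det ≠ 0 := by
  open scoped MatrixOrder in
  obtain ⟨C, hC⟩ := CStarAlgebra.nonneg_iff_eq_star_mul_self.mp hA.posSemidef.nonneg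
  refine ⟨Cᵀ, by simpa [star_eq_conjTranspose] using hC, fun h => ?_⟩
  have := hA.det_pos
  rw [hC, det_mul] at this
  rw [det_transpose] at h
  simp [h] at this

theorem det_toEuclideanLin (B : Matrix (Fin 3) (Fin 3) ℝ) :
    LinearMap.det (toEuclideanLin B) = B.det := by
  rw [toEuclideanLin, toLpLin_eq_toLin, LinearMap.det_toLin]

theorem quad_inv_toEuclideanLin (hB : B.det ≠ 0) (z : E3) :
    quad (B * Bᵀ)⁻¹ (toEuclideanLin B z) = ‖z‖ ^ 2 := by
  have hu : IsUnit B.det := isUnit_iff_ne_zero.2 hB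
  have hu' : IsUnit Bᵀ.det := by rwa [det_transpose]
  have e : (fun i => toEuclideanLin B z i) = B *ᵥ fun i => z i := by
    ext i; simp [toEuclideanLin, toLpLin_apply]
  unfold quad
  rw [e, mulVec_mulVec, Matrix.mul_inv_rev, Matrix.mul_assoc, nonsing_inv_mul B hu, Matrix.mul_one,
    dotProduct_comm, dotProduct_mulVec, ← mulVec_transpose, mulVec_mulVec,
    mul_nonsing_inv _ hu', one_mulVec]
  rw [EuclideanSpace.norm_sq_eq]
  simp [dotProduct, sq]

theorem det_mul_gauss (hB : B.det ≠ 0) (u z : E3) :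
    |B.det| * gauss 1 u (B * Bᵀ) (u + toEuclideanLin B z) = Mw z := by
  unfold gauss Mw
  rw [add_sub_cancel_left, quad_inv_toEuclideanLin hB, sqrt_det_two_pi_smul, det_mul,
    det_transpose, Real.sqrt_mul_self_eq_abs, show -(3 : ℝ) / 2 = -(3 / 2) by norm_num,
    Real.rpow_neg (by positivity)]
  have := abs_pos.2 hB
  field_simp

theorem bijective_toEuclideanLin (hB : B.det ≠ 0) (u : E3) :
    Function.Bijective fun z => u + toEuclideanLin B z := by
  have h : IsUnit (toEuclideanLin B) := by
    rw [LinearMap.isUnit_iff_isUnit_det, det_toEuclideanLin]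
    exact isUnit_iff_ne_zero.2 hB
  exact (AddGroup.addLeft_bijective u).comp ((Module.End.isUnit_iff _).1 h)

theorem hasFDerivWithinAt_toEuclideanLin (B : Matrix (Fin 3) (Fin 3) ℝ) (u : E3) (s : Set E3)
    (z : E3) : HasFDerivWithinAt (fun z => u + toEuclideanLin B z)
      (toEuclideanLin B).toContinuousLinearMap s z :=
  ((toEuclideanLin B).toContinuousLinearMap.hasFDerivWithinAt).const_add u

theorem abs_det_mul_gauss (hB : B.det ≠ 0) (u : E3) (φ : E3 → ℝ) (z : E3) :
    |(toEuclideanLin B).toContinuousLinearMap.det| •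
      (φ (u + toEuclideanLin B z) * gauss 1 u (B * Bᵀ) (u + toEuclideanLin B z))
      = φ (u + toEuclideanLin B z) * Mw z := by
  rw [LinearMap.det_toContinuousLinearMap, det_toEuclideanLin, ← det_mul_gauss hB u, smul_eq_mul]
  ring

theorem integral_mul_gauss (hB : B.det ≠ 0) (u : E3) (φ : E3 → ℝ) :
    ∫ v, φ v * gauss 1 u (B * Bᵀ) v = ∫ z, φ (u + toEuclideanLin B z) * Mw z := by
  have hbij := bijective_toEuclideanLin hB u
  have := integral_image_eq_integral_abs_det_fderiv_smul volume MeasurableSet.univ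
    (fun z _ => hasFDerivWithinAt_toEuclideanLin B u Set.univ z) hbij.injective.injOn
    fun v => φ v * gauss 1 u (B * Bᵀ) v
  rw [Set.image_univ, hbij.surjective.range_eq] at this
  simpa only [Measure.restrict_univ, abs_det_mul_gauss hB] using this

theorem integrable_mul_gauss (hB : B.det ≠ 0) (u : E3) {φ : E3 → ℝ}
    (h : Integrable fun z => φ (u + toEuclideanLin B z) * Mw z) :
    Integrable fun v => φ v * gauss 1 u (B * Bᵀ) v := by
  have hbij := bijective_toEuclideanLin hB u
  have := integrableOn_image_iff_integrableOn_abs_det_fderiv_smul volume MeasurableSet.univ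
    (fun z _ => hasFDerivWithinAt_toEuclideanLin B u Set.univ z) hbij.injective.injOn
    fun v => φ v * gauss 1 u (B * Bᵀ) v
  rw [Set.image_univ, hbij.surjective.range_eq] at this
  simp only [abs_det_mul_gauss hB, integrableOn_univ] at this
  exact this.2 h

theorem gauss_eq_mul (ρ : ℝ) (u : E3) (A : Matrix (Fin 3) (Fin 3) ℝ) (v : E3) :
    gauss ρ u A v = ρ * gauss 1 u A v := by
  unfold gauss; ring

theorem integral_gauss (hA : A.PosDef) (u : E3) :
    Integrable (gauss 1 u A) ∧ ∫ v, gauss 1 u A v = 1 := by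
  obtain ⟨B, rfl, hB⟩ := exists_mul_transpose_of_posDef hA
  have h1 := integrable_mul_gauss hB u (φ := fun _ => 1) (by simpa using integrable_Mw)
  have h2 := integral_mul_gauss hB u fun _ => 1
  simp only [one_mul] at h1 h2
  exact ⟨h1, h2.trans integral_Mw⟩

theorem toEuclideanLin_coord (B : Matrix (Fin 3) (Fin 3) ℝ) (z : E3) (i : Fin 3) :
    toEuclideanLin B z i = ∑ k, B i k * z k := by
  simp [toEuclideanLin, toLpLin_apply, mulVec, dotProduct]

theorem integral_coord_mul_gauss (hA : A.PosDef) (u : E3) (i : Fin 3) :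
    Integrable (fun v => (v - u) i * gauss 1 u A v) ∧ ∫ v, (v - u) i * gauss 1 u A v = 0 := by
  obtain ⟨B, rfl, hB⟩ := exists_mul_transpose_of_posDef hA
  have e : ∀ z : E3, (u + toEuclideanLin B z - u) i * Mw z = ∑ k, B i k * (z k * Mw z) := by
    intro z
    rw [add_sub_cancel_left, toEuclideanLin_coord, Finset.sum_mul]
    simp only [mul_assoc]
  have hi : ∀ k ∈ Finset.univ, Integrable fun z : E3 => B i k * (z k * Mw z) :=
    fun k _ => (integrable_coord_mul_Mw k).const_mul _
  refine ⟨integrable_mul_gauss hB u (φ := fun v => (v - u) i) ?_, ?_⟩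
  · simp only [e]; exact integrable_finsetSum _ hi
  · rw [integral_mul_gauss hB u fun v => (v - u) i]
    simp only [e]
    rw [integral_finsetSum _ hi]
    simp [integral_const_mul, integral_coord_mul_Mw]

theorem integral_coord_mul_coord_mul_gauss (hA : A.PosDef) (u : E3) (i j : Fin 3) :
    Integrable (fun v => (v - u) i * (v - u) j * gauss 1 u A v) ∧
      ∫ v, (v - u) i * (v - u) j * gauss 1 u A v = A i j := by
  obtain ⟨B, rfl, hB⟩ := exists_mul_transpose_of_posDef hA
  have e : ∀ z : E3, (u + toEuclideanLin B z - u) i * (u + toEuclideanLin B z - u) j * Mw z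
      = ∑ k, ∑ l, B i k * B j l * (z k * z l * Mw z) := by
    intro z
    rw [add_sub_cancel_left, toEuclideanLin_coord, toEuclideanLin_coord, Finset.sum_mul_sum,
      Finset.sum_mul]
    refine Finset.sum_congr rfl fun k _ => ?_
    rw [Finset.sum_mul]
    exact Finset.sum_congr rfl fun l _ => by ring
  have hi : ∀ k l, Integrable fun z : E3 => B i k * B j l * (z k * z l * Mw z) :=
    fun k l => (integrable_coord_mul_coord_mul_Mw k l).const_mul _
  refine ⟨integrable_mul_gauss hB u (φ := fun v => (v - u) i * (v - u) j) ?_, ?_⟩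
  · simp only [e]
    exact integrable_finsetSum _ fun k _ => integrable_finsetSum _ fun l _ => hi k l
  · rw [integral_mul_gauss hB u fun v => (v - u) i * (v - u) j]
    simp only [e]
    rw [integral_finsetSum _ fun k _ => integrable_finsetSum _ fun l _ => hi k l]
    simp_rw [fun k => integral_finsetSum Finset.univ fun l (_ : l ∈ Finset.univ) => hi k l,
      integral_const_mul, integral_coord_mul_coord_mul_Mw]
    simp [Matrix.mul_apply]

end ChangeOfVariables

end ESBGK

namespace ESBGK

/-! ### Symmetric `3 × 3` matrices -/

section LinearAlgebra

variable {A : Matrix (Fin 3) (Fin 3) ℝ} {c C : ℝ}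

theorem quad_toLp (A : Matrix (Fin 3) (Fin 3) ℝ) (z : Fin 3 → ℝ) :
    quad A (WithLp.toLp 2 z) = z ⬝ᵥ (A *ᵥ z) := rfl

theorem posDef_of_quad (hA : A.IsHermitian) (hc : 0 < c) (h : ∀ x, c * ‖x‖ ^ 2 ≤ quad A x) :
    A.PosDef := by
  refine PosDef.of_dotProduct_mulVec_pos hA fun z hz => ?_
  have h1 := h (WithLp.toLp 2 z)
  rw [quad_toLp] at h1
  refine lt_of_lt_of_le ?_ h1
  have : (WithLp.toLp 2 z : E3) ≠ 0 := by
    intro h0; exact hz (by simpa using h0)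
  have := norm_pos_iff.2 this
  positivity

theorem pow_three_le_det (hA : A.IsHermitian) (hc : 0 ≤ c) (h : ∀ x, c * ‖x‖ ^ 2 ≤ quad A x) :
    c ^ 3 ≤ A.det := by
  rw [hA.det_eq_prod_eigenvalues]
  have : ∀ i, c ≤ hA.eigenvalues i := by
    intro i
    have h1 := h (hA.eigenvectorBasis i)
    rw [hA.eigenvectorBasis.orthonormal.1 i] at h1
    rw [hA.eigenvalues_eq]
    simpa [quad] using h1
  calc c ^ 3 = ∏ _i : Fin 3, c := by simp
    _ ≤ ∏ i, hA.eigenvalues i := Finset.prod_le_prod (fun _ _ => hc) fun i _ => this i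

theorem quad_inv_ge (hA : A.PosDef) (hC : 0 < C) (h : ∀ x, quad A x ≤ C * ‖x‖ ^ 2) (x : E3) :
    ‖x‖ ^ 2 / C ≤ quad A⁻¹ x := by
  have hdet : IsUnit A.det := isUnit_iff_ne_zero.2 hA.det_pos.ne'
  set w : Fin 3 → ℝ := fun i => x i with hw
  set y : Fin 3 → ℝ := A⁻¹ *ᵥ w with hy
  have hxy : A *ᵥ y = w := by rw [hy, mulVec_mulVec, mul_nonsing_inv A hdet, one_mulVec]
  have hn : w ⬝ᵥ w = ‖x‖ ^ 2 := by
    rw [EuclideanSpace.norm_sq_eq]; simp [dotProduct, hw, sq]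
  have hsym : y ⬝ᵥ (A *ᵥ w) = w ⬝ᵥ w := by
    rw [dotProduct_mulVec, ← mulVec_transpose,
      show Aᵀ = A by simpa [IsHermitian] using hA.isHermitian, hxy]
  have hq : quad A⁻¹ x = y ⬝ᵥ w := by
    unfold quad; rw [← hw, ← hy, dotProduct_comm]
  have hpos : ∀ s : ℝ, 0 ≤ y ⬝ᵥ w - 2 * s * (w ⬝ᵥ w) + s ^ 2 * (w ⬝ᵥ (A *ᵥ w)) := by
    intro s
    have := hA.posSemidef.dotProduct_mulVec_nonneg (y - s • w)
    rw [star_trivial, mulVec_sub, mulVec_smul, hxy] at this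
    simp only [sub_dotProduct, dotProduct_sub, smul_dotProduct, dotProduct_smul, hsym,
      smul_eq_mul] at this
    linarith
  have h1 := hpos (1 / C)
  have h2 := h x
  rw [show quad A x = w ⬝ᵥ (A *ᵥ w) from rfl] at h2
  rw [hq]
  rw [hn] at h1
  have h3 : (1 / C) ^ 2 * (w ⬝ᵥ (A *ᵥ w)) ≤ (1 / C) ^ 2 * (C * ‖x‖ ^ 2) := by gcongr
  have h4 : (1 / C) ^ 2 * (C * ‖x‖ ^ 2) = ‖x‖ ^ 2 / C := by field_simp
  have h5 : 2 * (1 / C) * ‖x‖ ^ 2 = 2 * (‖x‖ ^ 2 / C) := by field_simp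
  linarith

theorem prod_le_prod_relax {a b c ν : ℝ} (ha : 0 < a) (hb : 0 < b) (hc : 0 < c)
    (hν1 : -(1 / 2 : ℝ) < ν) (hν2 : ν < 1) :
    a * b * c ≤ ((1 - ν) * ((a + b + c) / 3) + ν * a) * ((1 - ν) * ((a + b + c) / 3) + ν * b)
      * ((1 - ν) * ((a + b + c) / 3) + ν * c) := by
  obtain ⟨T, hT⟩ : ∃ T, (a + b + c) / 3 = T := ⟨_, rfl⟩
  rw [hT]
  obtain ⟨p, rfl⟩ : ∃ p, a = T + p := ⟨a - T, by ring⟩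
  obtain ⟨q, rfl⟩ : ∃ q, b = T + q := ⟨b - T, by ring⟩
  obtain rfl : c = T - p - q := by linarith
  have hT0 : 0 < T := by linarith
  set X := T * (p ^ 2 + p * q + q ^ 2) with hX
  set e := p * q * (-p - q) with he
  have hX0 : 0 ≤ X := by
    have : 0 ≤ p ^ 2 + p * q + q ^ 2 := by nlinarith [sq_nonneg (p + q), sq_nonneg p, sq_nonneg q]
    positivity
  have hkey : 3 * e ≤ 2 * X := by
    have h1 : 2 * X - 3 * e = ((T + p) * (q - (-p - q)) ^ 2 + (T + q) * (p - (-p - q)) ^ 2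
      + (T - p - q) * (p - q) ^ 2) / 3 := by rw [hX, he]; ring
    have : 0 ≤ 2 * X - 3 * e := by rw [h1]; positivity
    linarith
  have hid : ((1 - ν) * T + ν * (T + p)) * ((1 - ν) * T + ν * (T + q))
      * ((1 - ν) * T + ν * (T - p - q)) - (T + p) * (T + q) * (T - p - q)
      = (1 - ν) * (X * (1 + ν) - e * (1 + ν + ν ^ 2)) := by rw [hX, he]; ring
  have h2 : 0 ≤ X * (1 + ν) - e * (1 + ν + ν ^ 2) := by
    have h3 : 0 ≤ (2 * X - 3 * e) * (1 + ν + ν ^ 2) :=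
      mul_nonneg (by linarith) (by nlinarith [sq_nonneg (ν + 1)])
    have h4 : 0 ≤ X * ((1 - ν) * (1 + 2 * ν)) :=
      mul_nonneg hX0 (mul_nonneg (by linarith) (by linarith))
    nlinarith
  have h5 : 0 ≤ (1 - ν) * (X * (1 + ν) - e * (1 + ν + ν ^ 2)) := mul_nonneg (by linarith) h2
  linarith

theorem det_le_det_relax (hA : A.PosDef) {ν : ℝ} (hν1 : -(1 / 2 : ℝ) < ν) (hν2 : ν < 1) :
    A.det ≤ (((1 - ν) * (A.trace / 3)) • (1 : Matrix (Fin 3) (Fin 3) ℝ) + ν • A).det := by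
  have hH := hA.isHermitian
  have htr : A.trace = ∑ i, hH.eigenvalues i := by simpa using hH.trace_eq_sum_eigenvalues
  have hdet : A.det = ∏ i, hH.eigenvalues i := by simpa using hH.det_eq_prod_eigenvalues
  have hspec := hH.spectral_theorem
  rw [Unitary.conjStarAlgAut_apply] at hspec
  set U : Matrix (Fin 3) (Fin 3) ℝ := (hH.eigenvectorUnitary : Matrix (Fin 3) (Fin 3) ℝ) with hU
  have hUU : U * star U = 1 := by simp [hU]
  set s := (1 - ν) * (A.trace / 3) with hs
  have hD : s • (1 : Matrix (Fin 3) (Fin 3) ℝ) + ν • A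
      = U * diagonal (fun i => s + ν * hH.eigenvalues i) * star U := by
    have : diagonal (fun i => s + ν * hH.eigenvalues i)
        = s • (1 : Matrix (Fin 3) (Fin 3) ℝ) + ν • diagonal hH.eigenvalues := by
      ext i j
      by_cases hij : i = j
      · subst hij; simp
      · simp [hij]
    rw [this, Matrix.mul_add, Matrix.add_mul, Matrix.mul_smul, Matrix.smul_mul, Matrix.mul_one, hUU,
      Matrix.mul_smul, Matrix.smul_mul]
    congr 2
  have hdet' : (s • (1 : Matrix (Fin 3) (Fin 3) ℝ) + ν • A).det
      = ∏ i, (s + ν * hH.eigenvalues i) := by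
    rw [hD, det_mul_right_comm, hUU, Matrix.one_mul, det_diagonal]
  rw [hdet', hdet, Fin.prod_univ_three, Fin.prod_univ_three, hs, htr, Fin.sum_univ_three]
  have hp := hA.eigenvalues_pos
  exact prod_le_prod_relax (hp 0) (hp 1) (hp 2) hν1 hν2

end LinearAlgebra

end ESBGK

namespace ESBGK

/-! ### Velocity distributions with finite energy -/

/-- Nonnegative measurable velocity distributions with finite mass and energy. -/
structure Kin (g : E3 → ℝ) : Prop where
  meas : Measurable g
  nonneg : ∀ v, 0 ≤ g v
  int : Integrable fun v => (1 + ‖v‖) ^ 2 * g v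

/-- Nonnegative measurable velocity distributions bounded by `N (1 + |v|)^{-β}`. -/
structure Adm (β N : ℝ) (g : E3 → ℝ) : Prop where
  meas : Measurable g
  nonneg : ∀ v, 0 ≤ g v
  le : ∀ v, (1 + ‖v‖) ^ β * g v ≤ N

theorem integrable_weight {r : ℝ} (hr : 3 < r) :
    Integrable fun v : E3 => (1 + ‖v‖) ^ (-r) :=
  integrable_one_add_norm (by simpa using hr)

theorem abs_coord_le (v : E3) (i : Fin 3) : |v i| ≤ ‖v‖ := by
  simpa using EuclideanSpace.norm_eq v ▸ PiLp.norm_apply_le v i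

section Adm

variable {β N : ℝ} {g : E3 → ℝ}

theorem Adm.N_nonneg (h : Adm β N g) : 0 ≤ N :=
  (mul_nonneg (by positivity) (h.nonneg 0)).trans (h.le 0)

theorem Adm.mono {N' : ℝ} (h : Adm β N g) (hN : N ≤ N') : Adm β N' g :=
  ⟨h.meas, h.nonneg, fun v => (h.le v).trans hN⟩

theorem Adm.le_weight (h : Adm β N g) (v : E3) : g v ≤ N * (1 + ‖v‖) ^ (-β) := by
  have hv : 0 < 1 + ‖v‖ := by positivity
  rw [Real.rpow_neg hv.le, ← div_eq_mul_inv, le_div_iff₀ (by positivity), mul_comm]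
  exact h.le v

theorem Adm.weight_sq_mul_le (h : Adm β N g) (v : E3) :
    (1 + ‖v‖) ^ 2 * g v ≤ N * (1 + ‖v‖) ^ (-(β - 2)) := by
  have hv : 0 < 1 + ‖v‖ := by positivity
  have h1 := mul_le_mul_of_nonneg_left (h.le_weight v) (sq_nonneg (1 + ‖v‖))
  refine h1.trans_eq ?_
  rw [show -(β - 2) = -β + 2 by ring, Real.rpow_add hv, Real.rpow_two]; ring

theorem Adm.kin (h : Adm β N g) (hβ : 5 < β) : Kin g := by
  refine ⟨h.meas, h.nonneg, ?_⟩
  refine Integrable.mono' ((integrable_weight (r := β - 2) (by linarith)).const_mul N) ?_ ?_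
  · exact ((measurable_const.add measurable_norm).pow_const 2 |>.mul h.meas).aestronglyMeasurable
  · refine Filter.Eventually.of_forall fun v => ?_
    rw [Real.norm_eq_abs, abs_of_nonneg (mul_nonneg (sq_nonneg _) (h.nonneg v))]
    exact h.weight_sq_mul_le v

end Adm

namespace Kin

variable {g : E3 → ℝ} {φ : E3 → ℝ} {C : ℝ}

theorem integrable_mul (h : Kin g) (hφ : Measurable φ) (hC : ∀ v, |φ v| ≤ C * (1 + ‖v‖) ^ 2) :
    Integrable fun v => φ v * g v := by
  refine Integrable.mono' (h.int.const_mul C) (hφ.mul h.meas).aestronglyMeasurable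
    (Filter.Eventually.of_forall fun v => ?_)
  rw [Real.norm_eq_abs, abs_mul, abs_of_nonneg (h.nonneg v), ← mul_assoc]
  exact mul_le_mul_of_nonneg_right (hC v) (h.nonneg v)

theorem integrable (h : Kin g) : Integrable g := by
  have := h.integrable_mul (φ := fun _ => 1) (C := 1) measurable_const fun v => by
    have := norm_nonneg v
    rw [abs_one]; nlinarith
  simpa using this

theorem integrable_coord (h : Kin g) (i : Fin 3) : Integrable fun v => v i * g v :=
  h.integrable_mul (C := 1) (by fun_prop) fun v => by
    have := abs_coord_le v i
    have := norm_nonneg v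
    nlinarith

theorem integrable_coord_mul_coord (h : Kin g) (i j : Fin 3) :
    Integrable fun v => v i * v j * g v :=
  h.integrable_mul (C := 1) (by fun_prop) fun v => by
    have h1 := abs_coord_le v i
    have h2 := abs_coord_le v j
    have h3 := norm_nonneg v
    rw [abs_mul]
    have := mul_le_mul h1 h2 (abs_nonneg _) h3
    nlinarith

theorem integrable_norm_sq (h : Kin g) : Integrable fun v => ‖v‖ ^ 2 * g v :=
  h.integrable_mul (C := 1) (by fun_prop) fun v => by
    have h3 := norm_nonneg v
    rw [abs_of_nonneg (sq_nonneg _)]; nlinarith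

theorem integrable_norm_sub_sq (h : Kin g) (u : E3) : Integrable fun v => ‖v - u‖ ^ 2 * g v :=
  h.integrable_mul (C := (1 + ‖u‖) ^ 2) (by fun_prop) fun v => by
    have h3 := norm_nonneg v
    have h4 := norm_nonneg u
    have h5 := norm_sub_le v u
    rw [abs_of_nonneg (sq_nonneg _), ← mul_pow]
    gcongr
    nlinarith

theorem integrable_sub_coord_mul (h : Kin g) (u : E3) (i j : Fin 3) :
    Integrable fun v => (v - u) i * (v - u) j * g v := by
  refine Integrable.mono' (h.integrable_norm_sub_sq u) ?_ (Filter.Eventually.of_forall fun v => ?_)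
  · have := h.meas
    have : Measurable fun v : E3 => (v - u) i * (v - u) j * g v := by
      refine Measurable.mul ?_ this
      fun_prop
    exact this.aestronglyMeasurable
  · rw [Real.norm_eq_abs, abs_mul, abs_mul, abs_of_nonneg (h.nonneg v), sq]
    have := h.nonneg v
    gcongr <;> exact abs_coord_le _ _

theorem bulk_coord (h : Kin g) (i : Fin 3) : bulk g i = (dens g)⁻¹ * ∫ v, v i * g v := by
  have hi : Integrable fun v : E3 => g v • v := by
    rw [← integrable_norm_iff]
    · refine (h.integrable_mul (φ := fun v => ‖v‖) (C := 1) (by fun_prop) fun v => ?_).congr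
        (Filter.Eventually.of_forall fun v => ?_)
      · have := norm_nonneg v
        rw [abs_of_nonneg this]; nlinarith
      · simp [norm_smul, abs_of_nonneg (h.nonneg v), mul_comm]
    · exact (h.meas.smul measurable_id).aestronglyMeasurable
  unfold bulk
  have := (EuclideanSpace.proj (𝕜 := ℝ) i).integral_comp_comm hi
  rw [PiLp.smul_apply, smul_eq_mul]
  congr 1
  refine this.symm.trans (integral_congr_ae (Filter.Eventually.of_forall fun v => ?_))
  simp [mul_comm]

theorem dens_mul_bulk (h : Kin g) (hρ : 0 < dens g) (i : Fin 3) :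
    ∫ v, v i * g v = dens g * bulk g i := by
  rw [h.bulk_coord]; field_simp

theorem integral_sub_bulk_mul (h : Kin g) (hρ : 0 < dens g) (i : Fin 3) :
    Integrable (fun v => (v - bulk g) i * g v) ∧ ∫ v, (v - bulk g) i * g v = 0 := by
  have e : ∀ v, (v - bulk g) i * g v = v i * g v - bulk g i * g v := fun v => by
    rw [PiLp.sub_apply]; ring
  simp only [e]
  refine ⟨(h.integrable_coord i).sub (h.integrable.const_mul _), ?_⟩
  rw [integral_sub (h.integrable_coord i) (h.integrable.const_mul _), integral_const_mul,
    h.dens_mul_bulk hρ, dens]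
  ring

theorem stress_apply (h : Kin g) (hρ : 0 < dens g) (i j : Fin 3) :
    stress g i j = (dens g)⁻¹ * (∫ v, v i * v j * g v) - bulk g i * bulk g j := by
  have e : ∀ v, (v - bulk g) i * (v - bulk g) j * g v
      = v i * v j * g v - bulk g j * (v i * g v) - bulk g i * (v j * g v)
        + bulk g i * bulk g j * g v := fun v => by
    rw [PiLp.sub_apply, PiLp.sub_apply]; ring
  unfold stress
  rw [Matrix.of_apply]
  simp only [e]
  have i1 := h.integrable_coord_mul_coord i j
  have i2 := (h.integrable_coord i).const_mul (bulk g j)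
  have i3 := (h.integrable_coord j).const_mul (bulk g i)
  have i4 := h.integrable.const_mul (bulk g i * bulk g j)
  have i5 : Integrable fun v => v i * v j * g v - bulk g j * (v i * g v) := i1.sub i2
  have i6 : Integrable fun v => v i * v j * g v - bulk g j * (v i * g v)
    - bulk g i * (v j * g v) := i5.sub i3
  rw [integral_add i6 i4, integral_sub i5 i3, integral_sub i1 i2,
    integral_const_mul, integral_const_mul, integral_const_mul, h.dens_mul_bulk hρ,
    h.dens_mul_bulk hρ, show ∫ v, g v = dens g from rfl]
  field_simp
  ring

theorem temp_eq_trace (h : Kin g) : temp g = (stress g).trace / 3 := by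
  unfold temp
  have e : ∀ v : E3, ‖v - bulk g‖ ^ 2 * g v
      = ∑ i, (v - bulk g) i * (v - bulk g) i * g v := fun v => by
    rw [EuclideanSpace.norm_sq_eq, Finset.sum_mul]
    refine Finset.sum_congr rfl fun i _ => ?_
    rw [Real.norm_eq_abs, sq_abs]; ring
  simp only [e]
  rw [integral_finsetSum _ fun i _ => h.integrable_sub_coord_mul _ i i]
  simp only [Matrix.trace, Matrix.diag, stress, Matrix.of_apply, ← Finset.mul_sum]
  rw [mul_inv]; ring

theorem isHermitian_stress (g : E3 → ℝ) : (stress g).IsHermitian := by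
  ext i j
  simp [stress, mul_comm]

theorem isHermitian_tempTensor (g : E3 → ℝ) (ν : ℝ) : (tempTensor g ν).IsHermitian := by
  unfold tempTensor
  ext i j
  have := congrFun (congrFun (isHermitian_stress g) i) j
  simp only [conjTranspose_apply, star_trivial] at this
  simp [this, Matrix.one_apply, eq_comm]

theorem quad_stress (h : Kin g) (z : E3) :
    quad (stress g) z = (dens g)⁻¹ * ∫ v, (∑ i, (v - bulk g) i * z i) ^ 2 * g v := by
  have e : ∀ v : E3, (∑ i, (v - bulk g) i * z i) ^ 2 * g v
      = ∑ i, ∑ j, z i * z j * ((v - bulk g) i * (v - bulk g) j * g v) := fun v => by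
    rw [sq, Finset.sum_mul_sum, Finset.sum_mul]
    refine Finset.sum_congr rfl fun i _ => ?_
    rw [Finset.sum_mul]
    exact Finset.sum_congr rfl fun j _ => by ring
  have hi : ∀ i j, Integrable fun v => z i * z j * ((v - bulk g) i * (v - bulk g) j * g v) :=
    fun i j => (h.integrable_sub_coord_mul _ i j).const_mul _
  simp only [e]
  rw [integral_finsetSum _ fun i _ => integrable_finsetSum _ fun j _ => hi i j]
  simp_rw [fun i => integral_finsetSum Finset.univ fun j (_ : j ∈ Finset.univ) => hi i j]
  rw [quad_eq_sum, Finset.mul_sum]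
  refine Finset.sum_congr rfl fun i _ => ?_
  rw [Finset.mul_sum]
  refine Finset.sum_congr rfl fun j _ => ?_
  rw [integral_const_mul, stress, Matrix.of_apply]; ring

theorem sum_mul_sq_le (a z : E3) : (∑ i, a i * z i) ^ 2 ≤ ‖a‖ ^ 2 * ‖z‖ ^ 2 := by
  have := Finset.sum_mul_sq_le_sq_mul_sq Finset.univ (fun i => a i) fun i => z i
  simpa [EuclideanSpace.norm_sq_eq] using this

theorem integrable_sum_sq (h : Kin g) (u z : E3) :
    Integrable fun v => (∑ i, (v - u) i * z i) ^ 2 * g v := by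
  refine Integrable.mono' ((h.integrable_norm_sub_sq u).const_mul (‖z‖ ^ 2)) ?_
    (Filter.Eventually.of_forall fun v => ?_)
  · have h1 : Measurable fun v : E3 => (∑ i, (v - u) i * z i) ^ 2 := by fun_prop
    exact (h1.mul h.meas).aestronglyMeasurable
  · rw [Real.norm_eq_abs, abs_of_nonneg (mul_nonneg (sq_nonneg _) (h.nonneg v)), ← mul_assoc]
    refine mul_le_mul_of_nonneg_right ?_ (h.nonneg v)
    rw [mul_comm]; exact sum_mul_sq_le _ _

theorem quad_stress_le (h : Kin g) (hρ : 0 < dens g) (z : E3) :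
    quad (stress g) z ≤ 3 * temp g * ‖z‖ ^ 2 := by
  rw [h.quad_stress]
  have h1 : ∫ v, (∑ i, (v - bulk g) i * z i) ^ 2 * g v
      ≤ ∫ v, ‖z‖ ^ 2 * (‖v - bulk g‖ ^ 2 * g v) := by
    refine integral_mono (h.integrable_sum_sq _ z) ((h.integrable_norm_sub_sq _).const_mul _)
      fun v => ?_
    show (∑ i, (v - bulk g) i * z i) ^ 2 * g v ≤ ‖z‖ ^ 2 * (‖v - bulk g‖ ^ 2 * g v)
    rw [← mul_assoc]
    refine mul_le_mul_of_nonneg_right ?_ (h.nonneg v)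
    rw [mul_comm]; exact sum_mul_sq_le _ _
  rw [integral_const_mul] at h1
  have h2 := mul_le_mul_of_nonneg_left h1 (inv_pos.2 hρ).le
  refine h2.trans_eq ?_
  unfold temp
  rw [mul_inv]; ring

theorem posDef_stress (h : Kin g) (hρ : 0 < dens g) : (stress g).PosDef := by
  refine PosDef.of_dotProduct_mulVec_pos (isHermitian_stress g) fun w hw => ?_
  rw [star_trivial, ← quad_toLp]
  set z : E3 := WithLp.toLp 2 w with hz
  have hz0 : z ≠ 0 := fun h0 => hw (by simpa [hz] using h0)
  rw [h.quad_stress]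
  refine mul_pos (inv_pos.2 hρ) ?_
  have hnn : 0 ≤ fun v => (∑ i, (v - bulk g) i * z i) ^ 2 * g v :=
    fun v => mul_nonneg (sq_nonneg _) (h.nonneg v)
  refine lt_of_le_of_ne (integral_nonneg hnn) fun h0 => ?_
  have hae := (integral_eq_zero_iff_of_nonneg hnn (h.integrable_sum_sq _ z)).1 h0.symm
  have hg : g =ᵐ[volume] 0 := by
    have hnull : volume {v : E3 | inner ℝ z (v - bulk g) = 0} = 0 := by
      have h1 : volume ((LinearMap.ker (innerSL ℝ z).toLinearMap : Submodule ℝ E3) : Set E3) = 0 := by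
        refine Measure.addHaar_submodule _ _ fun htop => hz0 ?_
        have : z ∈ LinearMap.ker (innerSL ℝ z).toLinearMap := by rw [htop]; trivial
        simpa using this
      rw [← measure_preimage_add_right volume (-bulk g)] at h1
      convert h1 using 2
      ext v
      simp [sub_eq_add_neg]
    have hne : ∀ᵐ v : E3, inner ℝ z (v - bulk g) ≠ 0 := by
      rw [ae_iff]; simpa using hnull
    filter_upwards [hae, hne] with v h1 h2
    have h3 : (∑ i, (v - bulk g) i * z i) = inner ℝ z (v - bulk g) := by
      simp [PiLp.inner_apply]
    simp only [Pi.zero_apply, h3] at h1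
    rcases mul_eq_zero.1 h1 with h4 | h4
    · exact absurd (pow_eq_zero_iff (two_ne_zero) |>.1 h4) h2
    · exact h4
  rw [dens, integral_congr_ae hg] at hρ
  simp at hρ

theorem temp_pos (h : Kin g) (hρ : 0 < dens g) : 0 < temp g := by
  rw [h.temp_eq_trace]
  have := (h.posDef_stress hρ).trace_pos
  positivity

end Kin

end ESBGK

namespace ESBGK

/-! ### The anisotropic Gaussian and its entropy -/

theorem gauss_pos {ρ : ℝ} {A : Matrix (Fin 3) (Fin 3) ℝ} (hρ : 0 < ρ) (hA : A.PosDef) (u v : E3) :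
    0 < gauss ρ u A v := by
  have := hA.det_pos
  unfold gauss
  rw [sqrt_det_two_pi_smul]
  positivity

theorem log_gauss {ρ : ℝ} {A : Matrix (Fin 3) (Fin 3) ℝ} (hρ : 0 < ρ) (hA : A.PosDef) (u v : E3) :
    Real.log (gauss ρ u A v)
      = Real.log ρ - 3 / 2 * Real.log (2 * π) - Real.log A.det / 2 - quad A⁻¹ (v - u) / 2 := by
  have := hA.det_pos
  unfold gauss
  rw [sqrt_det_two_pi_smul, Real.log_mul (by positivity) (by positivity),
    Real.log_div (by positivity) (by positivity), Real.log_mul (by positivity) (by positivity),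
    Real.log_rpow (by positivity), Real.log_sqrt this.le, Real.log_exp]
  ring

/-- `f` has mass `ρ`, mean `u` and covariance `A`. -/
structure HasMoments (f : E3 → ℝ) (ρ : ℝ) (u : E3) (A : Matrix (Fin 3) (Fin 3) ℝ) : Prop where
  int₀ : Integrable f
  eq₀ : ∫ v, f v = ρ
  int₁ : ∀ i, Integrable fun v => (v - u) i * f v
  eq₁ : ∀ i, ∫ v, (v - u) i * f v = 0
  int₂ : ∀ i j, Integrable fun v => (v - u) i * (v - u) j * f v
  eq₂ : ∀ i j, ∫ v, (v - u) i * (v - u) j * f v = ρ * A i j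

namespace HasMoments

variable {f : E3 → ℝ} {ρ : ℝ} {u : E3} {A : Matrix (Fin 3) (Fin 3) ℝ}

theorem quad_integral (h : HasMoments f ρ u A) (Q : Matrix (Fin 3) (Fin 3) ℝ) :
    Integrable (fun v => quad Q (v - u) * f v) ∧
      ∫ v, quad Q (v - u) * f v = ρ * (Q * Aᵀ).trace := by
  have e : ∀ v, quad Q (v - u) * f v
      = ∑ i, ∑ j, Q i j * ((v - u) i * (v - u) j * f v) := fun v => by
    rw [quad_eq_sum, Finset.sum_mul]
    refine Finset.sum_congr rfl fun i _ => ?_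
    rw [Finset.sum_mul]
    exact Finset.sum_congr rfl fun j _ => by ring
  have hi : ∀ i j, Integrable fun v => Q i j * ((v - u) i * (v - u) j * f v) :=
    fun i j => (h.int₂ i j).const_mul _
  simp only [e]
  refine ⟨integrable_finsetSum _ fun i _ => integrable_finsetSum _ fun j _ => hi i j, ?_⟩
  rw [integral_finsetSum _ fun i _ => integrable_finsetSum _ fun j _ => hi i j]
  simp_rw [fun i => integral_finsetSum Finset.univ fun j (_ : j ∈ Finset.univ) => hi i j,
    integral_const_mul, h.eq₂]
  simp only [Matrix.trace, Matrix.diag, Matrix.mul_apply, transpose_apply, Finset.mul_sum]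
  exact Finset.sum_congr rfl fun i _ => Finset.sum_congr rfl fun j _ => by ring

theorem norm_sq_integral (h : HasMoments f ρ u A) :
    Integrable (fun v => ‖v‖ ^ 2 * f v) ∧ ∫ v, ‖v‖ ^ 2 * f v = ρ * (A.trace + ‖u‖ ^ 2) := by
  have hq := h.quad_integral 1
  have hq1 : ∀ x : E3, quad 1 x = ‖x‖ ^ 2 := fun x => by
    rw [EuclideanSpace.norm_sq_eq]; simp [quad, dotProduct, sq]
  have e : ∀ v : E3, ‖v‖ ^ 2 * f v = quad 1 (v - u) * f v
      + (∑ i, 2 * u i * ((v - u) i * f v)) + ‖u‖ ^ 2 * f v := fun v => by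
    rw [hq1, EuclideanSpace.norm_sq_eq, EuclideanSpace.norm_sq_eq, EuclideanSpace.norm_sq_eq]
    simp only [Real.norm_eq_abs, sq_abs, Fin.sum_univ_three, PiLp.sub_apply]
    ring
  simp only [e]
  have i1 := hq.1
  have i2 : Integrable fun v : E3 => ∑ i, 2 * u i * ((v - u) i * f v) :=
    integrable_finsetSum _ fun i _ => (h.int₁ i).const_mul _
  have i3 : Integrable fun v => quad 1 (v - u) * f v + ∑ i, 2 * u i * ((v - u) i * f v) :=
    i1.add i2
  refine ⟨i3.add (h.int₀.const_mul _), ?_⟩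
  rw [integral_add i3 (h.int₀.const_mul _), integral_add i1 i2,
    integral_finsetSum _ fun i _ => (h.int₁ i).const_mul _, hq.2]
  simp only [integral_const_mul, h.eq₁, h.eq₀]
  simp
  ring

theorem log_integral (h : HasMoments f ρ u A) (hρ : 0 < ρ) (hA : A.PosDef) :
    Integrable (fun v => (Real.log (gauss ρ u A v) - Real.log (Mw v)) * f v) ∧
      ∫ v, (Real.log (gauss ρ u A v) - Real.log (Mw v)) * f v
        = ρ * (Real.log ρ - Real.log A.det / 2 - 3 / 2 + (A.trace + ‖u‖ ^ 2) / 2) := by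
  have hq := h.quad_integral A⁻¹
  have hn := h.norm_sq_integral
  have hA' : Aᵀ = A := by simpa [IsHermitian] using hA.isHermitian
  rw [hA', nonsing_inv_mul _ (isUnit_iff_ne_zero.2 hA.det_pos.ne')] at hq
  have e : ∀ v, (Real.log (gauss ρ u A v) - Real.log (Mw v)) * f v
      = (Real.log ρ - Real.log A.det / 2) * f v - 1 / 2 * (quad A⁻¹ (v - u) * f v)
        + 1 / 2 * (‖v‖ ^ 2 * f v) := fun v => by
    rw [log_gauss hρ hA, log_Mw]; ring
  simp only [e]
  have i1 : Integrable fun v => (Real.log ρ - Real.log A.det / 2) * f v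
    - 1 / 2 * (quad A⁻¹ (v - u) * f v) := (h.int₀.const_mul _).sub (hq.1.const_mul _)
  refine ⟨i1.add (hn.1.const_mul _), ?_⟩
  rw [integral_add i1 (hn.1.const_mul _), integral_sub (h.int₀.const_mul _) (hq.1.const_mul _),
    integral_const_mul, integral_const_mul, integral_const_mul, hq.2, hn.2, h.eq₀]
  simp
  ring

end HasMoments

theorem hasMoments_gauss (ρ : ℝ) (u : E3) {A : Matrix (Fin 3) (Fin 3) ℝ} (hA : A.PosDef) :
    HasMoments (gauss ρ u A) ρ u A := by
  have h0 := integral_gauss hA u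
  have h1 := integral_coord_mul_gauss hA u
  have h2 := integral_coord_mul_coord_mul_gauss hA u
  have e : gauss ρ u A = fun v => ρ * gauss 1 u A v := funext (gauss_eq_mul ρ u A)
  have e1 : ∀ i, (fun v => (v - u) i * gauss ρ u A v)
      = fun v => ρ * ((v - u) i * gauss 1 u A v) := fun i => by
    rw [e]; ext v; ring
  have e2 : ∀ i j, (fun v => (v - u) i * (v - u) j * gauss ρ u A v)
      = fun v => ρ * ((v - u) i * (v - u) j * gauss 1 u A v) := fun i j => by
    rw [e]; ext v; ring
  refine ⟨?_, ?_, fun i => ?_, fun i => ?_, fun i j => ?_, fun i j => ?_⟩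
  · rw [e]; exact h0.1.const_mul ρ
  · rw [e, integral_const_mul, h0.2, mul_one]
  · rw [e1]; exact (h1 i).1.const_mul ρ
  · rw [e1, integral_const_mul, (h1 i).2, mul_zero]
  · rw [e2]; exact (h2 i j).1.const_mul ρ
  · rw [e2, integral_const_mul, (h2 i j).2]

namespace Kin

variable {g : E3 → ℝ} {ν : ℝ}

theorem hasMoments (h : Kin g) (hρ : 0 < dens g) : HasMoments g (dens g) (bulk g) (stress g) := by
  refine ⟨h.integrable, rfl, fun i => (h.integral_sub_bulk_mul hρ i).1,
    fun i => (h.integral_sub_bulk_mul hρ i).2, h.integrable_sub_coord_mul _, fun i j => ?_⟩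
  rw [stress, Matrix.of_apply]
  field_simp

theorem trace_stress (h : Kin g) : (stress g).trace = 3 * temp g := by
  rw [h.temp_eq_trace]; ring

theorem trace_tempTensor (h : Kin g) (ν : ℝ) : (tempTensor g ν).trace = 3 * temp g := by
  unfold tempTensor
  rw [trace_add, trace_smul, trace_smul, h.trace_stress, trace_one]
  simp
  ring

theorem quad_tempTensor (g : E3 → ℝ) (ν : ℝ) (x : E3) :
    quad (tempTensor g ν) x = (1 - ν) * temp g * ‖x‖ ^ 2 + ν * quad (stress g) x := by
  rw [EuclideanSpace.norm_sq_eq]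
  simp [quad, tempTensor, add_mulVec, smul_mulVec, dotProduct_add, dotProduct_smul]
  simp [dotProduct, sq]

theorem quad_tempTensor_le (h : Kin g) (hρ : 0 < dens g) (hν1 : -(1 / 2 : ℝ) < ν) (hν2 : ν < 1)
    (x : E3) : quad (tempTensor g ν) x ≤ 3 * temp g * ‖x‖ ^ 2 := by
  rw [quad_tempTensor]
  have h1 := h.quad_stress_le hρ x
  have h2 : 0 ≤ quad (stress g) x := (h.posDef_stress hρ).posSemidef.dotProduct_mulVec_nonneg _
  have h3 := mul_nonneg (h.temp_pos hρ).le (sq_nonneg ‖x‖)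
  rcases le_total 0 ν with hν | hν
  · nlinarith [mul_le_mul_of_nonneg_left h1 hν]
  · nlinarith [mul_nonpos_of_nonpos_of_nonneg hν h2]

theorem le_quad_tempTensor (h : Kin g) (hρ : 0 < dens g)
    (x : E3) : min (1 - ν) (1 + 2 * ν) * temp g * ‖x‖ ^ 2 ≤ quad (tempTensor g ν) x := by
  rw [quad_tempTensor]
  have h1 := h.quad_stress_le hρ x
  have h2 : 0 ≤ quad (stress g) x := (h.posDef_stress hρ).posSemidef.dotProduct_mulVec_nonneg _
  have h3 := mul_nonneg (h.temp_pos hρ).le (sq_nonneg ‖x‖)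
  rw [mul_assoc]
  rcases le_total 0 ν with hν | hν
  · have := mul_le_mul_of_nonneg_right (min_le_left (1 - ν) (1 + 2 * ν)) h3
    nlinarith [mul_nonneg hν h2]
  · have := mul_le_mul_of_nonneg_right (min_le_right (1 - ν) (1 + 2 * ν)) h3
    nlinarith [mul_le_mul_of_nonpos_left h1 hν]

theorem min_pos (hν1 : -(1 / 2 : ℝ) < ν) (hν2 : ν < 1) : 0 < min (1 - ν) (1 + 2 * ν) :=
  lt_min (by linarith) (by linarith)

theorem posDef_tempTensor (h : Kin g) (hρ : 0 < dens g) (hν1 : -(1 / 2 : ℝ) < ν) (hν2 : ν < 1) :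
    (tempTensor g ν).PosDef :=
  posDef_of_quad (isHermitian_tempTensor g ν) (mul_pos (min_pos hν1 hν2) (h.temp_pos hρ))
    (h.le_quad_tempTensor hρ)

theorem aGauss_pos (h : Kin g) (hρ : 0 < dens g) (hν1 : -(1 / 2 : ℝ) < ν) (hν2 : ν < 1) (v : E3) :
    0 < aGauss g ν v :=
  gauss_pos hρ (h.posDef_tempTensor hρ hν1 hν2) _ _

/-- The anisotropic Gaussian has smaller relative entropy than the distribution itself. -/
theorem lintegral_hent_aGauss_le (h : Kin g) (hρ : 0 < dens g) (hν1 : -(1 / 2 : ℝ) < ν)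
    (hν2 : ν < 1) :
    ∫⁻ v, ENNReal.ofReal (hent (Mw v) (aGauss g ν v))
      ≤ ∫⁻ v, ENNReal.ofReal (hent (Mw v) (g v)) := by
  have hT := h.posDef_tempTensor hρ hν1 hν2
  have hS := h.posDef_stress hρ
  have hM := hasMoments_gauss (dens g) (bulk g) hT
  have hG := hasMoments_gauss (dens g) (bulk g) hS
  obtain ⟨iM, eM⟩ := hM.log_integral hρ hT
  obtain ⟨iS, eS⟩ := (h.hasMoments hρ).log_integral hρ hS
  have hdet : (stress g).det ≤ (tempTensor g ν).det := by
    have := det_le_det_relax hS hν1 hν2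
    rwa [← h.temp_eq_trace] at this
  have hlog := Real.log_le_log hS.det_pos hdet
  have e1 : ∀ v, hent (Mw v) (aGauss g ν v)
      = (Real.log (gauss (dens g) (bulk g) (tempTensor g ν) v) - Real.log (Mw v))
        * gauss (dens g) (bulk g) (tempTensor g ν) v
        - gauss (dens g) (bulk g) (tempTensor g ν) v + Mw v := fun v => by
    rw [aGauss_eq_gauss, hent]; ring
  have i1 : Integrable fun v =>
    (Real.log (gauss (dens g) (bulk g) (tempTensor g ν) v) - Real.log (Mw v))
      * gauss (dens g) (bulk g) (tempTensor g ν) v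
      - gauss (dens g) (bulk g) (tempTensor g ν) v := iM.sub hM.int₀
  have i2 : Integrable fun v => hent (Mw v) (aGauss g ν v) := by
    simp only [e1]; exact i1.add integrable_Mw
  have i3 : Integrable fun v =>
    (Real.log (gauss (dens g) (bulk g) (stress g) v) - Real.log (Mw v)) * g v
      - gauss (dens g) (bulk g) (stress g) v := iS.sub hG.int₀
  have i4 : Integrable fun v =>
    (Real.log (gauss (dens g) (bulk g) (stress g) v) - Real.log (Mw v)) * g v
      - gauss (dens g) (bulk g) (stress g) v + Mw v := i3.add integrable_Mw
  have hle : ∀ v, (Real.log (gauss (dens g) (bulk g) (stress g) v) - Real.log (Mw v)) * g v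
      - gauss (dens g) (bulk g) (stress g) v + Mw v ≤ hent (Mw v) (g v) := fun v => by
    have := hent_young (m := Mw v) (h.nonneg v)
      (Real.log (gauss (dens g) (bulk g) (stress g) v))
    rwa [Real.exp_log (gauss_pos hρ hS _ _)] at this
  calc ∫⁻ v, ENNReal.ofReal (hent (Mw v) (aGauss g ν v))
      = ENNReal.ofReal (∫ v, hent (Mw v) (aGauss g ν v)) :=
        (ofReal_integral_eq_lintegral_ofReal i2 (Filter.Eventually.of_forall fun v =>
          hent_nonneg (Mw_pos v) (gauss_pos hρ hT _ _).le)).symm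
    _ ≤ ENNReal.ofReal (∫ v, ((Real.log (gauss (dens g) (bulk g) (stress g) v)
          - Real.log (Mw v)) * g v - gauss (dens g) (bulk g) (stress g) v + Mw v)) := by
        refine ENNReal.ofReal_le_ofReal ?_
        simp only [e1]
        rw [integral_add i1 integrable_Mw, integral_add i3 integrable_Mw]
        rw [integral_sub iM hM.int₀, integral_sub iS hG.int₀, eM, eS, hM.eq₀, hG.eq₀,
          h.trace_stress, h.trace_tempTensor]
        have := mul_le_mul_of_nonneg_left hlog hρ.le
        nlinarith
    _ ≤ ∫⁻ v, ENNReal.ofReal ((Real.log (gauss (dens g) (bulk g) (stress g) v)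
          - Real.log (Mw v)) * g v - gauss (dens g) (bulk g) (stress g) v + Mw v) := by
        rw [integral_eq_lintegral_pos_part_sub_lintegral_neg_part i4]
        refine (ENNReal.ofReal_le_ofReal (sub_le_self _ ENNReal.toReal_nonneg)).trans ?_
        exact ENNReal.ofReal_toReal_le
    _ ≤ _ := lintegral_mono fun v => ENNReal.ofReal_le_ofReal (hle v)

end Kin

end ESBGK

namespace ESBGK

/-! ### Pointwise bounds on the anisotropic Gaussian -/

namespace Kin

variable {g : E3 → ℝ} {ν : ℝ}

theorem sqrt_temp_pos (h : Kin g) (hρ : 0 < dens g) : 0 < √(temp g) :=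
  Real.sqrt_pos.2 (h.temp_pos hρ)

theorem sq_sqrt_temp (h : Kin g) (hρ : 0 < dens g) : √(temp g) ^ 2 = temp g :=
  Real.sq_sqrt (h.temp_pos hρ).le

theorem integral_norm_sub_bulk_sq (h : Kin g) (hρ : 0 < dens g) :
    ∫ v, ‖v - bulk g‖ ^ 2 * g v = 3 * dens g * √(temp g) ^ 2 := by
  rw [h.sq_sqrt_temp hρ, temp]
  field_simp

theorem temp_eq (h : Kin g) (hρ : 0 < dens g) :
    3 * dens g * temp g = (∫ v, ‖v‖ ^ 2 * g v) - dens g * ‖bulk g‖ ^ 2 := by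
  have := (h.hasMoments hρ).norm_sq_integral.2
  rw [this, h.trace_stress]
  ring

theorem dens_mul_temp_le (h : Kin g) (hρ : 0 < dens g) :
    3 * dens g * temp g ≤ ∫ v, ‖v‖ ^ 2 * g v := by
  rw [h.temp_eq hρ]
  have := mul_nonneg hρ.le (sq_nonneg ‖bulk g‖)
  linarith

theorem aGauss_le (h : Kin g) (hρ : 0 < dens g) (hν1 : -(1 / 2 : ℝ) < ν) (hν2 : ν < 1) (v : E3) :
    aGauss g ν v ≤ (√(min (1 - ν) (1 + 2 * ν) ^ 3))⁻¹ * (dens g / √(temp g) ^ 3)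
      * Real.exp (-(‖v - bulk g‖ / √(temp g)) ^ 2 / 6) := by
  have hκ := min_pos hν1 hν2
  have hT := h.temp_pos hρ
  have hσ := h.sqrt_temp_pos hρ
  have hdet := pow_three_le_det (isHermitian_tempTensor g ν) (mul_pos hκ hT).le
    (h.le_quad_tempTensor hρ)
  have hq := quad_inv_ge (h.posDef_tempTensor hρ hν1 hν2) (by positivity : 0 < 3 * temp g)
    (h.quad_tempTensor_le hρ hν1 hν2) (v - bulk g)
  rw [aGauss_eq_gauss, gauss, sqrt_det_two_pi_smul]
  have e1 : √((min (1 - ν) (1 + 2 * ν) * temp g) ^ 3)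
      = √(min (1 - ν) (1 + 2 * ν) ^ 3) * √(temp g) ^ 3 := by
    rw [mul_pow, Real.sqrt_mul (by positivity)]
    congr 1
    rw [Real.sqrt_eq_iff_mul_self_eq (by positivity) (by positivity), ← mul_pow,
      Real.mul_self_sqrt hT.le]
  have e2 : (1 : ℝ) ≤ (2 * π) ^ ((3 : ℝ) / 2) :=
    Real.one_le_rpow (by linarith [Real.pi_gt_three]) (by norm_num)
  have e3 := Real.sqrt_le_sqrt hdet
  rw [e1] at e3
  have hκ3 : 0 < √(min (1 - ν) (1 + 2 * ν) ^ 3) := Real.sqrt_pos.2 (by positivity)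
  have e4 : √(min (1 - ν) (1 + 2 * ν) ^ 3) * √(temp g) ^ 3
      ≤ (2 * π) ^ ((3 : ℝ) / 2) * √(tempTensor g ν).det := by
    refine e3.trans ?_
    have := mul_le_mul_of_nonneg_right e2 (Real.sqrt_nonneg (tempTensor g ν).det)
    linarith
  have e5 : -(1 / 2) * quad (tempTensor g ν)⁻¹ (v - bulk g)
      ≤ -(‖v - bulk g‖ / √(temp g)) ^ 2 / 6 := by
    rw [div_pow, h.sq_sqrt_temp hρ]
    have : ‖v - bulk g‖ ^ 2 / (3 * temp g) = (‖v - bulk g‖ ^ 2 / temp g) / 3 := by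
      field_simp
    rw [this] at hq
    linarith
  calc _ ≤ dens g / (√(min (1 - ν) (1 + 2 * ν) ^ 3) * √(temp g) ^ 3)
        * Real.exp (-(‖v - bulk g‖ / √(temp g)) ^ 2 / 6) := by gcongr
    _ = _ := by field_simp

end Kin

/-- The integral of `(1 + |v|)^{-(β - 2)}`. -/
noncomputable def wInt (β : ℝ) : ℝ := ∫ v : E3, (1 + ‖v‖) ^ (-(β - 2))

theorem wInt_nonneg (β : ℝ) : 0 ≤ wInt β := integral_nonneg fun v => by positivity

namespace Adm

variable {β N ν : ℝ} {g : E3 → ℝ}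

theorem integral_mul_le (h : Adm β N g) (hβ : 5 < β) {φ : E3 → ℝ}
    (hφ : ∀ v, |φ v| ≤ (1 + ‖v‖) ^ 2) : |∫ v, φ v * g v| ≤ N * wInt β := by
  have h1 : ∀ v, ‖φ v * g v‖ ≤ N * (1 + ‖v‖) ^ (-(β - 2)) := fun v => by
    rw [Real.norm_eq_abs, abs_mul, abs_of_nonneg (h.nonneg v)]
    exact (mul_le_mul_of_nonneg_right (hφ v) (h.nonneg v)).trans (h.weight_sq_mul_le v)
  rw [wInt, ← integral_const_mul, ← Real.norm_eq_abs]
  exact norm_integral_le_of_norm_le ((integrable_weight (by linarith)).const_mul N)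
    (Filter.Eventually.of_forall h1)

theorem dens_mul_temp_le (h : Adm β N g) (hβ : 5 < β) (hρ : 0 < dens g) :
    dens g * temp g ≤ N * wInt β := by
  have h1 := h.integral_mul_le hβ (φ := fun v => ‖v‖ ^ 2) fun v => by
    rw [abs_of_nonneg (sq_nonneg _)]; nlinarith [norm_nonneg v]
  have h2 := (h.kin hβ).dens_mul_temp_le hρ
  have h3 := mul_pos hρ ((h.kin hβ).temp_pos hρ)
  have := (le_abs_self _).trans h1
  nlinarith

theorem dens_mul_rpow_le (h : Adm β N g) (hβ : 5 < β) (hρ : 0 < dens g) :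
    dens g * √(temp g) ^ (β - 3) ≤ 2 ^ (β - 2) * wInt β * N := by
  have hk := h.kin hβ
  have hσ := hk.sqrt_temp_pos hρ
  set σ := √(temp g) with hσd
  have hp : ∀ v, ‖v‖ ^ 2 * g v ≤ σ ^ 2 * g v
      + N * (2 ^ (β - 2) * σ ^ (-(β - 2))) * (1 + ‖σ⁻¹ • v‖) ^ (-(β - 2)) := fun v => by
    rcases le_total ‖v‖ σ with hv | hv
    · have h1 : ‖v‖ ^ 2 * g v ≤ σ ^ 2 * g v :=
        mul_le_mul_of_nonneg_right (by gcongr) (h.nonneg v)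
      have h2 : 0 ≤ N * (2 ^ (β - 2) * σ ^ (-(β - 2))) * (1 + ‖σ⁻¹ • v‖) ^ (-(β - 2)) := by
        have := h.N_nonneg
        positivity
      linarith
    · have h0 : 0 < ‖v‖ := hσ.trans_le hv
      have h1 : ‖v‖ ^ 2 * g v ≤ N * ‖v‖ ^ (-(β - 2)) := by
        refine (mul_le_mul_of_nonneg_left (h.le_weight v) (sq_nonneg _)).trans ?_
        have : ‖v‖ ^ (-(β - 2)) = ‖v‖ ^ 2 * ‖v‖ ^ (-β) := by
          rw [show -(β - 2) = 2 + -β by ring, Real.rpow_add h0, Real.rpow_two]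
        rw [this]
        have h3 : (1 + ‖v‖) ^ (-β) ≤ ‖v‖ ^ (-β) :=
          Real.rpow_le_rpow_of_nonpos h0 (by linarith) (by linarith)
        have h4 := h.N_nonneg
        nlinarith [mul_le_mul_of_nonneg_left h3 (mul_nonneg h4 (sq_nonneg ‖v‖))]
      have h2 : ‖v‖ ^ (-(β - 2))
          ≤ 2 ^ (β - 2) * σ ^ (-(β - 2)) * (1 + ‖σ⁻¹ • v‖) ^ (-(β - 2)) := by
        have e : (2 : ℝ) ^ (β - 2) = (2⁻¹ : ℝ) ^ (-(β - 2)) := by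
          rw [Real.rpow_neg (by norm_num), Real.inv_rpow (by norm_num), inv_inv]
        rw [e, ← Real.mul_rpow (by norm_num) hσ.le, ← Real.mul_rpow (by positivity) (by positivity)]
        refine Real.rpow_le_rpow_of_nonpos (by positivity) ?_ (by linarith)
        rw [norm_smul, norm_inv, Real.norm_eq_abs, abs_of_pos hσ]
        have : 2⁻¹ * σ * (1 + σ⁻¹ * ‖v‖) = (σ + ‖v‖) / 2 := by field_simp
        rw [this]; linarith
      have h3 := mul_nonneg (sq_nonneg σ) (h.nonneg v)
      nlinarith [mul_le_mul_of_nonneg_left h2 h.N_nonneg]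
  have hi := (integrable_weight (r := β - 2) (by linarith)).comp_smul (inv_ne_zero hσ.ne')
  have h1 := integral_mono hk.integrable_norm_sq ((hk.integrable.const_mul _).add
    (hi.const_mul (N * (2 ^ (β - 2) * σ ^ (-(β - 2)))))) hp
  have h2 : ∫ v : E3, (1 + ‖σ⁻¹ • v‖) ^ (-(β - 2)) = σ ^ 3 * wInt β := by
    rw [Measure.integral_comp_inv_smul volume (fun v : E3 => (1 + ‖v‖) ^ (-(β - 2))) σ]
    simp [wInt, abs_of_pos hσ]
  simp only [Pi.add_apply] at h1
  rw [integral_add (hk.integrable.const_mul _) (hi.const_mul _), integral_const_mul,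
    integral_const_mul, h2] at h1
  have h3 := hk.dens_mul_temp_le hρ
  rw [← hk.sq_sqrt_temp hρ, ← hσd] at h3
  have h4 : ∫ v, g v = dens g := rfl
  rw [h4] at h1
  have h5 : dens g * σ ^ 2 ≤ N * (2 ^ (β - 2) * σ ^ (-(β - 2))) * (σ ^ 3 * wInt β) := by
    nlinarith [mul_pos hρ (pow_pos hσ 2)]
  have e1 : σ ^ (β - 3) = σ ^ 2 * σ ^ (β - 5) := by
    rw [show β - 3 = 2 + (β - 5) by ring, Real.rpow_add hσ, Real.rpow_two]
  have e2 : σ ^ (-(β - 2)) * σ ^ 3 * σ ^ (β - 5) = 1 := by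
    rw [← Real.rpow_natCast σ 3, ← Real.rpow_add hσ, ← Real.rpow_add hσ]
    norm_num
    rw [show 2 - β + 3 + (β - 5) = 0 by ring, Real.rpow_zero]
  calc dens g * σ ^ (β - 3) = dens g * σ ^ 2 * σ ^ (β - 5) := by rw [e1]; ring
    _ ≤ N * (2 ^ (β - 2) * σ ^ (-(β - 2))) * (σ ^ 3 * wInt β) * σ ^ (β - 5) := by gcongr
    _ = 2 ^ (β - 2) * wInt β * N * (σ ^ (-(β - 2)) * σ ^ 3 * σ ^ (β - 5)) := by ring
    _ = _ := by rw [e2, mul_one]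

/-- A distribution bounded by `b` near its bulk velocity has density at most `C b T^{3/2}`. -/
theorem dens_le_of_ball (h : Adm β N g) (hβ : 5 < β) (hρ : 0 < dens g) {b : ℝ} (hb : 0 ≤ b)
    (hg : ∀ v, ‖v - bulk g‖ ≤ 3 * √(temp g) → g v ≤ b) :
    dens g ≤ 2 * b * volume.real (Metric.ball (0 : E3) 4) * √(temp g) ^ 3 := by
  have hk := h.kin hβ
  have hσ := hk.sqrt_temp_pos hρ
  set σ := √(temp g) with hσd
  have hp : ∀ v, g v ≤ (Metric.ball (bulk g) (4 * σ)).indicator (fun _ => b) v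
      + (9 * σ ^ 2)⁻¹ * (‖v - bulk g‖ ^ 2 * g v) := fun v => by
    rcases le_or_gt ‖v - bulk g‖ (3 * σ) with hv | hv
    · rw [Set.indicator_of_mem (by rw [mem_ball_iff_norm]; linarith)]
      have : 0 ≤ (9 * σ ^ 2)⁻¹ * (‖v - bulk g‖ ^ 2 * g v) := by
        have := h.nonneg v
        positivity
      linarith [hg v hv]
    · have h1 : 1 ≤ (9 * σ ^ 2)⁻¹ * ‖v - bulk g‖ ^ 2 := by
        rw [inv_mul_eq_div, one_le_div (by positivity)]
        nlinarith
      have h2 := mul_le_mul_of_nonneg_right h1 (h.nonneg v)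
      have h3 : 0 ≤ (Metric.ball (bulk g) (4 * σ)).indicator (fun _ => b) v :=
        Set.indicator_nonneg (fun _ _ => hb) v
      linarith
  have i1 : Integrable ((Metric.ball (bulk g) (4 * σ)).indicator fun _ : E3 => b) :=
    (integrable_indicator_iff measurableSet_ball).2
      (integrableOn_const (by finiteness))
  have h1 := integral_mono hk.integrable (i1.add ((hk.integrable_norm_sub_sq (bulk g)).const_mul
    (9 * σ ^ 2)⁻¹)) hp
  simp only [Pi.add_apply] at h1
  rw [integral_add i1 ((hk.integrable_norm_sub_sq _).const_mul _), integral_const_mul,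
    hk.integral_norm_sub_bulk_sq hρ, integral_indicator measurableSet_ball, setIntegral_const,
    ← hσd] at h1
  have h2 : volume.real (Metric.ball (bulk g) (4 * σ))
      = σ ^ 3 * volume.real (Metric.ball (0 : E3) 4) := by
    rw [mul_comm 4 σ, Measure.real, Measure.addHaar_ball_mul volume (bulk g) hσ.le 4,
      ENNReal.toReal_mul, ENNReal.toReal_ofReal (by positivity)]
    simp [Measure.real]
  rw [h2, smul_eq_mul] at h1
  have h3 : (9 * σ ^ 2)⁻¹ * (3 * dens g * σ ^ 2) = dens g / 3 := by field_simp; norm_num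
  have h4 : ∫ v, g v = dens g := rfl
  rw [h3, h4] at h1
  have h5 : 0 ≤ b * volume.real (Metric.ball (0 : E3) 4) * σ ^ 3 := by positivity
  nlinarith

theorem dens_le_temp (h : Adm β N g) (hβ : 5 < β) (hρ : 0 < dens g) :
    dens g ≤ 2 * N * volume.real (Metric.ball (0 : E3) 4) * √(temp g) ^ 3 := by
  refine h.dens_le_of_ball hβ hρ h.N_nonneg fun v _ => ?_
  have h1 : (1 : ℝ) ≤ (1 + ‖v‖) ^ β := Real.one_le_rpow (by linarith [norm_nonneg v]) (by linarith)
  nlinarith [h.le v, h.nonneg v]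

theorem exists_bulk_bound (β : ℝ) (hβ : 5 < β) : ∃ C, 0 ≤ C ∧ ∀ {N : ℝ} {g : E3 → ℝ},
    Adm β N g → 0 < dens g → dens g / √(temp g) ^ 3 * (1 + ‖bulk g‖) ^ β ≤ C * N := by
  refine ⟨2 * 2 ^ β * volume.real (Metric.ball (0 : E3) 4) + 6 ^ β * (2 ^ (β - 2) * wInt β),
    by have := wInt_nonneg β; positivity, fun {N g} h hρ => ?_⟩
  have hk := h.kin hβ
  have hσ := hk.sqrt_temp_pos hρ
  have hN := h.N_nonneg
  have hW := wInt_nonneg β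
  have hu : 0 < 1 + ‖bulk g‖ := by positivity
  rcases le_or_gt (6 * √(temp g)) (1 + ‖bulk g‖) with hc | hc
  · have h1 := h.dens_le_of_ball hβ hρ (b := N * (2 ^ β * (1 + ‖bulk g‖) ^ (-β))) (by positivity)
      fun v hv => by
        refine (h.le_weight v).trans (mul_le_mul_of_nonneg_left ?_ hN)
        have e : (2 : ℝ) ^ β = (2⁻¹ : ℝ) ^ (-β) := by
          rw [Real.rpow_neg (by norm_num), Real.inv_rpow (by norm_num), inv_inv]
        rw [e, ← Real.mul_rpow (by norm_num) hu.le]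
        refine Real.rpow_le_rpow_of_nonpos (by positivity) ?_ (by linarith)
        have := norm_sub_norm_le (bulk g) v
        rw [norm_sub_rev] at this
        linarith
    have h2 : dens g / √(temp g) ^ 3
        ≤ 2 * (N * (2 ^ β * (1 + ‖bulk g‖) ^ (-β))) * volume.real (Metric.ball (0 : E3) 4) := by
      rwa [div_le_iff₀ (by positivity)]
    have h3 := mul_le_mul_of_nonneg_right h2 (Real.rpow_nonneg hu.le β)
    have e : (1 + ‖bulk g‖) ^ (-β) * (1 + ‖bulk g‖) ^ β = 1 := by
      rw [← Real.rpow_add hu]; simp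
    have e2 : 2 * (N * (2 ^ β * (1 + ‖bulk g‖) ^ (-β))) * volume.real (Metric.ball (0 : E3) 4)
        * (1 + ‖bulk g‖) ^ β = 2 * 2 ^ β * volume.real (Metric.ball (0 : E3) 4) * N := by
      linear_combination (2 * N * 2 ^ β * volume.real (Metric.ball (0 : E3) 4)) * e
    rw [e2] at h3
    refine h3.trans (mul_le_mul_of_nonneg_right ?_ hN)
    have : 0 ≤ (6 : ℝ) ^ β * (2 ^ (β - 2) * wInt β) := by positivity
    linarith
  · have h1 := h.dens_mul_rpow_le hβ hρ
    have h2 : (1 + ‖bulk g‖) ^ β ≤ 6 ^ β * √(temp g) ^ β := by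
      rw [← Real.mul_rpow (by norm_num) hσ.le]
      exact Real.rpow_le_rpow hu.le hc.le (by linarith)
    have e : dens g / √(temp g) ^ 3 * (6 ^ β * √(temp g) ^ β)
        = 6 ^ β * (dens g * √(temp g) ^ (β - 3)) := by
      rw [Real.rpow_sub hσ, show (3 : ℝ) = ((3 : ℕ) : ℝ) by norm_num, Real.rpow_natCast]
      ring
    calc _ ≤ dens g / √(temp g) ^ 3 * (6 ^ β * √(temp g) ^ β) := by gcongr
      _ ≤ 6 ^ β * (2 ^ (β - 2) * wInt β * N) := by rw [e]; gcongr
      _ = 6 ^ β * (2 ^ (β - 2) * wInt β) * N := by ring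
      _ ≤ _ := by
        refine mul_le_mul_of_nonneg_right ?_ hN
        have : 0 ≤ 2 * (2 : ℝ) ^ β * volume.real (Metric.ball (0 : E3) 4) := by positivity
        linarith

end Adm

end ESBGK

namespace ESBGK

/-! ### Weighted bounds on the anisotropic Gaussian -/

theorem exists_rpow_mul_exp_le (β : ℝ) (hβ : 0 ≤ β) :
    ∃ C, 1 ≤ C ∧ ∀ s : ℝ, 0 ≤ s → s ^ β * Real.exp (-s ^ 2 / 6) ≤ C := by
  obtain ⟨n, hn⟩ := exists_nat_ge β
  refine ⟨1 + 6 ^ n * n.factorial, by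
    have : (0 : ℝ) ≤ 6 ^ n * n.factorial := by positivity
    linarith, fun s hs => ?_⟩
  have hF : (0 : ℝ) < n.factorial := by positivity
  rcases le_total s 1 with h1 | h1
  · have a1 : s ^ β ≤ 1 := Real.rpow_le_one hs h1 hβ
    have a2 : Real.exp (-s ^ 2 / 6) ≤ 1 := Real.exp_le_one_iff.2 (by nlinarith)
    have : (0 : ℝ) ≤ 6 ^ n * n.factorial := by positivity
    nlinarith [Real.exp_pos (-s ^ 2 / 6)]
  · have a1 : s ^ β ≤ (s ^ 2) ^ n := by
      calc s ^ β ≤ s ^ (n : ℝ) := Real.rpow_le_rpow_of_exponent_le h1 hn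
        _ = s ^ n := Real.rpow_natCast s n
        _ ≤ (s ^ 2) ^ n := by gcongr; nlinarith
    have a2 := Real.pow_div_factorial_le_exp (s ^ 2 / 6) (by positivity) n
    rw [div_le_iff₀ hF] at a2
    have a3 : (s ^ 2) ^ n ≤ 6 ^ n * n.factorial * Real.exp (s ^ 2 / 6) := by
      rw [div_pow, div_le_iff₀ (by positivity)] at a2
      linarith
    have a4 : Real.exp (s ^ 2 / 6) * Real.exp (-s ^ 2 / 6) = 1 := by
      rw [← Real.exp_add]; ring_nf; simp
    calc s ^ β * Real.exp (-s ^ 2 / 6)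
        ≤ 6 ^ n * n.factorial * Real.exp (s ^ 2 / 6) * Real.exp (-s ^ 2 / 6) := by
          gcongr; exact a1.trans a3
      _ = 6 ^ n * n.factorial := by rw [mul_assoc, a4, mul_one]
      _ ≤ _ := by linarith

theorem one_add_norm_rpow_le {β : ℝ} (hβ : 0 ≤ β) (u v : E3) :
    (1 + ‖v‖) ^ β ≤ 2 ^ β * ((1 + ‖u‖) ^ β + ‖v - u‖ ^ β) := by
  have h1 : ‖v‖ ≤ ‖u‖ + ‖v - u‖ := by
    simpa using norm_add_le u (v - u)
  rcases le_total (1 + ‖u‖) ‖v - u‖ with h | h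
  · have h2 : (1 + ‖v‖) ^ β ≤ (2 * ‖v - u‖) ^ β :=
      Real.rpow_le_rpow (by positivity) (by linarith) hβ
    rw [Real.mul_rpow (by norm_num) (norm_nonneg _)] at h2
    have : (0 : ℝ) ≤ 2 ^ β * (1 + ‖u‖) ^ β := by positivity
    linarith
  · have h2 : (1 + ‖v‖) ^ β ≤ (2 * (1 + ‖u‖)) ^ β :=
      Real.rpow_le_rpow (by positivity) (by linarith) hβ
    rw [Real.mul_rpow (by norm_num) (by positivity)] at h2
    have : (0 : ℝ) ≤ 2 ^ β * ‖v - u‖ ^ β := by positivity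
    linarith

theorem exists_weight_mul_aGauss_le {β ν : ℝ} (hβ : 5 < β) (hν1 : -(1 / 2 : ℝ) < ν) (hν2 : ν < 1) :
    ∃ C, 1 ≤ C ∧ ∀ {g : E3 → ℝ} {P : ℝ}, Kin g → 0 < dens g →
      dens g / √(temp g) ^ 3 * (1 + ‖bulk g‖) ^ β ≤ P →
      dens g * √(temp g) ^ (β - 3) ≤ P → ∀ v, (1 + ‖v‖) ^ β * aGauss g ν v ≤ C * P := by
  obtain ⟨C, hC, hCs⟩ := exists_rpow_mul_exp_le β (by linarith)
  set k := (√(min (1 - ν) (1 + 2 * ν) ^ 3))⁻¹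
  have hk : 0 ≤ k := by positivity
  refine ⟨1 + k * 2 ^ β * (1 + C), by
    have : 0 ≤ k * 2 ^ β * (1 + C) := by positivity
    linarith, fun {g P} h hρ h1 h2 v => ?_⟩
  have hσ := h.sqrt_temp_pos hρ
  have hP : 0 ≤ P := le_trans (by positivity) h2
  set σ := √(temp g)
  set s := ‖v - bulk g‖ / σ with hs
  have hs0 : 0 ≤ s := by positivity
  have hsσ : ‖v - bulk g‖ = σ * s := by rw [hs]; field_simp
  have e1 : σ ^ β / σ ^ 3 = σ ^ (β - 3) := by
    rw [Real.rpow_sub hσ, show (3 : ℝ) = ((3 : ℕ) : ℝ) by norm_num, Real.rpow_natCast]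
  have a1 : Real.exp (-s ^ 2 / 6) ≤ 1 := Real.exp_le_one_iff.2 (by nlinarith)
  have hE := Real.exp_pos (-s ^ 2 / 6)
  have a2 : dens g / σ ^ 3 * (1 + ‖bulk g‖) ^ β * Real.exp (-s ^ 2 / 6) ≤ P := by
    have : 0 ≤ dens g / σ ^ 3 * (1 + ‖bulk g‖) ^ β := by positivity
    nlinarith
  have a3 : dens g * σ ^ (β - 3) * (s ^ β * Real.exp (-s ^ 2 / 6)) ≤ P * C := by
    have := hCs s hs0
    gcongr
  calc (1 + ‖v‖) ^ β * aGauss g ν v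
      ≤ (2 ^ β * ((1 + ‖bulk g‖) ^ β + ‖v - bulk g‖ ^ β))
        * (k * (dens g / σ ^ 3) * Real.exp (-s ^ 2 / 6)) := by
        have := h.aGauss_le hρ hν1 hν2 v
        have h0 := (h.aGauss_pos hρ hν1 hν2 v).le
        gcongr
        exact one_add_norm_rpow_le (by linarith) _ _
    _ = k * 2 ^ β * (dens g / σ ^ 3 * (1 + ‖bulk g‖) ^ β * Real.exp (-s ^ 2 / 6)
        + dens g * (σ ^ β / σ ^ 3) * (s ^ β * Real.exp (-s ^ 2 / 6))) := by
        rw [hsσ, Real.mul_rpow hσ.le hs0]; ring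
    _ ≤ k * 2 ^ β * (P + P * C) := by rw [e1]; gcongr
    _ = k * 2 ^ β * (1 + C) * P := by ring
    _ ≤ _ := by nlinarith

namespace Adm

/-- The collision frequency and the anisotropic Gaussian are controlled by the weighted bound,
without any lower bound on the density. -/
theorem exists_bounds {β ν : ℝ} (hβ : 5 < β) (hν1 : -(1 / 2 : ℝ) < ν) (hν2 : ν < 1) :
    ∃ C, 1 ≤ C ∧ ∀ {g : E3 → ℝ} {N : ℝ}, Adm β N g → 0 < dens g →
      (collFreq g ν ≤ C * N) ∧ ∀ v, (1 + ‖v‖) ^ β * aGauss g ν v ≤ C * N := by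
  obtain ⟨C₁, h1, hC₁⟩ := exists_weight_mul_aGauss_le hβ hν1 hν2
  obtain ⟨C₂, h2, hC₂⟩ := exists_bulk_bound β hβ
  have hW := wInt_nonneg β
  have hν : 0 < 1 - ν := by linarith
  refine ⟨C₁ + C₁ * (C₂ + 2 ^ (β - 2) * wInt β) + wInt β / (1 - ν), ?_, fun {g N} h hρ => ?_⟩
  · have : 0 ≤ C₁ * (C₂ + 2 ^ (β - 2) * wInt β) + wInt β / (1 - ν) := by positivity
    linarith
  · have hN := h.N_nonneg
    have hk := h.kin hβ
    constructor
    · calc collFreq g ν ≤ N * wInt β / (1 - ν) := by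
            exact div_le_div_of_nonneg_right (h.dens_mul_temp_le hβ hρ) hν.le
        _ = wInt β / (1 - ν) * N := by ring
        _ ≤ _ := by
          refine mul_le_mul_of_nonneg_right ?_ hN
          have : 0 ≤ C₁ * (C₂ + 2 ^ (β - 2) * wInt β) := by positivity
          linarith
    · intro v
      refine (hC₁ (P := (C₂ + 2 ^ (β - 2) * wInt β) * N) hk hρ ?_ ?_ v).trans ?_
      · refine (hC₂ h hρ).trans (mul_le_mul_of_nonneg_right ?_ hN)
        have : 0 ≤ 2 ^ (β - 2) * wInt β := by positivity
        linarith
      · refine (h.dens_mul_rpow_le hβ hρ).trans (mul_le_mul_of_nonneg_right ?_ hN)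
        linarith
      · rw [← mul_assoc]
        refine mul_le_mul_of_nonneg_right ?_ hN
        have : 0 ≤ wInt β / (1 - ν) := by positivity
        linarith

end Adm

end ESBGK

namespace ESBGK

/-! ### Measurability of the macroscopic fields -/

section Measurability

variable {Z : Type*} [MeasurableSpace Z] {f : Z → E3 → ℝ}

theorem measurable_integral_snd {F : Type*} [NormedAddCommGroup F] [NormedSpace ℝ F]
    [MeasurableSpace F] [BorelSpace F] [SecondCountableTopology F] {f : Z → E3 → F}
    (hf : Measurable (Function.uncurry f)) : Measurable fun z => ∫ v, f z v :=
  (StronglyMeasurable.integral_prod_right hf.stronglyMeasurable).measurable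

theorem measurable_dens (hf : Measurable (Function.uncurry f)) : Measurable fun z => dens (f z) :=
  measurable_integral_snd hf

theorem measurable_bulk (hf : Measurable (Function.uncurry f)) : Measurable fun z => bulk (f z) :=
  (measurable_dens hf).inv.smul (measurable_integral_snd (f := fun z v => f z v • v)
    (hf.smul measurable_snd))

theorem measurable_sub_bulk (hf : Measurable (Function.uncurry f)) :
    Measurable fun p : Z × E3 => p.2 - bulk (f p.1) :=
  measurable_snd.sub ((measurable_bulk hf).comp measurable_fst)

theorem measurable_coord (i : Fin 3) : Measurable fun v : E3 => v i := by fun_prop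

theorem measurable_temp (hf : Measurable (Function.uncurry f)) : Measurable fun z => temp (f z) :=
  (measurable_const.mul (measurable_dens hf)).inv.mul
    (measurable_integral_snd (f := fun z v => ‖v - bulk (f z)‖ ^ 2 * f z v)
      (((measurable_sub_bulk hf).norm.pow_const 2).mul hf))

theorem measurable_stress (hf : Measurable (Function.uncurry f)) (i j : Fin 3) :
    Measurable fun z => stress (f z) i j :=
  (measurable_dens hf).inv.mul
    (measurable_integral_snd
      (f := fun z v => (v - bulk (f z)) i * (v - bulk (f z)) j * f z v)
      ((((measurable_coord i).comp (measurable_sub_bulk hf)).mul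
        ((measurable_coord j).comp (measurable_sub_bulk hf))).mul hf))

theorem measurable_tempTensor (hf : Measurable (Function.uncurry f)) (ν : ℝ) (i j : Fin 3) :
    Measurable fun z => tempTensor (f z) ν i j := by
  simp only [tempTensor, Matrix.add_apply, Matrix.smul_apply, smul_eq_mul]
  exact (((measurable_temp hf).const_mul _).mul_const _).add ((measurable_stress hf i j).const_mul _)

theorem measurable_det {A : Z → Matrix (Fin 3) (Fin 3) ℝ}
    (hA : ∀ i j, Measurable fun z => A z i j) : Measurable fun z => (A z).det := by
  simp only [Matrix.det_fin_three]
  fun_prop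

theorem measurable_inv_apply {A : Z → Matrix (Fin 3) (Fin 3) ℝ}
    (hA : ∀ i j, Measurable fun z => A z i j) (i j : Fin 3) :
    Measurable fun z => (A z)⁻¹ i j := by
  have hd := measurable_det hA
  simp only [Matrix.inv_def, Ring.inverse_eq_inv', Matrix.smul_apply, smul_eq_mul]
  refine hd.inv.mul ?_
  simp only [Matrix.adjugate_fin_three]
  fin_cases i <;> fin_cases j <;> simp <;> fun_prop

theorem measurable_collFreq (hf : Measurable (Function.uncurry f)) (ν : ℝ) :
    Measurable fun z => collFreq (f z) ν :=
  ((measurable_dens hf).mul (measurable_temp hf)).div_const _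

theorem measurable_aGauss (hf : Measurable (Function.uncurry f)) (ν : ℝ) :
    Measurable fun p : Z × E3 => aGauss (f p.1) ν p.2 := by
  have hT := measurable_tempTensor hf ν
  have hq : Measurable fun p : Z × E3 =>
      quad (tempTensor (f p.1) ν)⁻¹ (p.2 - bulk (f p.1)) := by
    simp only [quad_eq_sum]
    refine Finset.measurable_sum _ fun i _ => Finset.measurable_sum _ fun j _ => ?_
    exact ((measurable_inv_apply hT i j).comp measurable_fst).mul
      (((measurable_coord i).comp (measurable_sub_bulk hf)).mul
        ((measurable_coord j).comp (measurable_sub_bulk hf)))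
  simp only [aGauss_eq_gauss, gauss, sqrt_det_two_pi_smul]
  refine Measurable.mul ?_ (Real.measurable_exp.comp (hq.const_mul _))
  exact ((measurable_dens hf).comp measurable_fst).div
    (((measurable_det hT).comp measurable_fst).sqrt.const_mul _)

end Measurability

end ESBGK

namespace ESBGK

/-! ### Lipschitz dependence of the macroscopic fields -/

/-- The weighted `L¹` distance between velocity distributions. -/
noncomputable def vdist (f g : E3 → ℝ) : ℝ := ∫ v, (1 + ‖v‖) ^ 2 * |f v - g v|

theorem vdist_nonneg (f g : E3 → ℝ) : 0 ≤ vdist f g :=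
  integral_nonneg fun v => by positivity

/-- Admissible distributions with density bounded below. -/
structure Reg (β N c : ℝ) (g : E3 → ℝ) : Prop where
  adm : Adm β N g
  le_dens : c ≤ dens g

/-- A family of functionals that is uniformly bounded and Lipschitz on a class `S`. -/
def LipF {ι : Type*} (S : (E3 → ℝ) → Prop) (X : ι → (E3 → ℝ) → ℝ) : Prop :=
  ∃ B, 0 ≤ B ∧ (∀ i f, S f → |X i f| ≤ B) ∧
    ∀ i f g, S f → S g → |X i f - X i g| ≤ B * vdist f g

namespace LipF

variable {ι : Type*} {S : (E3 → ℝ) → Prop} {X Y : ι → (E3 → ℝ) → ℝ}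

theorem congr (hX : LipF S X) (h : ∀ i f, S f → Y i f = X i f) : LipF S Y := by
  obtain ⟨B, hB, h1, h2⟩ := hX
  refine ⟨B, hB, fun i f hf => ?_, fun i f g hf hg => ?_⟩
  · rw [h i f hf]; exact h1 i f hf
  · rw [h i f hf, h i g hg]; exact h2 i f g hf hg

theorem const {c : ι → ℝ} {B : ℝ} (hc : ∀ i, |c i| ≤ B) : LipF S fun i _ => c i := by
  refine ⟨max B 0, le_max_right _ _, fun i f _ => (hc i).trans (le_max_left _ _),
    fun i f g _ _ => ?_⟩
  rw [sub_self, abs_zero]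
  exact mul_nonneg (le_max_right _ _) (vdist_nonneg f g)

theorem add (hX : LipF S X) (hY : LipF S Y) : LipF S fun i f => X i f + Y i f := by
  obtain ⟨B, hB, h1, h2⟩ := hX
  obtain ⟨C, hC, h3, h4⟩ := hY
  refine ⟨B + C, add_nonneg hB hC, fun i f hf => ?_, fun i f g hf hg => ?_⟩
  · exact (abs_add_le _ _).trans (add_le_add (h1 i f hf) (h3 i f hf))
  · rw [add_sub_add_comm, add_mul]
    exact (abs_add_le _ _).trans (add_le_add (h2 i f g hf hg) (h4 i f g hf hg))

theorem mul (hX : LipF S X) (hY : LipF S Y) : LipF S fun i f => X i f * Y i f := by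
  obtain ⟨B, hB, h1, h2⟩ := hX
  obtain ⟨C, hC, h3, h4⟩ := hY
  refine ⟨B * C + B * C, by positivity, fun i f hf => ?_, fun i f g hf hg => ?_⟩
  · rw [abs_mul]
    have := mul_le_mul (h1 i f hf) (h3 i f hf) (abs_nonneg _) hB
    have : 0 ≤ B * C := by positivity
    linarith
  · have e : X i f * Y i f - X i g * Y i g
        = (X i f - X i g) * Y i f + X i g * (Y i f - Y i g) := by ring
    rw [e]
    refine (abs_add_le _ _).trans ?_
    rw [abs_mul, abs_mul]
    have hd := vdist_nonneg f g
    have a1 := mul_le_mul (h2 i f g hf hg) (h3 i f hf) (abs_nonneg _) (by positivity)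
    have a2 := mul_le_mul (h1 i g hg) (h4 i f g hf hg) (abs_nonneg _) hB
    linarith

theorem const_mul (hX : LipF S X) (c : ℝ) : LipF S fun i f => c * X i f :=
  (const (c := fun _ => c) fun _ => le_rfl).mul hX

theorem neg (hX : LipF S X) : LipF S fun i f => -X i f := by
  simpa using hX.const_mul (-1)

theorem sub (hX : LipF S X) (hY : LipF S Y) : LipF S fun i f => X i f - Y i f := by
  simpa [sub_eq_add_neg] using hX.add hY.neg

theorem sum {κ : Type*} [Fintype κ] {X : κ → ι → (E3 → ℝ) → ℝ} (hX : ∀ k, LipF S (X k)) :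
    LipF S fun i f => ∑ k, X k i f := by
  classical
  have : ∀ s : Finset κ, LipF S fun i f => ∑ k ∈ s, X k i f := fun s => by
    induction s using Finset.induction_on with
    | empty =>
      simpa using const (ι := ι) (S := S) (c := fun _ => (0 : ℝ)) (B := 0) fun _ => by simp
    | insert a s ha ih =>
      simp only [Finset.sum_insert ha]
      exact (hX a).add ih
  exact this _

theorem inv (hX : LipF S X) {c : ℝ} (hc : 0 < c) (h : ∀ i f, S f → c ≤ X i f) :
    LipF S fun i f => (X i f)⁻¹ := by
  obtain ⟨B, hB, h1, h2⟩ := hX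
  have h0 : ∀ i f, S f → |(X i f)⁻¹| ≤ c⁻¹ := fun i f hf => by
    have := h i f hf
    rw [abs_of_nonneg (inv_nonneg.2 (hc.le.trans this))]
    exact inv_anti₀ hc this
  refine ⟨c⁻¹ + c⁻¹ * c⁻¹ * B, by positivity, fun i f hf => (h0 i f hf).trans ?_,
    fun i f g hf hg => ?_⟩
  · have : 0 ≤ c⁻¹ * c⁻¹ * B := by positivity
    linarith
  · have hf0 := (hc.trans_le (h i f hf)).ne'
    have hg0 := (hc.trans_le (h i g hg)).ne'
    have e : (X i f)⁻¹ - (X i g)⁻¹ = -((X i f)⁻¹ * (X i g)⁻¹ * (X i f - X i g)) := by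
      field_simp; ring
    rw [e, abs_neg, abs_mul, abs_mul]
    have hd := vdist_nonneg f g
    have a1 := mul_le_mul (mul_le_mul (h0 i f hf) (h0 i g hg) (abs_nonneg _) (by positivity))
      (h2 i f g hf hg) (abs_nonneg _) (by positivity)
    have : 0 ≤ c⁻¹ * vdist f g := by positivity
    linarith

theorem sqrt (hX : LipF S X) {c : ℝ} (hc : 0 < c) (h : ∀ i f, S f → c ≤ X i f) :
    LipF S fun i f => √(X i f) := by
  obtain ⟨B, hB, h1, h2⟩ := hX
  have hc' := Real.sqrt_pos.2 hc
  refine ⟨√B + (√c)⁻¹ * B, by positivity, fun i f hf => ?_, fun i f g hf hg => ?_⟩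
  · rw [abs_of_nonneg (Real.sqrt_nonneg _)]
    have := Real.sqrt_le_sqrt ((le_abs_self _).trans (h1 i f hf))
    have : 0 ≤ (√c)⁻¹ * B := by positivity
    linarith
  · have a1 := Real.sqrt_le_sqrt (h i f hf)
    have a2 := Real.sqrt_nonneg (X i g)
    have e1 := Real.sq_sqrt (hc.le.trans (h i f hf))
    have e2 := Real.sq_sqrt (hc.le.trans (h i g hg))
    have e : |√(X i f) - √(X i g)| * (√(X i f) + √(X i g)) = |X i f - X i g| := by
      rw [← abs_of_nonneg (add_nonneg (Real.sqrt_nonneg (X i f)) a2), ← abs_mul]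
      congr 1
      nlinarith
    have hd := vdist_nonneg f g
    have a3 : |√(X i f) - √(X i g)| * √c ≤ B * vdist f g := by
      refine le_trans ?_ (e ▸ h2 i f g hf hg)
      gcongr
      linarith
    have a4 : |√(X i f) - √(X i g)| ≤ (√c)⁻¹ * (B * vdist f g) := by
      rwa [inv_mul_eq_div, le_div_iff₀ hc']
    have : 0 ≤ √B * vdist f g := by positivity
    linarith

theorem det {A : ι → (E3 → ℝ) → Matrix (Fin 3) (Fin 3) ℝ}
    (h : ∀ i j, LipF S fun k f => A k f i j) : LipF S fun k f => (A k f).det := by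
  simp only [Matrix.det_fin_three]
  exact (((((((h 0 0).mul (h 1 1)).mul (h 2 2)).sub (((h 0 0).mul (h 1 2)).mul (h 2 1))).sub
    (((h 0 1).mul (h 1 0)).mul (h 2 2))).add (((h 0 1).mul (h 1 2)).mul (h 2 0))).add
    (((h 0 2).mul (h 1 0)).mul (h 2 1))).sub (((h 0 2).mul (h 1 1)).mul (h 2 0))

end LipF

theorem Adm.integrable_vdist {β N : ℝ} {f g : E3 → ℝ} (hβ : 5 < β) (hf : Adm β N f)
    (hg : Adm β N g) : Integrable fun v => (1 + ‖v‖) ^ 2 * |f v - g v| := by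
  refine ((hf.kin hβ).int.add (hg.kin hβ).int).mono' ?_ (Filter.Eventually.of_forall fun v => ?_)
  · exact (((measurable_const.add measurable_norm).pow_const 2).mul
      (hf.meas.sub hg.meas).abs).aestronglyMeasurable
  · rw [Real.norm_eq_abs, abs_of_nonneg (by positivity), Pi.add_apply, ← mul_add]
    gcongr
    rw [abs_le]
    have := hf.nonneg v
    have := hg.nonneg v
    constructor <;> linarith

section Fields

variable {ι : Type*} {β N c ν : ℝ}

theorem lipF_moment (hβ : 5 < β) {φ : E3 → ℝ} (hm : Measurable φ)
    (hφ : ∀ v, |φ v| ≤ (1 + ‖v‖) ^ 2) :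
    LipF (Reg β N c) fun (_ : ι) f => ∫ v, φ v * f v := by
  refine ⟨max (N * wInt β) 1, by positivity, fun _ f hf =>
    (hf.adm.integral_mul_le hβ hφ).trans (le_max_left _ _), fun _ f g hf hg => ?_⟩
  have i1 := (hf.adm.kin hβ).integrable_mul hm (C := 1) (by simpa using hφ)
  have i2 := (hg.adm.kin hβ).integrable_mul hm (C := 1) (by simpa using hφ)
  rw [← integral_sub i1 i2]
  have h1 : |∫ v, (φ v * f v - φ v * g v)| ≤ vdist f g := by
    rw [← Real.norm_eq_abs]
    refine norm_integral_le_of_norm_le (hf.adm.integrable_vdist hβ hg.adm)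
      (Filter.Eventually.of_forall fun v => ?_)
    rw [Real.norm_eq_abs, ← mul_sub, abs_mul]
    gcongr
    exact hφ v
  refine h1.trans (le_mul_of_one_le_left (vdist_nonneg f g) (le_max_right _ _))

theorem lipF_dens (hβ : 5 < β) : LipF (Reg β N c) fun (_ : ι) f => dens f := by
  simpa [dens] using lipF_moment (ι := ι) (N := N) (c := c) hβ (φ := fun _ => 1)
    measurable_const fun v => by rw [abs_one]; nlinarith [norm_nonneg v]

theorem lipF_inv_dens (hβ : 5 < β) (hc : 0 < c) :
    LipF (Reg β N c) fun (_ : ι) f => (dens f)⁻¹ :=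
  (lipF_dens hβ).inv hc fun _ _ hf => hf.le_dens

theorem lipF_bulk (hβ : 5 < β) (hc : 0 < c) (i : Fin 3) :
    LipF (Reg β N c) fun (_ : ι) f => bulk f i :=
  ((lipF_inv_dens hβ hc).mul (lipF_moment hβ (measurable_coord i) fun v => by
    nlinarith [abs_coord_le v i, norm_nonneg v])).congr fun _ _ hf =>
      (hf.adm.kin hβ).bulk_coord i

theorem lipF_stress (hβ : 5 < β) (hc : 0 < c) (i j : Fin 3) :
    LipF (Reg β N c) fun (_ : ι) f => stress f i j :=
  (((lipF_inv_dens hβ hc).mul (lipF_moment hβ ((measurable_coord i).mul (measurable_coord j))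
    fun v => by
      rw [Pi.mul_apply, abs_mul]
      have := mul_le_mul (abs_coord_le v i) (abs_coord_le v j) (abs_nonneg _) (norm_nonneg _)
      nlinarith [norm_nonneg v])).sub ((lipF_bulk hβ hc i).mul (lipF_bulk hβ hc j))).congr
        fun _ _ hf => (hf.adm.kin hβ).stress_apply (hc.trans_le hf.le_dens) i j

theorem lipF_temp (hβ : 5 < β) (hc : 0 < c) : LipF (Reg β N c) fun (_ : ι) f => temp f :=
  ((LipF.sum fun i => lipF_stress (ι := ι) hβ hc i i).const_mul (3⁻¹)).congr fun _ _ hf => by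
    rw [(hf.adm.kin hβ).temp_eq_trace, Matrix.trace, div_eq_inv_mul]
    rfl

theorem lipF_collFreq (hβ : 5 < β) (hc : 0 < c) :
    LipF (Reg β N c) fun (_ : ι) f => collFreq f ν :=
  (((lipF_dens hβ).mul (lipF_temp hβ hc)).const_mul (1 - ν)⁻¹).congr fun _ _ _ => by
    rw [collFreq]; ring

theorem lipF_tempTensor (hβ : 5 < β) (hc : 0 < c) (i j : Fin 3) :
    LipF (Reg β N c) fun (_ : ι) f => tempTensor f ν i j :=
  (((lipF_temp hβ hc).const_mul ((1 - ν) * (1 : Matrix (Fin 3) (Fin 3) ℝ) i j)).add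
    ((lipF_stress hβ hc i j).const_mul ν)).congr fun _ _ _ => by
      simp only [tempTensor, Matrix.add_apply, Matrix.smul_apply, smul_eq_mul]; ring

theorem exists_le_temp (hβ : 5 < β) (hc : 0 < c) :
    ∃ θ, 0 < θ ∧ ∀ f, Reg β N c f → θ ≤ temp f := by
  rcases le_or_gt (2 * N * volume.real (Metric.ball (0 : E3) 4)) 0 with hV | hV
  · refine ⟨1, one_pos, fun f hf => ?_⟩
    have hρ := hc.trans_le hf.le_dens
    have := hf.adm.dens_le_temp hβ hρ
    have h3 := pow_pos ((hf.adm.kin hβ).sqrt_temp_pos hρ) 3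
    nlinarith
  · set V := 2 * N * volume.real (Metric.ball (0 : E3) 4)
    refine ⟨min (c / V) 1, by positivity, fun f hf => ?_⟩
    have hρ := hc.trans_le hf.le_dens
    have h1 := hf.adm.dens_le_temp hβ hρ
    have hσ := (hf.adm.kin hβ).sqrt_temp_pos hρ
    rw [← (hf.adm.kin hβ).sq_sqrt_temp hρ]
    have h2 : c / V ≤ √(temp f) ^ 3 := by
      rw [div_le_iff₀ hV]; linarith [hf.le_dens]
    rcases le_total (√(temp f)) 1 with h | h
    · refine (min_le_left _ _).trans (h2.trans ?_)
      nlinarith [pow_pos hσ 2]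
    · refine (min_le_right _ _).trans ?_
      nlinarith

theorem exists_le_det (hβ : 5 < β) (hc : 0 < c) (hν1 : -(1 / 2 : ℝ) < ν) (hν2 : ν < 1) :
    ∃ δ, 0 < δ ∧ ∀ f, Reg β N c f → δ ≤ (tempTensor f ν).det := by
  obtain ⟨θ, hθ, h⟩ := exists_le_temp (N := N) hβ hc
  have hκ := Kin.min_pos hν1 hν2
  refine ⟨(min (1 - ν) (1 + 2 * ν) * θ) ^ 3, by positivity, fun f hf => ?_⟩
  have hρ := hc.trans_le hf.le_dens
  refine le_trans ?_ (pow_three_le_det (Kin.isHermitian_tempTensor f ν)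
    (mul_pos hκ ((hf.adm.kin hβ).temp_pos hρ)).le ((hf.adm.kin hβ).le_quad_tempTensor hρ))
  have := h f hf
  gcongr

theorem lipF_inv_tempTensor (hβ : 5 < β) (hc : 0 < c) (hν1 : -(1 / 2 : ℝ) < ν) (hν2 : ν < 1)
    (i j : Fin 3) : LipF (Reg β N c) fun (_ : ι) f => (tempTensor f ν)⁻¹ i j := by
  obtain ⟨δ, hδ, hd⟩ := exists_le_det (N := N) hβ hc hν1 hν2
  have h := fun i j => lipF_tempTensor (ι := ι) (β := β) (N := N) (c := c) (ν := ν) hβ hc i j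
  simp only [Matrix.inv_def, Ring.inverse_eq_inv', Matrix.smul_apply, smul_eq_mul]
  refine ((LipF.det h).inv hδ fun _ f hf => hd f hf).mul ?_
  simp only [Matrix.adjugate_apply]
  refine LipF.det fun k l => ?_
  simp only [Matrix.updateRow_apply]
  split_ifs
  · exact LipF.const (B := |(Pi.single i 1 : Fin 3 → ℝ) l|) fun _ => le_rfl
  · exact h k l

end Fields

end ESBGK

namespace ESBGK

/-! ### Lipschitz dependence of the anisotropic Gaussian -/

theorem exists_weight_mul_exp_le {p a : ℝ} (hp : 0 ≤ p) (ha : 0 < a) :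
    ∃ C, 0 ≤ C ∧ ∀ v : E3, (1 + ‖v‖) ^ p * Real.exp (-(a * ‖v‖ ^ 2)) ≤ C := by
  obtain ⟨C, hC1, hC⟩ := exists_rpow_mul_exp_le p hp
  have hs : 0 < √(6 * a) := Real.sqrt_pos.2 (by positivity)
  refine ⟨2 ^ p * (1 + (√(6 * a))⁻¹ ^ p * C), by positivity, fun v => ?_⟩
  have h1 := one_add_norm_rpow_le hp 0 v
  simp only [norm_zero, add_zero, Real.one_rpow, sub_zero] at h1
  have h2 := hC (√(6 * a) * ‖v‖) (by positivity)
  rw [Real.mul_rpow hs.le (norm_nonneg v), mul_pow, Real.sq_sqrt (by positivity)] at h2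
  have e : -(6 * a * ‖v‖ ^ 2) / 6 = -(a * ‖v‖ ^ 2) := by ring
  rw [e] at h2
  have hE := Real.exp_pos (-(a * ‖v‖ ^ 2))
  have hE1 : Real.exp (-(a * ‖v‖ ^ 2)) ≤ 1 := Real.exp_le_one_iff.2 (by
    have : 0 ≤ a * ‖v‖ ^ 2 := by positivity
    linarith)
  have e2 : (√(6 * a))⁻¹ ^ p * √(6 * a) ^ p = 1 := by
    rw [← Real.mul_rpow (by positivity) hs.le, inv_mul_cancel₀ hs.ne', Real.one_rpow]
  have h3 : ‖v‖ ^ p * Real.exp (-(a * ‖v‖ ^ 2)) ≤ (√(6 * a))⁻¹ ^ p * C := by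
    calc _ = (√(6 * a))⁻¹ ^ p * (√(6 * a) ^ p * ‖v‖ ^ p * Real.exp (-(a * ‖v‖ ^ 2))) := by
          linear_combination (-(‖v‖ ^ p * Real.exp (-(a * ‖v‖ ^ 2)))) * e2
      _ ≤ _ := by gcongr
  calc (1 + ‖v‖) ^ p * Real.exp (-(a * ‖v‖ ^ 2))
      ≤ 2 ^ p * (1 + ‖v‖ ^ p) * Real.exp (-(a * ‖v‖ ^ 2)) := by gcongr
    _ = 2 ^ p * (Real.exp (-(a * ‖v‖ ^ 2)) + ‖v‖ ^ p * Real.exp (-(a * ‖v‖ ^ 2))) := by ring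
    _ ≤ _ := by gcongr

theorem abs_exp_sub_exp_le {x y m : ℝ} (hx : x ≤ m) (hy : y ≤ m) :
    |Real.exp x - Real.exp y| ≤ Real.exp m * |x - y| := by
  wlog h : y ≤ x generalizing x y
  · rw [abs_sub_comm, abs_sub_comm x y]
    exact this hy hx (le_of_not_ge h)
  rw [abs_of_nonneg (sub_nonneg.2 (Real.exp_le_exp.2 h)), abs_of_nonneg (sub_nonneg.2 h)]
  have h1 := Real.add_one_le_exp (y - x)
  have h2 : Real.exp y = Real.exp x * Real.exp (y - x) := by rw [← Real.exp_add]; ring_nf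
  have h3 : Real.exp x - Real.exp y ≤ Real.exp x * (x - y) := by
    rw [h2]; nlinarith [Real.exp_pos x]
  exact h3.trans (mul_le_mul_of_nonneg_right (Real.exp_le_exp.2 hx) (sub_nonneg.2 h))

section Fields

variable {ι : Type*} {β N c ν : ℝ}

theorem lipF_quad (hβ : 5 < β) (hc : 0 < c) (hν1 : -(1 / 2 : ℝ) < ν) (hν2 : ν < 1) :
    LipF (Reg β N c) fun (v : E3) f =>
      ((1 + ‖v‖) ^ 2)⁻¹ * quad (tempTensor f ν)⁻¹ (v - bulk f) := by
  have hw : ∀ i, LipF (Reg β N c) fun (v : E3) f => (1 + ‖v‖)⁻¹ * (v - bulk f) i := fun i => by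
    have h1 : LipF (Reg β N c) fun (v : E3) (_ : E3 → ℝ) => (1 + ‖v‖)⁻¹ * v i :=
      LipF.const (B := 1) fun v => by
        rw [abs_mul, abs_of_pos (by positivity), inv_mul_le_one₀ (by positivity)]
        linarith [abs_coord_le v i]
    have h2 : LipF (Reg β N c) fun (v : E3) (_ : E3 → ℝ) => (1 + ‖v‖)⁻¹ :=
      LipF.const (B := 1) fun v => by
        rw [abs_of_pos (by positivity)]
        exact inv_le_one_of_one_le₀ (by linarith [norm_nonneg v])
    refine (h1.sub (h2.mul (lipF_bulk hβ hc i))).congr fun v f _ => ?_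
    rw [PiLp.sub_apply]; ring
  refine (LipF.sum fun i => LipF.sum fun j =>
    (lipF_inv_tempTensor hβ hc hν1 hν2 i j).mul ((hw i).mul (hw j))).congr fun v f _ => ?_
  rw [quad_eq_sum, Finset.mul_sum]
  refine Finset.sum_congr rfl fun i _ => ?_
  rw [Finset.mul_sum]
  refine Finset.sum_congr rfl fun j _ => ?_
  have : 1 + ‖v‖ ≠ 0 := by positivity
  field_simp

theorem lipF_amplitude (hβ : 5 < β) (hc : 0 < c) (hν1 : -(1 / 2 : ℝ) < ν) (hν2 : ν < 1) :
    LipF (Reg β N c) fun (_ : ι) f => dens f / √((2 * π) • tempTensor f ν).det := by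
  obtain ⟨δ, hδ, hd⟩ := exists_le_det (N := N) hβ hc hν1 hν2
  have h := fun i j => lipF_tempTensor (ι := ι) (β := β) (N := N) (c := c) (ν := ν) hβ hc i j
  have h1 := (LipF.det h).sqrt hδ fun _ f hf => hd f hf
  have h2 := h1.inv (Real.sqrt_pos.2 hδ) fun _ f hf => Real.sqrt_le_sqrt (hd f hf)
  refine (((lipF_dens hβ).mul h2).const_mul ((2 * π) ^ ((3 : ℝ) / 2))⁻¹).congr fun _ f _ => ?_
  rw [sqrt_det_two_pi_smul, div_eq_mul_inv, mul_inv]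
  ring

theorem exists_quad_lower (hβ : 5 < β) (hc : 0 < c) (hν1 : -(1 / 2 : ℝ) < ν) (hν2 : ν < 1) :
    ∃ a b, 0 < a ∧ ∀ f, Reg β N c f → ∀ v,
      a * ‖v‖ ^ 2 - b ≤ quad (tempTensor f ν)⁻¹ (v - bulk f) := by
  obtain ⟨T, hT, hTb, -⟩ := lipF_temp (ι := Unit) (β := β) (N := N) (c := c) hβ hc
  choose B hB hBb using fun i => lipF_bulk (ι := Unit) (β := β) (N := N) (c := c) hβ hc i
  set D := 3 * (T + 1) with hD
  have hD0 : 0 < D := by positivity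
  refine ⟨1 / (2 * D), (∑ i, B i ^ 2) / D, by positivity, fun f hf v => ?_⟩
  have hρ := hc.trans_le hf.le_dens
  have hk := hf.adm.kin hβ
  have h1 := quad_inv_ge (hk.posDef_tempTensor hρ hν1 hν2) hD0 (fun x => by
    refine (hk.quad_tempTensor_le hρ hν1 hν2 x).trans ?_
    have := (le_abs_self _).trans (hTb () f hf)
    have h0 : temp f ≤ T + 1 := by linarith
    rw [hD]; gcongr) (v - bulk f)
  refine le_trans ?_ h1
  have h2 : ‖bulk f‖ ^ 2 ≤ ∑ i, B i ^ 2 := by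
    rw [EuclideanSpace.norm_sq_eq]
    refine Finset.sum_le_sum fun i _ => ?_
    rw [Real.norm_eq_abs]
    have := (hBb i).1 () f hf
    gcongr
  have h3 : ‖v‖ ^ 2 ≤ 2 * ‖v - bulk f‖ ^ 2 + 2 * ‖bulk f‖ ^ 2 := by
    have := norm_add_le (v - bulk f) (bulk f)
    rw [sub_add_cancel] at this
    nlinarith [sq_nonneg (‖v - bulk f‖ - ‖bulk f‖), norm_nonneg v]
  have e : 1 / (2 * D) * ‖v‖ ^ 2 - (∑ i, B i ^ 2) / D
      = (‖v‖ ^ 2 / 2 - ∑ i, B i ^ 2) / D := by field_simp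
  rw [e]
  exact div_le_div_of_nonneg_right (by linarith) hD0.le

/-- Lipschitz bounds for the collision frequency and the anisotropic Gaussian. -/
theorem exists_lipschitz (hβ : 5 < β) (hc : 0 < c) (hν1 : -(1 / 2 : ℝ) < ν) (hν2 : ν < 1) (N : ℝ) :
    ∃ L, 0 ≤ L ∧ ∀ f g, Reg β N c f → Reg β N c g →
      |collFreq f ν - collFreq g ν| ≤ L * vdist f g ∧
      ∀ v, (1 + ‖v‖) ^ β * |aGauss f ν v - aGauss g ν v| ≤ L * vdist f g := by
  obtain ⟨LA, hLA, -, hA⟩ := lipF_collFreq (ι := Unit) (β := β) (N := N) (c := c) (ν := ν) hβ hc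
  obtain ⟨P, hP, hP1, hP2⟩ := lipF_amplitude (ι := Unit) (N := N) hβ hc hν1 hν2
  obtain ⟨Q, hQ, -, hQ2⟩ := lipF_quad (N := N) hβ hc hν1 hν2
  obtain ⟨a, b, ha, hab⟩ := exists_quad_lower (N := N) hβ hc hν1 hν2
  obtain ⟨E, hE, hEb⟩ := exists_weight_mul_exp_le (p := β + 2) (by linarith) (half_pos ha)
  refine ⟨LA + (P * (Real.exp (b / 2) * E) + P * (Real.exp (b / 2) * E * Q)), by positivity,
    fun f g hf hg => ?_⟩
  have hd := vdist_nonneg f g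
  have hL : 0 ≤ (P * (Real.exp (b / 2) * E) + P * (Real.exp (b / 2) * E * Q)) * vdist f g := by
    positivity
  refine ⟨(hA () f g hf hg).trans (by rw [add_mul]; linarith), fun v => ?_⟩
  have hw : 0 < 1 + ‖v‖ := by positivity
  set m := b / 2 - a / 2 * ‖v‖ ^ 2 with hm
  have hqf : -(1 / 2) * quad (tempTensor f ν)⁻¹ (v - bulk f) ≤ m := by
    have := hab f hf v; linarith
  have hqg : -(1 / 2) * quad (tempTensor g ν)⁻¹ (v - bulk g) ≤ m := by
    have := hab g hg v; linarith
  have hexp := abs_exp_sub_exp_le hqf hqg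
  have hq := hQ2 v f g hf hg
  rw [← mul_sub, abs_mul, abs_of_pos (by positivity), inv_mul_le_iff₀ (by positivity)] at hq
  have hexp2 : |Real.exp (-(1 / 2) * quad (tempTensor f ν)⁻¹ (v - bulk f))
      - Real.exp (-(1 / 2) * quad (tempTensor g ν)⁻¹ (v - bulk g))|
      ≤ Real.exp m * ((1 + ‖v‖) ^ 2 * (Q * vdist f g)) := by
    refine hexp.trans (mul_le_mul_of_nonneg_left ?_ (Real.exp_pos _).le)
    rw [← mul_sub, abs_mul]
    refine le_trans ?_ hq
    have : |(-(1 / 2) : ℝ)| = 1 / 2 := by norm_num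
    rw [this]
    have := abs_nonneg (quad (tempTensor f ν)⁻¹ (v - bulk f) - quad (tempTensor g ν)⁻¹ (v - bulk g))
    linarith
  have hW : (1 + ‖v‖) ^ β * (1 + ‖v‖) ^ 2 * Real.exp m ≤ Real.exp (b / 2) * E := by
    have := hEb v
    rw [Real.rpow_add hw, Real.rpow_two] at this
    rw [hm, sub_eq_add_neg, Real.exp_add]
    nlinarith [Real.exp_pos (b / 2)]
  have hW' : (1 + ‖v‖) ^ β * Real.exp m ≤ Real.exp (b / 2) * E := by
    refine le_trans ?_ hW
    have : (1 : ℝ) ≤ (1 + ‖v‖) ^ 2 := by nlinarith [norm_nonneg v]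
    have h0 : 0 ≤ (1 + ‖v‖) ^ β * Real.exp m := by positivity
    nlinarith
  rw [aGauss_eq_gauss, aGauss_eq_gauss, gauss, gauss]
  set pf := dens f / √((2 * π) • tempTensor f ν).det
  set pg := dens g / √((2 * π) • tempTensor g ν).det
  set xf := Real.exp (-(1 / 2) * quad (tempTensor f ν)⁻¹ (v - bulk f))
  set xg := Real.exp (-(1 / 2) * quad (tempTensor g ν)⁻¹ (v - bulk g))
  have hp : |pf - pg| ≤ P * vdist f g := hP2 () f g hf hg
  have hpg : |pg| ≤ P := hP1 () g hg
  have hxf : |xf| ≤ Real.exp m := by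
    rw [abs_of_pos (Real.exp_pos _)]; exact Real.exp_le_exp.2 hqf
  have e : pf * xf - pg * xg = (pf - pg) * xf + pg * (xf - xg) := by ring
  calc (1 + ‖v‖) ^ β * |pf * xf - pg * xg|
      ≤ (1 + ‖v‖) ^ β * (P * vdist f g * Real.exp m
          + P * (Real.exp m * ((1 + ‖v‖) ^ 2 * (Q * vdist f g)))) := by
        rw [e]
        refine mul_le_mul_of_nonneg_left ((abs_add_le _ _).trans ?_) (by positivity)
        rw [abs_mul, abs_mul]
        gcongr
    _ = P * vdist f g * ((1 + ‖v‖) ^ β * Real.exp m)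
        + P * (Q * vdist f g) * ((1 + ‖v‖) ^ β * (1 + ‖v‖) ^ 2 * Real.exp m) := by ring
    _ ≤ P * vdist f g * (Real.exp (b / 2) * E)
        + P * (Q * vdist f g) * (Real.exp (b / 2) * E) := by gcongr
    _ = (P * (Real.exp (b / 2) * E) + P * (Real.exp (b / 2) * E * Q)) * vdist f g := by ring
    _ ≤ _ := by rw [add_mul LA]; nlinarith

end Fields

end ESBGK

namespace ESBGK

/-! ### Behaviour near the global Maxwellian -/

theorem exists_adm_Mw {β : ℝ} (hβ : 0 ≤ β) : ∃ N, Adm β N Mw := by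
  obtain ⟨C, hC, h⟩ := exists_weight_mul_exp_le hβ (a := 1 / 2) (by norm_num)
  refine ⟨(2 * π) ^ (-(3 : ℝ) / 2) * C, continuous_Mw.measurable, fun v => (Mw_pos v).le,
    fun v => ?_⟩
  have e : -‖v‖ ^ 2 / 2 = -(1 / 2 * ‖v‖ ^ 2) := by ring
  rw [Mw, e, mul_left_comm]
  exact mul_le_mul_of_nonneg_left (h v) (by positivity)

theorem kin_Mw : Kin Mw := by
  obtain ⟨N, h⟩ := exists_adm_Mw (β := 6) (by norm_num)
  exact h.kin (by norm_num)

theorem dens_Mw : dens Mw = 1 := integral_Mw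

theorem bulk_Mw : bulk Mw = 0 := by
  ext i
  rw [kin_Mw.bulk_coord, integral_coord_mul_Mw]
  simp

theorem stress_Mw : stress Mw = 1 := by
  ext i j
  rw [kin_Mw.stress_apply (by rw [dens_Mw]; exact one_pos), dens_Mw, bulk_Mw,
    integral_coord_mul_coord_mul_Mw, Matrix.one_apply]
  simp

theorem temp_Mw : temp Mw = 1 := by
  rw [kin_Mw.temp_eq_trace, stress_Mw, trace_one]
  simp

theorem tempTensor_Mw (ν : ℝ) : tempTensor Mw ν = 1 := by
  rw [tempTensor, temp_Mw, stress_Mw, ← add_smul]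
  simp

theorem collFreq_Mw (ν : ℝ) : collFreq Mw ν = 1 / (1 - ν) := by
  rw [collFreq, dens_Mw, temp_Mw, one_mul]

theorem aGauss_Mw (ν : ℝ) : aGauss Mw ν = Mw := by
  ext v
  rw [aGauss_eq_gauss, gauss, tempTensor_Mw, bulk_Mw, dens_Mw, sqrt_det_two_pi_smul, Mw]
  have e : quad (1 : Matrix (Fin 3) (Fin 3) ℝ)⁻¹ (v - 0) = ‖v‖ ^ 2 := by
    rw [inv_one, sub_zero, EuclideanSpace.norm_sq_eq]
    simp [quad, dotProduct, sq]
  rw [e, det_one, Real.sqrt_one, mul_one, neg_div, Real.rpow_neg (by positivity), one_div]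
  congr 2
  ring

theorem norm_sq_eq_sum (v : E3) : ‖v‖ ^ 2 = ∑ i, v i * v i := by
  rw [EuclideanSpace.norm_sq_eq]
  exact Finset.sum_congr rfl fun i _ => by rw [Real.norm_eq_abs, sq_abs, sq]

theorem integral_norm_sq_mul_Mw : ∫ v : E3, ‖v‖ ^ 2 * Mw v = 3 := by
  have h := (kin_Mw.hasMoments (by rw [dens_Mw]; exact one_pos)).norm_sq_integral.2
  rw [h, dens_Mw, stress_Mw, bulk_Mw, trace_one]
  simp

theorem abs_integral_sub_le_vdist {β N N' : ℝ} (hβ : 5 < β) {f g : E3 → ℝ} (hf : Adm β N f)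
    (hg : Adm β N' g) : |dens f - dens g| ≤ vdist f g := by
  have hf' := hf.mono (le_max_left N N')
  have hg' := hg.mono (le_max_right N N')
  rw [dens, dens, ← integral_sub (hf.kin hβ).integrable (hg.kin hβ).integrable, ← Real.norm_eq_abs]
  refine norm_integral_le_of_norm_le (hf'.integrable_vdist hβ hg')
    (Filter.Eventually.of_forall fun v => ?_)
  rw [Real.norm_eq_abs]
  refine le_mul_of_one_le_left (abs_nonneg _) ?_
  nlinarith [norm_nonneg v]

/-- Near the Maxwellian the collision frequency and the anisotropic Gaussian are Lipschitz without
any lower bound on the density. -/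
theorem exists_lipschitz_Mw {β ν : ℝ} (hβ : 5 < β) (hν1 : -(1 / 2 : ℝ) < ν) (hν2 : ν < 1)
    (N : ℝ) : ∃ L, 0 ≤ L ∧ ∀ g, Adm β N g → 0 < dens g →
      |collFreq g ν - 1 / (1 - ν)| ≤ L * vdist g Mw ∧
      ∀ v, (1 + ‖v‖) ^ β * |aGauss g ν v - Mw v| ≤ L * vdist g Mw := by
  obtain ⟨N₀, hM⟩ := exists_adm_Mw (β := β) (by linarith)
  set N₁ := max N N₀
  obtain ⟨L, hL, hLip⟩ := exists_lipschitz (c := 1 / 2) hβ (by norm_num) hν1 hν2 N₁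
  obtain ⟨C, hC, hCb⟩ := Adm.exists_bounds hβ hν1 hν2
  have hM1 := hM.mono (le_max_right N N₀)
  have hN1 := hM1.N_nonneg
  have hMr : Reg β N₁ (1 / 2) Mw := ⟨hM1, by rw [dens_Mw]; norm_num⟩
  have hdM : 0 < dens Mw := by rw [dens_Mw]; exact one_pos
  refine ⟨L + 2 * (C * N₁), by positivity, fun g hg hρ => ?_⟩
  have hg1 := hg.mono (le_max_left N N₀)
  have hd := vdist_nonneg g Mw
  have hd1 := abs_integral_sub_le_vdist hβ hg hM
  rw [dens_Mw] at hd1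
  rcases le_or_gt (1 / 2) (dens g) with h | h
  · have := hLip g Mw ⟨hg1, h⟩ hMr
    rw [collFreq_Mw, aGauss_Mw] at this
    have h0 : 0 ≤ 2 * (C * N₁) * vdist g Mw := by positivity
    exact ⟨this.1.trans (by linarith), fun v => (this.2 v).trans (by linarith)⟩
  · have hd2 : 1 / 2 ≤ vdist g Mw := by
      have := neg_abs_le (dens g - 1)
      linarith
    have hb1 := hCb hg1 hρ
    have hb2 := hCb hM1 hdM
    rw [collFreq_Mw, aGauss_Mw] at hb2
    have hν : 0 < 1 - ν := by linarith
    have h0 : 0 ≤ L * vdist g Mw := by positivity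
    have h1 : C * N₁ ≤ 2 * (C * N₁) * vdist g Mw := by
      have : 0 ≤ C * N₁ := by positivity
      nlinarith
    constructor
    · have hA : 0 ≤ collFreq g ν :=
        div_nonneg (mul_nonneg hρ.le ((hg.kin hβ).temp_pos hρ).le) hν.le
      have hB : 0 ≤ 1 / (1 - ν) := by positivity
      have : |collFreq g ν - 1 / (1 - ν)| ≤ C * N₁ := by
        rw [abs_le]; constructor <;> linarith [hb1.1, hb2.1]
      linarith
    · intro v
      have hA := ((hg.kin hβ).aGauss_pos hρ hν1 hν2 v).le
      have hB := (Mw_pos v).le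
      have hw : 0 ≤ (1 + ‖v‖) ^ β := by positivity
      have : (1 + ‖v‖) ^ β * |aGauss g ν v - Mw v| ≤ C * N₁ := by
        rw [← abs_of_nonneg hw, ← abs_mul, mul_sub, abs_le]
        constructor <;>
          linarith [hb1.2 v, hb2.2 v, mul_nonneg hw hA, mul_nonneg hw hB]
      linarith

/-- The weighted distance to the Maxwellian is controlled by the relative entropy. -/
theorem exists_vdist_le_hent {β κ : ℝ} (hβ : 6 < β) (N : ℝ) (hκ : 0 < κ) :
    ∃ C, 0 ≤ C ∧ ∀ g, Adm β N g → ENNReal.ofReal (vdist g Mw)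
      ≤ ENNReal.ofReal κ + ENNReal.ofReal C * ∫⁻ v, ENNReal.ofReal (hent (Mw v) (g v)) := by
  obtain ⟨N₀, hM⟩ := exists_adm_Mw (β := β) (by linarith)
  set N₁ := max N N₀
  have hM1 := hM.mono (le_max_right N N₀)
  have hN1 := hM1.N_nonneg
  set J := ∫ v : E3, (1 + ‖v‖) ^ (-(β - 3))
  have hJ : 0 ≤ J := integral_nonneg fun v => by positivity
  set Q := 1 + 2 * N₁ * J * 2 / κ with hQ
  have hQ1 : 1 ≤ Q := by
    have : 0 ≤ 2 * N₁ * J * 2 / κ := by positivity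
    linarith
  have hQ0 : 0 < Q := by linarith
  set η := min 1 (κ / (2 * Q ^ 2)) with hη
  have hη0 : 0 < η := by positivity
  refine ⟨Q ^ 2 * η⁻¹, by positivity, fun g hg => ?_⟩
  have hg1 := hg.mono (le_max_left N N₀)
  have hpt : ∀ v : E3, (1 + ‖v‖) ^ 2 * |g v - Mw v| ≤ (Q ^ 2 * η * Mw v
      + 2 * N₁ / Q * (1 + ‖v‖) ^ (-(β - 3))) + Q ^ 2 * η⁻¹ * hent (Mw v) (g v) := fun v => by
    have hw : 0 < 1 + ‖v‖ := by positivity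
    have hh := hent_nonneg (Mw_pos v) (hg.nonneg v)
    have hMv := (Mw_pos v).le
    rcases le_total (1 + ‖v‖) Q with h | h
    · have h1 := abs_sub_le_hent (Mw_pos v) (hg.nonneg v) hη0 (min_le_left _ _)
      have h2 : (1 + ‖v‖) ^ 2 * |g v - Mw v| ≤ Q ^ 2 * (η * Mw v + η⁻¹ * hent (Mw v) (g v)) := by
        gcongr
      have h3 : 0 ≤ 2 * N₁ / Q * (1 + ‖v‖) ^ (-(β - 3)) := by positivity
      linarith
    · have h1 : (1 + ‖v‖) ^ 2 * |g v - Mw v| ≤ 2 * N₁ * (1 + ‖v‖) ^ (-(β - 2)) := by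
        have a1 := hg1.weight_sq_mul_le v
        have a2 := hM1.weight_sq_mul_le v
        have a3 : |g v - Mw v| ≤ g v + Mw v := by
          rw [abs_le]; constructor <;> linarith [hg.nonneg v]
        calc (1 + ‖v‖) ^ 2 * |g v - Mw v| ≤ (1 + ‖v‖) ^ 2 * (g v + Mw v) := by gcongr
          _ ≤ _ := by rw [mul_add]; linarith
      have h2 : (1 + ‖v‖) ^ (-(β - 2)) ≤ Q⁻¹ * (1 + ‖v‖) ^ (-(β - 3)) := by
        rw [show -(β - 2) = -1 + -(β - 3) by ring, Real.rpow_add hw, Real.rpow_neg_one]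
        gcongr
      have h3 : 0 ≤ Q ^ 2 * η * Mw v + Q ^ 2 * η⁻¹ * hent (Mw v) (g v) := by positivity
      have h4 : 2 * N₁ * (1 + ‖v‖) ^ (-(β - 2)) ≤ 2 * N₁ * (Q⁻¹ * (1 + ‖v‖) ^ (-(β - 3))) := by
        gcongr
      have e : 2 * N₁ * (Q⁻¹ * (1 + ‖v‖) ^ (-(β - 3)))
        = 2 * N₁ / Q * (1 + ‖v‖) ^ (-(β - 3)) := by ring
      linarith
  have i1 : Integrable fun v : E3 => Q ^ 2 * η * Mw v
      + 2 * N₁ / Q * (1 + ‖v‖) ^ (-(β - 3)) :=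
    (integrable_Mw.const_mul _).add ((integrable_weight (by linarith)).const_mul _)
  have hval : ∫ v : E3, (Q ^ 2 * η * Mw v + 2 * N₁ / Q * (1 + ‖v‖) ^ (-(β - 3))) ≤ κ := by
    rw [integral_add (integrable_Mw.const_mul _)
      ((integrable_weight (by linarith)).const_mul _), integral_const_mul, integral_const_mul,
      integral_Mw, mul_one]
    have a1 : Q ^ 2 * η ≤ κ / 2 := by
      have := mul_le_mul_of_nonneg_left (min_le_right 1 (κ / (2 * Q ^ 2))) (sq_nonneg Q)
      refine this.trans_eq ?_
      field_simp
    have a2 : 2 * N₁ / Q * J ≤ κ / 2 := by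
      rw [div_mul_eq_mul_div, div_le_iff₀ hQ0, hQ]
      have : κ / 2 * (1 + 2 * N₁ * J * 2 / κ) = κ / 2 + 2 * N₁ * J := by field_simp
      linarith
    exact (add_le_add a1 a2).trans_eq (by ring)
  rw [vdist, ofReal_integral_eq_lintegral_ofReal (hg1.integrable_vdist (by linarith) hM1)
    (Filter.Eventually.of_forall fun v => by positivity)]
  calc _ ≤ ∫⁻ v : E3, (ENNReal.ofReal (Q ^ 2 * η * Mw v + 2 * N₁ / Q * (1 + ‖v‖) ^ (-(β - 3)))
        + ENNReal.ofReal (Q ^ 2 * η⁻¹) * ENNReal.ofReal (hent (Mw v) (g v))) := by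
        refine lintegral_mono fun v => (ENNReal.ofReal_le_ofReal (hpt v)).trans ?_
        refine ENNReal.ofReal_add_le.trans ?_
        rw [← ENNReal.ofReal_mul (by positivity)]
    _ = ENNReal.ofReal (∫ v : E3, (Q ^ 2 * η * Mw v + 2 * N₁ / Q * (1 + ‖v‖) ^ (-(β - 3))))
        + ENNReal.ofReal (Q ^ 2 * η⁻¹) * ∫⁻ v, ENNReal.ofReal (hent (Mw v) (g v)) := by
        rw [lintegral_add_left', lintegral_const_mul' _ _ ENNReal.ofReal_ne_top,
          ofReal_integral_eq_lintegral_ofReal i1 (Filter.Eventually.of_forall fun v => by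
            have := (Mw_pos v).le
            positivity)]
        exact i1.aestronglyMeasurable.aemeasurable.ennreal_ofReal
    _ ≤ _ := by gcongr

theorem abs_integral_le_momentGap (f : E3 → ℝ) :
    |∫ v, (f v - Mw v)| ≤ momentGap f ∧ (∀ i, |∫ v, v i * (f v - Mw v)| ≤ momentGap f) ∧
      |∫ v, ‖v‖ ^ 2 * (f v - Mw v)| ≤ momentGap f := by
  refine ⟨?_, fun i => ?_, ?_⟩ <;> unfold momentGap
  · exact (le_max_left _ _).trans ((le_max_left _ _).trans (le_max_left _ _))
  · refine le_trans ?_ ((le_max_right _ _).trans ((le_max_left _ _).trans (le_max_left _ _)))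
    exact le_ciSup (f := fun i : Fin 3 => |∫ v, v i * (f v - Mw v)|)
      (Set.finite_range _).bddAbove i
  · exact (le_max_right _ _).trans (le_max_left _ _)

theorem momentGap_nonneg (f : E3 → ℝ) : 0 ≤ momentGap f :=
  (abs_nonneg _).trans (abs_integral_le_momentGap f).1

/-- If the moments are close to those of the Maxwellian, the anisotropic Gaussian satisfies a
bound that does not depend on the distribution. -/
theorem exists_aGauss_le_of_moments {β ν : ℝ} (hβ : 5 < β) (hν1 : -(1 / 2 : ℝ) < ν) (hν2 : ν < 1) :
    ∃ C, 0 ≤ C ∧ ∀ g, Kin g → |∫ v, (g v - Mw v)| ≤ 1 / 8 →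
      (∀ i, |∫ v, v i * (g v - Mw v)| ≤ 1 / 8) → |∫ v, ‖v‖ ^ 2 * (g v - Mw v)| ≤ 1 / 8 →
      0 < dens g ∧ ∀ v, (1 + ‖v‖) ^ β * aGauss g ν v ≤ C := by
  obtain ⟨C, hC, h⟩ := exists_weight_mul_aGauss_le hβ hν1 hν2
  refine ⟨C * (9 * 2 ^ β), by positivity, fun g hg h0 h1 h2 => ?_⟩
  rw [integral_sub hg.integrable integrable_Mw, integral_Mw, abs_le] at h0
  have hd : ∫ v, g v = dens g := rfl
  rw [hd] at h0
  have hρ : 0 < dens g := by linarith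
  have hu : ∀ i, |bulk g i| ≤ 1 / 7 := fun i => by
    have := h1 i
    simp only [mul_sub] at this
    rw [integral_sub (hg.integrable_coord i) (integrable_coord_mul_Mw i), integral_coord_mul_Mw,
      sub_zero, hg.dens_mul_bulk hρ, abs_mul, abs_of_pos hρ] at this
    nlinarith [abs_nonneg (bulk g i)]
  simp only [mul_sub] at h2
  rw [integral_sub hg.integrable_norm_sq kin_Mw.integrable_norm_sq, integral_norm_sq_mul_Mw,
    abs_le] at h2
  have hU : ‖bulk g‖ ^ 2 ≤ 3 / 49 := by
    rw [norm_sq_eq_sum, Fin.sum_univ_three]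
    have h3 : ∀ i, bulk g i * bulk g i ≤ 1 / 49 := fun i => by
      have := abs_le.1 (hu i)
      nlinarith
    linarith [h3 0, h3 1, h3 2]
  have hT := hg.temp_eq hρ
  have hT1 : 1 / 4 ≤ temp g := by nlinarith [sq_nonneg ‖bulk g‖]
  have hT2 : temp g ≤ 4 := by nlinarith [sq_nonneg ‖bulk g‖]
  have hσ1 : 1 / 2 ≤ √(temp g) := Real.le_sqrt_of_sq_le (by linarith)
  have hσ2 : √(temp g) ≤ 2 := Real.sqrt_le_iff.2 ⟨by norm_num, by linarith⟩
  have hU1 : 1 + ‖bulk g‖ ≤ 2 := by nlinarith [norm_nonneg (bulk g)]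
  refine ⟨hρ, h hg hρ ?_ ?_⟩
  · have a1 : (1 + ‖bulk g‖) ^ β ≤ 2 ^ β := Real.rpow_le_rpow (by positivity) hU1 (by linarith)
    have a2 : dens g / √(temp g) ^ 3 ≤ 9 := by
      have : (1 / 2 : ℝ) ^ 3 ≤ √(temp g) ^ 3 := by gcongr
      rw [div_le_iff₀ (by positivity)]
      linarith
    gcongr
  · have a1 : √(temp g) ^ (β - 3) ≤ 2 ^ β := by
      calc √(temp g) ^ (β - 3) ≤ 2 ^ (β - 3) :=
            Real.rpow_le_rpow (by positivity) hσ2 (by linarith)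
        _ ≤ 2 ^ β := Real.rpow_le_rpow_of_exponent_le (by norm_num) (by linarith)
    have a2 : dens g ≤ 9 := by linarith
    gcongr

end ESBGK

namespace ESBGK

/-! ### The Duhamel map with truncated collision frequency -/

/-- The collision frequency, truncated at height `K`, along the characteristic `τ ↦ y + τ v`. -/
noncomputable def freqOn (ν K : ℝ) (F : ℝ → E3 → E3 → ℝ) (y v : E3) (τ : ℝ) : ℝ :=
  max 0 (min (collFreq (F τ (y + τ • v)) ν) K)

/-- The anisotropic Gaussian along the characteristic `τ ↦ y + τ v`. -/
noncomputable def gainOn (ν : ℝ) (F : ℝ → E3 → E3 → ℝ) (y v : E3) (τ : ℝ) : ℝ :=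
  aGauss (F τ (y + τ • v)) ν v

/-- The Duhamel map whose fixed points are the truncated mild solutions. -/
noncomputable def mildStep (ν K : ℝ) (F₀ : E3 → E3 → ℝ) (F : ℝ → E3 → E3 → ℝ) (t : ℝ) (x v : E3) :
    ℝ :=
  duh (freqOn ν K F (x - t • v) v) (gainOn ν F (x - t • v) v) 0 (F₀ (x - t • v) v) t

/-- Joint measurability in time, position and velocity. -/
def JMeas (F : ℝ → E3 → E3 → ℝ) : Prop := Measurable fun z : ℝ × E3 × E3 => F z.1 z.2.1 z.2.2

variable {ν K : ℝ} {F : ℝ → E3 → E3 → ℝ} {F₀ : E3 → E3 → ℝ}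

theorem JMeas.uncurry (h : JMeas F) :
    Measurable (Function.uncurry fun z : ℝ × E3 => F z.1 z.2) :=
  h.comp (f := fun p : (ℝ × E3) × E3 => (p.1.1, p.1.2, p.2)) (by fun_prop)

theorem JMeas.collFreq (h : JMeas F) (ν : ℝ) :
    Measurable fun z : ℝ × E3 => collFreq (F z.1 z.2) ν :=
  measurable_collFreq h.uncurry ν

theorem JMeas.aGauss (h : JMeas F) (ν : ℝ) :
    Measurable fun p : (ℝ × E3) × E3 => aGauss (F p.1.1 p.1.2) ν p.2 :=
  measurable_aGauss h.uncurry ν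

theorem JMeas.freqOn (h : JMeas F) (ν K : ℝ) :
    Measurable fun p : (E3 × E3) × ℝ => freqOn ν K F p.1.1 p.1.2 p.2 :=
  measurable_const.max (((h.collFreq ν).comp
    (f := fun p : (E3 × E3) × ℝ => (p.2, p.1.1 + p.2 • p.1.2)) (by fun_prop)).min measurable_const)

theorem JMeas.gainOn (h : JMeas F) (ν : ℝ) :
    Measurable fun p : (E3 × E3) × ℝ => gainOn ν F p.1.1 p.1.2 p.2 :=
  (h.aGauss ν).comp
    (f := fun p : (E3 × E3) × ℝ => ((p.2, p.1.1 + p.2 • p.1.2), p.1.2)) (by fun_prop)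

theorem JMeas.measurable_gainOn (h : JMeas F) (ν : ℝ) (y v : E3) : Measurable (ESBGK.gainOn ν F y v) :=
  (h.gainOn ν).comp (f := fun τ : ℝ => ((y, v), τ)) (by fun_prop)

theorem JMeas.freq (h : JMeas F) (ν : ℝ) (hK : 0 ≤ K) (y v : E3) :
    Freq K (ESBGK.freqOn ν K F y v) where
  meas := (h.freqOn ν K).comp (f := fun τ : ℝ => ((y, v), τ)) (by fun_prop)
  nonneg τ := le_max_left _ _
  le τ := max_le hK (min_le_right _ _)

theorem JMeas.slice (h : JMeas F) (t : ℝ) : Measurable fun p : E3 × E3 => F t p.1 p.2 :=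
  h.comp (f := fun p : E3 × E3 => (t, p)) (by fun_prop)

theorem JMeas.along (h : JMeas F) :
    Measurable fun p : (E3 × E3) × ℝ => F p.2 (p.1.1 + p.2 • p.1.2) p.1.2 :=
  h.comp (f := fun p : (E3 × E3) × ℝ => (p.2, p.1.1 + p.2 • p.1.2, p.1.2)) (by fun_prop)

theorem JMeas.mildStep (h : JMeas F) (h₀ : Measurable fun p : E3 × E3 => F₀ p.1 p.2) (ν K : ℝ) :
    JMeas (mildStep ν K F₀ F) := by
  have hy : Measurable fun z : ℝ × E3 × E3 => (z.2.1 - z.1 • z.2.2, z.2.2) := by fun_prop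
  have ha : Measurable (Function.uncurry fun (z : (ℝ × E3 × E3) × ℝ) (τ : ℝ) =>
      ESBGK.freqOn ν K F (z.1.2.1 - z.1.1 • z.1.2.2) z.1.2.2 τ) :=
    (h.freqOn ν K).comp (f := fun p : ((ℝ × E3 × E3) × ℝ) × ℝ =>
      ((p.1.1.2.1 - p.1.1.1 • p.1.1.2.2, p.1.1.2.2), p.2)) (by fun_prop)
  have hE : Measurable fun z : (ℝ × E3 × E3) × ℝ =>
      expI (ESBGK.freqOn ν K F (z.1.2.1 - z.1.1 • z.1.2.2) z.1.2.2) z.2 z.1.1 :=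
    (measurable_setIntegral_Ioc ha measurable_snd (measurable_fst.comp measurable_fst)).neg.exp
  have ha' : Measurable fun z : (ℝ × E3 × E3) × ℝ =>
      ESBGK.freqOn ν K F (z.1.2.1 - z.1.1 • z.1.2.2) z.1.2.2 z.2 :=
    (h.freqOn ν K).comp (f := fun p : (ℝ × E3 × E3) × ℝ =>
      ((p.1.2.1 - p.1.1 • p.1.2.2, p.1.2.2), p.2)) (by fun_prop)
  have hm' : Measurable fun z : (ℝ × E3 × E3) × ℝ =>
      ESBGK.gainOn ν F (z.1.2.1 - z.1.1 • z.1.2.2) z.1.2.2 z.2 :=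
    (h.gainOn ν).comp (f := fun p : (ℝ × E3 × E3) × ℝ =>
      ((p.1.2.1 - p.1.1 • p.1.2.2, p.1.2.2), p.2)) (by fun_prop)
  have h1 : Measurable fun z : ℝ × E3 × E3 => F₀ (z.2.1 - z.1 • z.2.2) z.2.2 := h₀.comp hy
  have h2 : Measurable fun z : ℝ × E3 × E3 =>
      expI (ESBGK.freqOn ν K F (z.2.1 - z.1 • z.2.2) z.2.2) 0 z.1 :=
    hE.comp (f := fun z : ℝ × E3 × E3 => (z, (0 : ℝ))) (by fun_prop)
  have h3 := measurable_setIntegral_Ioc (Z := ℝ × E3 × E3) (s := fun _ => 0) (t := fun z => z.1)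
    (f := fun z s => expI (ESBGK.freqOn ν K F (z.2.1 - z.1 • z.2.2) z.2.2) s z.1 *
      ESBGK.freqOn ν K F (z.2.1 - z.1 • z.2.2) z.2.2 s *
      ESBGK.gainOn ν F (z.2.1 - z.1 • z.2.2) z.2.2 s)
    ((hE.mul ha').mul hm') measurable_const measurable_fst
  exact (h1.mul h2).add h3

/-- Nonnegative initial data bounded by `M (1 + |v|)^{-β}` whose free transport has density bounded
below by `c`. -/
structure Data (β M c : ℝ) (F₀ : E3 → E3 → ℝ) : Prop where
  meas : Measurable fun p : E3 × E3 => F₀ p.1 p.2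
  nonneg : ∀ x v, 0 ≤ F₀ x v
  le : ∀ x v, (1 + ‖v‖) ^ β * F₀ x v ≤ M
  le_dens : ∀ t : ℝ, 0 ≤ t → ∀ x, c ≤ ∫ v, F₀ (x - t • v) v

/-- Jointly measurable functions lying between a damped free transport and an exponentially growing
bound. -/
structure Traj (β M C K : ℝ) (F₀ : E3 → E3 → ℝ) (F : ℝ → E3 → E3 → ℝ) : Prop where
  meas : JMeas F
  lower : ∀ t, 0 ≤ t → ∀ x v, F₀ (x - t • v) v * Real.exp (-(K * t)) ≤ F t x v
  upper : ∀ t, 0 ≤ t → ∀ x v, (1 + ‖v‖) ^ β * F t x v ≤ M * Real.exp (C * t)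

variable {β M C c : ℝ}

theorem Data.M_nonneg (h : Data β M c F₀) : 0 ≤ M :=
  (mul_nonneg (by positivity) (h.nonneg 0 0)).trans (h.le 0 0)

theorem Data.M_pos (h : Data β M c F₀) (hc : 0 < c) : 0 < M := by
  refine h.M_nonneg.lt_of_ne fun h0 => ?_
  have h1 : ∀ x v, F₀ x v = 0 := fun x v => by
    have := h.le x v
    have hw : 0 < (1 + ‖v‖) ^ β := by positivity
    have h2 := h.nonneg x v
    rw [← h0] at this
    nlinarith
  have := h.le_dens 0 le_rfl 0
  simp only [h1, integral_zero] at this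
  linarith

theorem Data.adm_transport (h : Data β M c F₀) (t : ℝ) (x : E3) :
    Adm β M fun v => F₀ (x - t • v) v where
  meas := h.meas.comp (f := fun v : E3 => (x - t • v, v)) (by fun_prop)
  nonneg v := h.nonneg _ v
  le v := h.le _ v

theorem Data.traj_transport (h : Data β M c F₀) (hC : 0 ≤ C) (hK : 0 ≤ K) :
    Traj β M C K F₀ fun t x v => F₀ (x - t • v) v where
  meas := h.meas.comp (f := fun z : ℝ × E3 × E3 => (z.2.1 - z.1 • z.2.2, z.2.2)) (by fun_prop)
  lower t ht x v := by
    have : Real.exp (-(K * t)) ≤ 1 := Real.exp_le_one_iff.2 (by nlinarith)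
    nlinarith [h.nonneg (x - t • v) v]
  upper t ht x v := by
    have : 1 ≤ Real.exp (C * t) := Real.one_le_exp (by positivity)
    nlinarith [h.le (x - t • v) v, h.M_nonneg]

theorem Traj.adm (hF : Traj β M C K F₀ F) (h : Data β M c F₀) {t : ℝ} (ht : 0 ≤ t) (x : E3) :
    Adm β (M * Real.exp (C * t)) (F t x) where
  meas := hF.meas.comp (f := fun v : E3 => (t, x, v)) (by fun_prop)
  nonneg v := (mul_nonneg (h.nonneg _ _) (Real.exp_pos _).le).trans (hF.lower t ht x v)
  le v := hF.upper t ht x v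

theorem Traj.le_dens (hF : Traj β M C K F₀ F) (h : Data β M c F₀) (hβ : 5 < β) {t : ℝ}
    (ht : 0 ≤ t) (x : E3) : c * Real.exp (-(K * t)) ≤ dens (F t x) := by
  have h1 := ((h.adm_transport t x).kin hβ).integrable
  have h2 := ((hF.adm h ht x).kin hβ).integrable
  calc c * Real.exp (-(K * t))
      ≤ (∫ v, F₀ (x - t • v) v) * Real.exp (-(K * t)) := by
        gcongr
        exact h.le_dens t ht x
    _ = ∫ v, F₀ (x - t • v) v * Real.exp (-(K * t)) := (integral_mul_const _ _).symm
    _ ≤ dens (F t x) := integral_mono (h1.mul_const _) h2 fun v => hF.lower t ht x v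

theorem Traj.dens_pos (hF : Traj β M C K F₀ F) (h : Data β M c F₀) (hβ : 5 < β) (hc : 0 < c)
    {t : ℝ} (ht : 0 ≤ t) (x : E3) : 0 < dens (F t x) :=
  (mul_pos hc (Real.exp_pos _)).trans_le (hF.le_dens h hβ ht x)

theorem Traj.reg (hF : Traj β M C K F₀ F) (h : Data β M c F₀) (hβ : 5 < β) (hC : 0 ≤ C)
    (hK : 0 ≤ K) (hc : 0 < c) {t T : ℝ} (ht : 0 ≤ t) (htT : t ≤ T) (x : E3) :
    Reg β (M * Real.exp (C * T)) (c * Real.exp (-(K * T))) (F t x) where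
  adm := (hF.adm h ht x).mono (by have := h.M_nonneg; gcongr)
  le_dens := le_trans (by gcongr) (hF.le_dens h hβ ht x)

/-- The gain bound constant: `C` works as in `Adm.exists_bounds`. -/
def GainBound (β ν C : ℝ) : Prop := ∀ {g : E3 → ℝ} {N : ℝ}, Adm β N g → 0 < dens g →
  collFreq g ν ≤ C * N ∧ ∀ v, (1 + ‖v‖) ^ β * aGauss g ν v ≤ C * N

theorem Traj.mildStep {G : ℝ} (hG : GainBound β ν G) (hF : Traj β M (K * G) K F₀ F)
    (h : Data β M c F₀) (hβ : 5 < β) (hν1 : -(1 / 2 : ℝ) < ν) (hν2 : ν < 1) (hK : 0 ≤ K)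
    (hG0 : 0 ≤ G) (hc : 0 < c) :
    Traj β M (K * G) K F₀ (mildStep ν K F₀ F) := by
  have hM := h.M_nonneg
  have hpos : ∀ y v : E3, ∀ τ, 0 ≤ τ → 0 ≤ gainOn ν F y v τ := fun y v τ hτ =>
    (((hF.adm h hτ _).kin hβ).aGauss_pos (hF.dens_pos h hβ hc hτ _) hν1 hν2 v).le
  have hle : ∀ y v : E3, ∀ τ, 0 ≤ τ →
      (1 + ‖v‖) ^ β * gainOn ν F y v τ ≤ G * (M * Real.exp (K * G * τ)) := fun y v τ hτ =>
    (hG (hF.adm h hτ _) (hF.dens_pos h hβ hc hτ _)).2 v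
  refine ⟨hF.meas.mildStep h.meas ν K, fun t ht x v => ?_, fun t ht x v => ?_⟩
  · have := le_duh (m := gainOn ν F (x - t • v) v) (hF.meas.freq ν hK (x - t • v) v)
      (h.nonneg (x - t • v) v) (fun τ hτ => hpos _ _ τ hτ.1.le) ht
    rwa [sub_zero] at this
  · have hw : 0 < (1 + ‖v‖) ^ β := by positivity
    set y := x - t • v
    have hm := hF.meas.measurable_gainOn ν y v
    have hB : ∀ τ ∈ Set.Ioc 0 t, |gainOn ν F y v τ| ≤
        ((1 + ‖v‖) ^ β)⁻¹ * (G * (M * Real.exp (K * G * t))) := fun τ hτ => by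
      rw [abs_of_nonneg (hpos y v τ hτ.1.le), inv_mul_eq_div, le_div_iff₀ hw, mul_comm]
      refine (hle y v τ hτ.1.le).trans ?_
      have := hτ.2
      gcongr
    have h1 := duh_le_add (hF.meas.freq ν hK y v) hm hB (h.nonneg y v)
      fun τ hτ => hpos _ _ τ hτ.1.le
    have hd : ∀ τ ∈ Set.uIcc 0 t, HasDerivAt (fun τ => M * Real.exp (K * G * τ))
        (K * (G * (M * Real.exp (K * G * τ)))) τ := fun τ _ => by
      have := (((hasDerivAt_id' τ).const_mul (K * G)).exp).const_mul M
      exact this.congr_deriv (by ring)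
    have h2 : ∫ s in Set.Ioc 0 t, K * (G * (M * Real.exp (K * G * s)))
        = M * Real.exp (K * G * t) - M := by
      rw [← intervalIntegral.integral_of_le ht, intervalIntegral.integral_eq_sub_of_hasDerivAt hd
        (Continuous.intervalIntegrable (by fun_prop) _ _)]
      simp
    have h3 : (1 + ‖v‖) ^ β * ∫ s in Set.Ioc 0 t, K * gainOn ν F y v s
        ≤ ∫ s in Set.Ioc 0 t, K * (G * (M * Real.exp (K * G * s))) := by
      rw [← integral_const_mul]
      refine setIntegral_mono_on ?_ ?_ measurableSet_Ioc fun s hs => ?_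
      · exact ((integrableOn_Ioc_of_bdd hm hB).const_mul K).const_mul _
      · exact Continuous.integrableOn_Ioc (by fun_prop)
      · have := hle y v s hs.1.le
        nlinarith
    calc (1 + ‖v‖) ^ β * ESBGK.mildStep ν K F₀ F t x v
        ≤ (1 + ‖v‖) ^ β * (F₀ y v + ∫ s in Set.Ioc 0 t, K * gainOn ν F y v s) := by
          gcongr; exact h1
      _ ≤ M * Real.exp (K * G * t) := by
          have := h.le y v
          rw [mul_add]; linarith

end ESBGK

namespace ESBGK

/-! ### Contraction estimates and the fixed point -/

variable {ν K β N c : ℝ}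

theorem abs_truncate_sub_le (a b K : ℝ) : |max 0 (min a K) - max 0 (min b K)| ≤ |a - b| := by
  have h1 := abs_max_sub_max_le_abs (min a K) (min b K) 0
  have h2 := abs_min_sub_min_le_max a K b K
  rw [max_comm 0, max_comm 0]
  refine h1.trans (h2.trans ?_)
  simp

theorem vdist_le {f g : E3 → ℝ} {X : ℝ} (hβ : 5 < β)
    (h : ∀ v, (1 + ‖v‖) ^ β * |f v - g v| ≤ X) : vdist f g ≤ wInt β * X := by
  have hi : Integrable fun v : E3 => (1 + ‖v‖) ^ (-(β - 2)) * X :=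
    (integrable_weight (by linarith)).mul_const X
  have hpt : ∀ v, (1 + ‖v‖) ^ 2 * |f v - g v| ≤ (1 + ‖v‖) ^ (-(β - 2)) * X := fun v => by
    have hw : 0 < 1 + ‖v‖ := by positivity
    have : (1 + ‖v‖) ^ 2 = (1 + ‖v‖) ^ (-(β - 2)) * (1 + ‖v‖) ^ β := by
      rw [← Real.rpow_add hw, ← Real.rpow_natCast]
      congr 1; push_cast; ring
    rw [this, mul_assoc]
    exact mul_le_mul_of_nonneg_left (h v) (by positivity)
  calc vdist f g ≤ ∫ v : E3, (1 + ‖v‖) ^ (-(β - 2)) * X :=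
        integral_mono_of_nonneg (.of_forall fun v => by positivity) hi (.of_forall hpt)
    _ = wInt β * X := integral_mul_const _ _

theorem integral_pow_div_factorial (c : ℝ) (n : ℕ) {t : ℝ} (ht : 0 ≤ t) :
    ∫ s in Set.Ioc 0 t, c * (s ^ n / n.factorial) = c * (t ^ (n + 1) / (n + 1).factorial) := by
  rw [← intervalIntegral.integral_of_le ht, intervalIntegral.integral_const_mul,
    intervalIntegral.integral_div, integral_pow, Nat.factorial_succ]
  push_cast
  have h : (n.factorial : ℝ) ≠ 0 := by positivity
  have h2 : (n + 1 : ℝ) ≠ 0 := by positivity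
  field_simp
  simp

/-- The Duhamel map is contractive in the Picard sense on distributions with density bounded
below. -/
theorem exists_mildStep_sub_le (hβ : 5 < β) (hc : 0 < c) (hν1 : -(1 / 2 : ℝ) < ν) (hν2 : ν < 1)
    (hN : 0 ≤ N) (hK : 0 ≤ K) {T : ℝ} (hT : 0 ≤ T) :
    ∃ B, 0 ≤ B ∧ ∀ (F₀ : E3 → E3 → ℝ) (F G : ℝ → E3 → E3 → ℝ) (A : ℝ) (n : ℕ), 0 ≤ A →
      (∀ x v, 0 ≤ F₀ x v) → (∀ x v, (1 + ‖v‖) ^ β * F₀ x v ≤ N) → JMeas F → JMeas G →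
      (∀ t ∈ Set.Icc 0 T, ∀ x, Reg β N c (F t x)) → (∀ t ∈ Set.Icc 0 T, ∀ x, Reg β N c (G t x)) →
      (∀ t ∈ Set.Icc 0 T, ∀ x v, (1 + ‖v‖) ^ β * |F t x v - G t x v| ≤ A * (t ^ n / n.factorial)) →
      ∀ t ∈ Set.Icc 0 T, ∀ x v, (1 + ‖v‖) ^ β * |mildStep ν K F₀ F t x v - mildStep ν K F₀ G t x v|
        ≤ A * B * (t ^ (n + 1) / (n + 1).factorial) := by
  obtain ⟨L, hL, hLip⟩ := exists_lipschitz hβ hc hν1 hν2 N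
  obtain ⟨C, hC, hCb⟩ := Adm.exists_bounds hβ hν1 hν2
  have hJ := wInt_nonneg β
  set P := C * N
  have hP : 0 ≤ P := by positivity
  refine ⟨(2 * P + K * P * T + K) * (L * wInt β), by positivity, ?_⟩
  intro F₀ F G A n hA h0 hb hF hG hFr hGr hFG t ht x v
  have hw : 0 < (1 + ‖v‖) ^ β := by positivity
  set W := ((1 + ‖v‖) ^ β)⁻¹ with hWdef
  have hW : 0 ≤ W := by positivity
  set D : ℝ → ℝ := fun τ => L * wInt β * A * (τ ^ n / n.factorial) with hDdef
  have hsub : ∀ τ ∈ Set.Ioc 0 t, τ ∈ Set.Icc 0 T := fun τ hτ => ⟨hτ.1.le, hτ.2.trans ht.2⟩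
  have hdist : ∀ τ ∈ Set.Ioc 0 t, ∀ y, L * vdist (F τ y) (G τ y) ≤ D τ := fun τ hτ y => by
    have := vdist_le hβ (hFG τ (hsub τ hτ) y)
    calc L * vdist (F τ y) (G τ y) ≤ L * (wInt β * (A * (τ ^ n / n.factorial))) := by gcongr
      _ = D τ := by simp only [hDdef]; ring
  have hWle : ∀ {z q : ℝ}, (1 + ‖v‖) ^ β * z ≤ q → z ≤ W * q := fun {z q} h => by
    rw [hWdef, inv_mul_eq_div, le_div_iff₀ hw, mul_comm]; exact h
  have hgain : ∀ {H : ℝ → E3 → E3 → ℝ}, (∀ t ∈ Set.Icc 0 T, ∀ x, Reg β N c (H t x)) →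
      ∀ τ ∈ Set.Ioc 0 t, |gainOn ν H (x - t • v) v τ| ≤ W * P := fun {H} hH τ hτ => by
    have hr := hH τ (hsub τ hτ) (x - t • v + τ • v)
    have hd := hc.trans_le hr.le_dens
    rw [gainOn, abs_of_nonneg ((hr.adm.kin hβ).aGauss_pos hd hν1 hν2 v).le]
    exact hWle ((hCb hr.adm hd).2 v)
  have key := abs_duh_sub_duh_le (r := 0) (y := F₀ (x - t • v) v) (D := D) (W := W) (P := P)
    (hF.freq ν hK (x - t • v) v) (hG.freq ν hK (x - t • v) v)
    (hF.measurable_gainOn ν (x - t • v) v) (hG.measurable_gainOn ν (x - t • v) v) hW hP ht.1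
    (Continuous.integrableOn_Ioc (by fun_prop))
    (fun τ hτ => by have := hτ.1.le; positivity)
    (by
      rw [abs_of_nonneg (h0 _ _)]
      refine hWle ((hb _ _).trans ?_)
      exact le_mul_of_one_le_left hN hC)
    (hgain hFr) (hgain hGr)
    (fun τ hτ => (abs_truncate_sub_le _ _ K).trans
      ((hLip _ _ (hFr τ (hsub τ hτ) _) (hGr τ (hsub τ hτ) _)).1.trans (hdist τ hτ _)))
    (fun τ hτ => hWle (((hLip _ _ (hFr τ (hsub τ hτ) _) (hGr τ (hsub τ hτ) _)).2 v).trans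
      (hdist τ hτ _)))
  rw [hDdef, integral_pow_div_factorial _ _ ht.1, sub_zero] at key
  have hq : 0 ≤ t ^ (n + 1) / ((n + 1).factorial : ℝ) := by have := ht.1; positivity
  calc (1 + ‖v‖) ^ β * |mildStep ν K F₀ F t x v - mildStep ν K F₀ G t x v|
      ≤ (1 + ‖v‖) ^ β * (W * (2 * P + K * P * t + K) *
        (L * wInt β * A * (t ^ (n + 1) / (n + 1).factorial))) := by gcongr; exact key
    _ = (2 * P + K * P * t + K) * (L * wInt β * A * (t ^ (n + 1) / (n + 1).factorial)) := by
        rw [hWdef]; field_simp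
    _ ≤ (2 * P + K * P * T + K) * (L * wInt β * A * (t ^ (n + 1) / (n + 1).factorial)) := by
        have := ht.2
        gcongr
    _ = _ := by ring

/-- Two fixed points of the Duhamel map agree. -/
theorem eq_of_mildStep_eq (hβ : 5 < β) (hc : 0 < c) (hν1 : -(1 / 2 : ℝ) < ν) (hν2 : ν < 1)
    (hK : 0 ≤ K) {T : ℝ} (hT : 0 ≤ T) {F₀ : E3 → E3 → ℝ} {F G : ℝ → E3 → E3 → ℝ}
    (h0 : ∀ x v, 0 ≤ F₀ x v) (hb : ∀ x v, (1 + ‖v‖) ^ β * F₀ x v ≤ N) (hF : JMeas F) (hG : JMeas G)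
    (hFr : ∀ t ∈ Set.Icc 0 T, ∀ x, Reg β N c (F t x))
    (hGr : ∀ t ∈ Set.Icc 0 T, ∀ x, Reg β N c (G t x))
    (hFe : ∀ t ∈ Set.Icc 0 T, ∀ x v, mildStep ν K F₀ F t x v = F t x v)
    (hGe : ∀ t ∈ Set.Icc 0 T, ∀ x v, mildStep ν K F₀ G t x v = G t x v) :
    ∀ t ∈ Set.Icc 0 T, ∀ x v, F t x v = G t x v := by
  have hN : 0 ≤ N := (mul_nonneg (by positivity) (h0 0 0)).trans (hb 0 0)
  obtain ⟨B, hB, hstep⟩ := exists_mildStep_sub_le hβ hc hν1 hν2 hN hK hT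
  have key : ∀ n : ℕ, ∀ t ∈ Set.Icc 0 T, ∀ x v,
      (1 + ‖v‖) ^ β * |F t x v - G t x v| ≤ N * B ^ n * (t ^ n / n.factorial) := by
    intro n
    induction n with
    | zero =>
      intro t ht x v
      have hw : 0 ≤ (1 + ‖v‖) ^ β := by positivity
      have h1 := (hFr t ht x).adm
      have h2 := (hGr t ht x).adm
      have : (1 + ‖v‖) ^ β * |F t x v - G t x v| ≤ N := by
        rw [← abs_of_nonneg hw, ← abs_mul, mul_sub, abs_le]
        constructor <;> linarith [h1.le v, h2.le v, mul_nonneg hw (h1.nonneg v),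
          mul_nonneg hw (h2.nonneg v)]
      simpa using this
    | succ n ih =>
      intro t ht x v
      have := hstep F₀ F G (N * B ^ n) n (by positivity) h0 hb hF hG hFr hGr ih t ht x v
      rw [hFe t ht, hGe t ht] at this
      rwa [pow_succ, ← mul_assoc]
  intro t ht x v
  have hw : 0 < (1 + ‖v‖) ^ β := by positivity
  have hlim : Filter.Tendsto (fun n : ℕ => N * ((B * t) ^ n / n.factorial)) Filter.atTop
      (nhds (N * 0)) := (FloorSemiring.tendsto_pow_div_factorial_atTop (B * t)).const_mul N
  have hle : (1 + ‖v‖) ^ β * |F t x v - G t x v| ≤ N * 0 :=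
    ge_of_tendsto' hlim fun n => (key n t ht x v).trans_eq (by rw [mul_pow]; ring)
  rw [mul_zero] at hle
  have : |F t x v - G t x v| ≤ 0 := by
    by_contra! h
    exact absurd hle (not_le.2 (by positivity))
  exact sub_eq_zero.1 (abs_nonpos_iff.1 this)

end ESBGK

namespace ESBGK

variable {ν K β M c G : ℝ} {F₀ : E3 → E3 → ℝ}

/-- Picard iterates of the Duhamel map, started from free transport. -/
noncomputable def picard (ν K : ℝ) (F₀ : E3 → E3 → ℝ) : ℕ → ℝ → E3 → E3 → ℝ
  | 0 => fun t x v => F₀ (x - t • v) v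
  | n + 1 => mildStep ν K F₀ (picard ν K F₀ n)

theorem traj_picard (h : Data β M c F₀) (hG : GainBound β ν G) (hβ : 5 < β) (hc : 0 < c)
    (hν1 : -(1 / 2 : ℝ) < ν) (hν2 : ν < 1) (hK : 0 ≤ K) (hG0 : 0 ≤ G) (n : ℕ) :
    Traj β M (K * G) K F₀ (picard ν K F₀ n) := by
  induction n with
  | zero => exact h.traj_transport (by positivity) hK
  | succ n ih => exact ih.mildStep hG h hβ hν1 hν2 hK hG0 hc

theorem mildStep_of_nonpos (F : ℝ → E3 → E3 → ℝ) {t : ℝ} (ht : t ≤ 0) (x v : E3) :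
    mildStep ν K F₀ F t x v = F₀ (x - t • v) v := duh_of_le ht

theorem picard_of_nonpos (n : ℕ) {t : ℝ} (ht : t ≤ 0) (x v : E3) :
    picard ν K F₀ n t x v = F₀ (x - t • v) v := by
  cases n with
  | zero => rfl
  | succ n => exact mildStep_of_nonpos _ ht x v

theorem abs_picard_succ_sub_le (h : Data β M c F₀) (hG : GainBound β ν G) (hβ : 5 < β)
    (hc : 0 < c) (hν1 : -(1 / 2 : ℝ) < ν) (hν2 : ν < 1) (hK : 0 ≤ K) (hG0 : 0 ≤ G) {T : ℝ}
    (hT : 0 ≤ T) :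
    ∃ A B, 0 ≤ A ∧ 0 ≤ B ∧ ∀ n, ∀ t ∈ Set.Icc 0 T, ∀ x v, (1 + ‖v‖) ^ β *
      |picard ν K F₀ n t x v - picard ν K F₀ (n + 1) t x v| ≤ A * ((B * T) ^ n / n.factorial) := by
  have htr := traj_picard h hG hβ hc hν1 hν2 hK hG0
  have hKG : 0 ≤ K * G := by positivity
  set N := M * Real.exp (K * G * T)
  have hM := h.M_nonneg
  have hN : 0 ≤ N := by positivity
  have hMN : M ≤ N := le_mul_of_one_le_right hM (Real.one_le_exp (by positivity))
  have hreg : ∀ n, ∀ t ∈ Set.Icc 0 T, ∀ x,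
      Reg β N (c * Real.exp (-(K * T))) (picard ν K F₀ n t x) := fun n t ht x =>
    (htr n).reg h hβ hKG hK hc ht.1 ht.2 x
  obtain ⟨B, hB, hstep⟩ := exists_mildStep_sub_le (T := T) hβ
    (mul_pos hc (Real.exp_pos (-(K * T)))) hν1 hν2 hN hK hT
  have key : ∀ n : ℕ, ∀ t ∈ Set.Icc 0 T, ∀ x v, (1 + ‖v‖) ^ β *
      |picard ν K F₀ n t x v - picard ν K F₀ (n + 1) t x v|
        ≤ N * B ^ n * (t ^ n / n.factorial) := by
    intro n
    induction n with
    | zero =>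
      intro t ht x v
      have hw : 0 ≤ (1 + ‖v‖) ^ β := by positivity
      have h1 := (hreg 0 t ht x).adm
      have h2 := (hreg 1 t ht x).adm
      have : (1 + ‖v‖) ^ β * |picard ν K F₀ 0 t x v - picard ν K F₀ 1 t x v| ≤ N := by
        rw [← abs_of_nonneg hw, ← abs_mul, mul_sub, abs_le]
        constructor <;> linarith [h1.le v, h2.le v, mul_nonneg hw (h1.nonneg v),
          mul_nonneg hw (h2.nonneg v)]
      simpa using this
    | succ n ih =>
      intro t ht x v
      have := hstep F₀ _ _ (N * B ^ n) n (by positivity) h.nonneg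
        (fun x v => (h.le x v).trans hMN) (htr n).meas (htr (n + 1)).meas (hreg n) (hreg (n + 1))
        ih t ht x v
      rwa [mul_assoc N, ← pow_succ] at this
  refine ⟨N, B, hN, hB, fun n t ht x v => (key n t ht x v).trans ?_⟩
  rw [mul_pow, mul_assoc, ← mul_div_assoc]
  have := ht.1
  have := ht.2
  gcongr

/-- The truncated equation has a global mild solution, obtained as the limit of the Picard
iterates. -/
theorem exists_fixed_point (h : Data β M c F₀) (hG : GainBound β ν G) (hβ : 5 < β) (hc : 0 < c)
    (hν1 : -(1 / 2 : ℝ) < ν) (hν2 : ν < 1) (hK : 0 ≤ K) (hG0 : 0 ≤ G) :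
    ∃ F, Traj β M (K * G) K F₀ F ∧ (∀ t x v, mildStep ν K F₀ F t x v = F t x v) ∧
      ∀ t x v, Filter.Tendsto (fun n => picard ν K F₀ n t x v) Filter.atTop (nhds (F t x v)) := by
  have htr := traj_picard h hG hβ hc hν1 hν2 hK hG0
  have hKG : 0 ≤ K * G := by positivity
  have hM := h.M_nonneg
  have hconv : ∀ t x v, ∃ l,
      Filter.Tendsto (fun n => picard ν K F₀ n t x v) Filter.atTop (nhds l) := by
    intro t x v
    rcases le_total t 0 with ht | ht
    · exact ⟨F₀ (x - t • v) v, by simp only [picard_of_nonpos _ ht]; exact tendsto_const_nhds⟩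
    · obtain ⟨A, B, hA, hB, hle⟩ := abs_picard_succ_sub_le h hG hβ hc hν1 hν2 hK hG0 ht
      have hw : 0 < (1 + ‖v‖) ^ β := by positivity
      refine cauchySeq_tendsto_of_complete (cauchySeq_of_dist_le_of_summable
        (fun n : ℕ => A / (1 + ‖v‖) ^ β * ((B * t) ^ n / n.factorial)) (fun n => ?_)
        ((Real.summable_pow_div_factorial _).mul_left _))
      rw [Real.dist_eq, div_mul_eq_mul_div, le_div_iff₀ hw, mul_comm]
      exact hle n t ⟨ht, le_rfl⟩ x v
  choose F hF using hconv
  have hmeas : JMeas F := measurable_of_tendsto_metrizable (fun n => (htr n).meas)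
    (tendsto_pi_nhds.2 fun z => hF z.1 z.2.1 z.2.2)
  have hFt : Traj β M (K * G) K F₀ F := ⟨hmeas,
    fun t ht x v => ge_of_tendsto' (hF t x v) fun n => (htr n).lower t ht x v,
    fun t ht x v => le_of_tendsto' ((hF t x v).const_mul _) fun n => (htr n).upper t ht x v⟩
  refine ⟨F, hFt, fun t x v => ?_, hF⟩
  rcases le_total t 0 with ht | ht
  · rw [mildStep_of_nonpos _ ht]
    refine tendsto_nhds_unique ?_ (hF t x v)
    simp only [picard_of_nonpos _ ht]
    exact tendsto_const_nhds
  obtain ⟨A, B, hA, hB, hle⟩ := abs_picard_succ_sub_le h hG hβ hc hν1 hν2 hK hG0 ht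
  have hw : 0 < (1 + ‖v‖) ^ β := by positivity
  set d : ℕ → ℝ := fun n => A * ((B * t) ^ n / n.factorial)
  have hd : Summable d := (Real.summable_pow_div_factorial _).mul_left _
  have hd0 : ∀ n, 0 ≤ d n := fun n => by positivity
  have htail : ∀ n, ∀ s ∈ Set.Icc 0 t, ∀ x v,
      (1 + ‖v‖) ^ β * |picard ν K F₀ n s x v - F s x v| ≤ ∑' m, d (n + m) := by
    intro n s hs x v
    have hw : 0 < (1 + ‖v‖) ^ β := by positivity
    have := dist_le_tsum_of_dist_le_of_tendsto (f := fun n => picard ν K F₀ n s x v)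
      (fun n => d n / (1 + ‖v‖) ^ β) (fun n => by
        rw [Real.dist_eq, le_div_iff₀ hw, mul_comm]
        exact hle n s hs x v) (hd.div_const _) (hF s x v) n
    rwa [tsum_div_const, Real.dist_eq, le_div_iff₀ hw, mul_comm] at this
  set N := M * Real.exp (K * G * t)
  have hN : 0 ≤ N := by positivity
  have hMN : M ≤ N := le_mul_of_one_le_right hM (Real.one_le_exp (by positivity))
  obtain ⟨B', hB', hstep⟩ := exists_mildStep_sub_le (T := t) hβ
    (mul_pos hc (Real.exp_pos (-(K * t)))) hν1 hν2 hN hK ht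
  have h1 : ∀ n, |picard ν K F₀ (n + 1) t x v - mildStep ν K F₀ F t x v|
      ≤ (∑' m, d (m + n)) * (B' * t / (1 + ‖v‖) ^ β) := fun n => by
    have := hstep F₀ (picard ν K F₀ n) F (∑' m, d (n + m)) 0 (tsum_nonneg fun m => hd0 _) h.nonneg
      (fun x v => (h.le x v).trans hMN) (htr n).meas hmeas
      (fun s hs x => (htr n).reg h hβ hKG hK hc hs.1 hs.2 x)
      (fun s hs x => hFt.reg h hβ hKG hK hc hs.1 hs.2 x)
      (fun s hs x v => by simpa using htail n s hs x v) t ⟨ht, le_rfl⟩ x v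
    rw [← mul_div_assoc, le_div_iff₀ hw, mul_comm]
    simp only [add_comm _ n]
    calc _ ≤ _ := this
      _ = _ := by simp; ring
  have h2 : Filter.Tendsto (fun n => picard ν K F₀ (n + 1) t x v) Filter.atTop
      (nhds (mildStep ν K F₀ F t x v)) := by
    rw [tendsto_iff_dist_tendsto_zero]
    refine squeeze_zero (fun _ => dist_nonneg) h1 ?_
    simpa using (tendsto_sum_nat_add d).mul_const (B' * t / (1 + ‖v‖) ^ β)
  exact tendsto_nhds_unique h2 ((hF t x v).comp (Filter.tendsto_add_atTop_nat 1))

end ESBGK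

namespace ESBGK

/-! ### The relative entropy of truncated solutions -/

variable {ν K β M c G : ℝ} {F₀ : E3 → E3 → ℝ} {F : ℝ → E3 → E3 → ℝ}

/-- The total relative entropy with respect to the global Maxwellian. -/
noncomputable def totEnt (f : E3 → E3 → ℝ) : ℝ≥0∞ :=
  ∫⁻ p : E3 × E3, ENNReal.ofReal (hent (Mw p.2) (f p.1 p.2))

theorem lintegral_transport {Φ : E3 × E3 → ℝ≥0∞} (hΦ : Measurable Φ) (s : ℝ) :
    ∫⁻ p : E3 × E3, Φ (p.1 + s • p.2, p.2) = ∫⁻ p, Φ p := by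
  have h : Measurable fun p : E3 × E3 => Φ (p.1 + s • p.2, p.2) := hΦ.comp (by fun_prop)
  rw [Measure.volume_eq_prod, lintegral_prod_symm _ h.aemeasurable,
    lintegral_prod_symm _ hΦ.aemeasurable]
  exact lintegral_congr fun v => lintegral_add_right_eq_self (fun x => Φ (x, v)) (s • v)

theorem measurable_ofReal_hent {Z : Type*} [MeasurableSpace Z] {w : Z → E3} {f : Z → ℝ}
    (hw : Measurable w) (hf : Measurable f) :
    Measurable fun z => ENNReal.ofReal (hent (Mw (w z)) (f z)) :=
  (measurable_hent.comp ((continuous_Mw.measurable.comp hw).prodMk hf)).ennreal_ofReal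

theorem totEnt_eq_lintegral_lintegral {f : E3 → E3 → ℝ}
    (hf : Measurable fun p : E3 × E3 => f p.1 p.2) :
    totEnt f = ∫⁻ x, ∫⁻ v, ENNReal.ofReal (hent (Mw v) (f x v)) := by
  rw [totEnt, Measure.volume_eq_prod,
    lintegral_prod _ (measurable_ofReal_hent measurable_snd hf).aemeasurable]

theorem totEnt_eq_ofReal_entE (h0 : ∀ x v, 0 ≤ F₀ x v)
    (h1 : Integrable fun p : E3 × E3 =>
      F₀ p.1 p.2 * Real.log (F₀ p.1 p.2) - Mw p.2 * Real.log (Mw p.2))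
    (h2 : Integrable fun p : E3 × E3 => F₀ p.1 p.2 - Mw p.2)
    (h3 : Integrable fun p : E3 × E3 => ‖p.2‖ ^ 2 * (F₀ p.1 p.2 - Mw p.2)) :
    0 ≤ entE F₀ ∧ totEnt F₀ = ENNReal.ofReal (entE F₀) := by
  have he : ∀ p : E3 × E3, hent (Mw p.2) (F₀ p.1 p.2)
      = (F₀ p.1 p.2 * Real.log (F₀ p.1 p.2) - Mw p.2 * Real.log (Mw p.2))
        + (3 / 2 * Real.log (2 * π) - 1) * (F₀ p.1 p.2 - Mw p.2)
        + 1 / 2 * (‖p.2‖ ^ 2 * (F₀ p.1 p.2 - Mw p.2)) := fun p => by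
    rw [hent, log_Mw]; ring
  have hi := (h1.add (h2.const_mul (3 / 2 * Real.log (2 * π) - 1))).add (h3.const_mul (1 / 2))
  have hi' : Integrable fun p : E3 × E3 => hent (Mw p.2) (F₀ p.1 p.2) :=
    hi.congr (.of_forall fun p => (he p).symm)
  have hIntegral : ∫ p : E3 × E3, hent (Mw p.2) (F₀ p.1 p.2) = entE F₀ := by
    rw [entE, ← integral_const_mul, ← integral_const_mul, ← integral_add h1 (h2.const_mul _),
      ← integral_add _ (h3.const_mul _)]
    · exact integral_congr_ae (.of_forall he)
    · exact h1.add (h2.const_mul _)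
  refine ⟨hIntegral ▸ integral_nonneg fun p => hent_nonneg (Mw_pos _) (h0 _ _), ?_⟩
  rw [totEnt, ← hIntegral, ofReal_integral_eq_lintegral_ofReal hi'
    (.of_forall fun p => hent_nonneg (Mw_pos _) (h0 _ _))]

theorem Traj.gainOn_mem (hG : GainBound β ν G) (hF : Traj β M (K * G) K F₀ F)
    (h : Data β M c F₀) (hβ : 5 < β) (hν1 : -(1 / 2 : ℝ) < ν) (hν2 : ν < 1) (hK : 0 ≤ K)
    (hG0 : 0 ≤ G) (hc : 0 < c) (y v : E3) (t : ℝ) :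
    ∀ τ ∈ Set.Ioc 0 t, gainOn ν F y v τ ∈
      Set.Icc 0 (((1 + ‖v‖) ^ β)⁻¹ * (G * (M * Real.exp (K * G * t)))) := by
  intro τ hτ
  have hM := h.M_nonneg
  have hw : 0 < (1 + ‖v‖) ^ β := by positivity
  have ha := hF.adm h hτ.1.le (y + τ • v)
  have hd := hF.dens_pos h hβ hc hτ.1.le (y + τ • v)
  refine ⟨((ha.kin hβ).aGauss_pos hd hν1 hν2 v).le, ?_⟩
  rw [inv_mul_eq_div, le_div_iff₀ hw, mul_comm]
  refine ((hG ha hd).2 v).trans ?_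
  have := hτ.2
  gcongr

theorem lintegral_hent_gainOn_le (hF : Traj β M (K * G) K F₀ F)
    (h : Data β M c F₀) (hβ : 5 < β) (hν1 : -(1 / 2 : ℝ) < ν) (hν2 : ν < 1) (hc : 0 < c)
    {A : E3 → ℝ≥0∞} (hA : Measurable A) {s : ℝ} (hs : 0 ≤ s) :
    ∫⁻ p : E3 × E3, A (p.1 + s • p.2) * ENNReal.ofReal (hent (Mw p.2) (gainOn ν F p.1 p.2 s))
      ≤ ∫⁻ p : E3 × E3, A (p.1 + s • p.2) *
        ENNReal.ofReal (hent (Mw p.2) (F s (p.1 + s • p.2) p.2)) := by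
  have hg : Measurable fun p : E3 × E3 => aGauss (F s p.1) ν p.2 :=
    (hF.meas.aGauss ν).comp (f := fun p : E3 × E3 => ((s, p.1), p.2)) (by fun_prop)
  have hΦ : Measurable fun p : E3 × E3 =>
      A p.1 * ENNReal.ofReal (hent (Mw p.2) (aGauss (F s p.1) ν p.2)) :=
    (hA.comp measurable_fst).mul (measurable_ofReal_hent measurable_snd hg)
  have hΨ : Measurable fun p : E3 × E3 => A p.1 * ENNReal.ofReal (hent (Mw p.2) (F s p.1 p.2)) :=
    (hA.comp measurable_fst).mul (measurable_ofReal_hent measurable_snd (hF.meas.slice s))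
  rw [show (∫⁻ p : E3 × E3, A (p.1 + s • p.2) *
      ENNReal.ofReal (hent (Mw p.2) (gainOn ν F p.1 p.2 s)))
    = ∫⁻ p : E3 × E3, (fun p : E3 × E3 =>
      A p.1 * ENNReal.ofReal (hent (Mw p.2) (aGauss (F s p.1) ν p.2))) (p.1 + s • p.2, p.2) from rfl,
    show (∫⁻ p : E3 × E3, A (p.1 + s • p.2) *
        ENNReal.ofReal (hent (Mw p.2) (F s (p.1 + s • p.2) p.2)))
    = ∫⁻ p : E3 × E3, (fun p : E3 × E3 => A p.1 * ENNReal.ofReal (hent (Mw p.2) (F s p.1 p.2)))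
      (p.1 + s • p.2, p.2) from rfl, lintegral_transport hΦ, lintegral_transport hΨ,
    Measure.volume_eq_prod, lintegral_prod _ hΦ.aemeasurable, lintegral_prod _ hΨ.aemeasurable]
  refine lintegral_mono fun x => ?_
  have hm1 : Measurable fun v : E3 => ENNReal.ofReal (hent (Mw v) (aGauss (F s x) ν v)) :=
    measurable_ofReal_hent measurable_id (hg.comp (f := fun v : E3 => (x, v)) (by fun_prop))
  have hm2 : Measurable fun v : E3 => ENNReal.ofReal (hent (Mw v) (F s x v)) :=
    measurable_ofReal_hent measurable_id (hF.adm h hs x).meas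
  simp only
  rw [lintegral_const_mul _ hm1, lintegral_const_mul _ hm2]
  refine mul_le_mul' le_rfl ?_
  exact ((hF.adm h hs x).kin hβ).lintegral_hent_aGauss_le (hF.dens_pos h hβ hc hs x) hν1 hν2

theorem totEnt_transport {f : E3 → E3 → ℝ} (hf : Measurable fun p : E3 × E3 => f p.1 p.2) (s : ℝ) :
    ∫⁻ p : E3 × E3, ENNReal.ofReal (hent (Mw p.2) (f (p.1 + s • p.2) p.2)) = totEnt f :=
  lintegral_transport (Φ := fun p => ENNReal.ofReal (hent (Mw p.2) (f p.1 p.2)))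
    (measurable_ofReal_hent measurable_snd hf) s

theorem JMeas.measurable_hent_gainOn (hF : JMeas F) (ν : ℝ) :
    Measurable fun q : (E3 × E3) × ℝ =>
      ENNReal.ofReal (hent (Mw q.1.2) (ESBGK.gainOn ν F q.1.1 q.1.2 q.2)) :=
  measurable_ofReal_hent (w := fun q : (E3 × E3) × ℝ => q.1.2) (by fun_prop) (hF.gainOn ν)

theorem totEnt_mildStep_le (hG : GainBound β ν G) (hF : Traj β M (K * G) K F₀ F)
    (h : Data β M c F₀) (hβ : 5 < β) (hν1 : -(1 / 2 : ℝ) < ν) (hν2 : ν < 1) (hK : 0 ≤ K)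
    (hG0 : 0 ≤ G) (hc : 0 < c) {t : ℝ} (ht : 0 ≤ t) :
    totEnt (mildStep ν K F₀ F t)
      ≤ totEnt F₀ + ∫⁻ s in Set.Ioc 0 t, ENNReal.ofReal K * totEnt (F s) := by
  rw [← totEnt_transport ((hF.meas.mildStep h.meas ν K).slice t) t]
  have hgm := hF.meas.measurable_hent_gainOn ν
  calc ∫⁻ p : E3 × E3, ENNReal.ofReal (hent (Mw p.2) (mildStep ν K F₀ F t (p.1 + t • p.2) p.2))
      ≤ ∫⁻ p : E3 × E3, (ENNReal.ofReal (hent (Mw p.2) (F₀ p.1 p.2)) + ∫⁻ s in Set.Ioc 0 t,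
          ENNReal.ofReal K * ENNReal.ofReal (hent (Mw p.2) (gainOn ν F p.1 p.2 s))) := by
        refine lintegral_mono fun p => ?_
        simp only [mildStep, add_sub_cancel_right]
        exact ofReal_hent_duh_le (Mw_pos _) (hF.meas.freq ν hK _ _)
          (hF.meas.measurable_gainOn ν _ _) ht (h.nonneg _ _)
          (hF.gainOn_mem hG h hβ hν1 hν2 hK hG0 hc _ _ t)
    _ = totEnt F₀ + ∫⁻ s in Set.Ioc 0 t, ∫⁻ p : E3 × E3,
          ENNReal.ofReal K * ENNReal.ofReal (hent (Mw p.2) (gainOn ν F p.1 p.2 s)) := by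
        rw [lintegral_add_left (measurable_ofReal_hent measurable_snd h.meas),
          lintegral_lintegral_swap (hgm.const_mul _).aemeasurable]
        rfl
    _ ≤ totEnt F₀ + ∫⁻ s in Set.Ioc 0 t, ENNReal.ofReal K * totEnt (F s) := by
        refine add_le_add le_rfl ?_
        refine setLIntegral_mono' measurableSet_Ioc fun s hs => ?_
        refine (lintegral_hent_gainOn_le hF h hβ hν1 hν2 hc
          (measurable_const (a := ENNReal.ofReal K)) hs.1.le).trans_eq ?_
        rw [lintegral_const_mul, totEnt_transport (hF.meas.slice s) s]
        exact measurable_ofReal_hent measurable_snd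
          ((hF.meas.slice s).comp (f := fun p : E3 × E3 => (p.1 + s • p.2, p.2)) (by fun_prop))

theorem lintegral_exp_growth (hK : 0 ≤ K) (H : ℝ≥0∞) {t : ℝ} (ht : 0 ≤ t) :
    H + ∫⁻ s in Set.Ioc 0 t, ENNReal.ofReal K * (H * ENNReal.ofReal (Real.exp (K * s)))
      = H * ENNReal.ofReal (Real.exp (K * t)) := by
  have h1 : ∫⁻ s in Set.Ioc 0 t, ENNReal.ofReal (K * Real.exp (K * s))
      = ENNReal.ofReal (Real.exp (K * t) - 1) := by
    rw [← ofReal_integral_eq_lintegral_ofReal (Continuous.integrableOn_Ioc (by fun_prop))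
      (.of_forall fun s => by positivity), ← intervalIntegral.integral_of_le ht,
      intervalIntegral.integral_eq_sub_of_hasDerivAt (f := fun s => Real.exp (K * s))
      (fun s _ => (((hasDerivAt_id' s).const_mul K).exp).congr_deriv (by ring))
      (Continuous.intervalIntegrable (by fun_prop) _ _)]
    simp
  have h2 : ∀ s, ENNReal.ofReal K * (H * ENNReal.ofReal (Real.exp (K * s)))
      = H * ENNReal.ofReal (K * Real.exp (K * s)) := fun s => by
    rw [ENNReal.ofReal_mul hK]; ring
  simp only [h2]
  rw [lintegral_const_mul _ (by fun_prop), h1]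
  nth_rewrite 1 [← mul_one H]
  rw [← mul_add, ← ENNReal.ofReal_one, ← ENNReal.ofReal_add zero_le_one]
  · simp
  · linarith [Real.one_le_exp (mul_nonneg hK ht)]

theorem totEnt_picard_le (h : Data β M c F₀) (hG : GainBound β ν G) (hβ : 5 < β) (hc : 0 < c)
    (hν1 : -(1 / 2 : ℝ) < ν) (hν2 : ν < 1) (hK : 0 ≤ K) (hG0 : 0 ≤ G) (n : ℕ) :
    ∀ t, 0 ≤ t → totEnt (picard ν K F₀ n t) ≤ totEnt F₀ * ENNReal.ofReal (Real.exp (K * t)) := by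
  have htr := traj_picard h hG hβ hc hν1 hν2 hK hG0
  induction n with
  | zero =>
    intro t ht
    have h1 : totEnt (picard ν K F₀ 0 t) = totEnt F₀ := by
      have := totEnt_transport h.meas (-t)
      simpa [totEnt, picard, sub_eq_add_neg] using this
    rw [h1]
    refine le_mul_of_one_le_right zero_le ?_
    rw [← ENNReal.ofReal_one]
    exact ENNReal.ofReal_le_ofReal (Real.one_le_exp (by positivity))
  | succ n ih =>
    intro t ht
    refine (totEnt_mildStep_le hG (htr n) h hβ hν1 hν2 hK hG0 hc ht).trans ?_
    rw [← lintegral_exp_growth hK _ ht]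
    refine add_le_add le_rfl ?_
    refine setLIntegral_mono' measurableSet_Ioc fun s hs => ?_
    gcongr
    exact ih s hs.1.le

/-- The relative entropy of the truncated solution does not increase. -/
theorem totEnt_le (h : Data β M c F₀) (hG : GainBound β ν G) (hβ : 5 < β) (hc : 0 < c)
    (hν1 : -(1 / 2 : ℝ) < ν) (hν2 : ν < 1) (hK : 0 ≤ K) (hG0 : 0 ≤ G)
    (hF : Traj β M (K * G) K F₀ F) (hfix : ∀ t x v, mildStep ν K F₀ F t x v = F t x v)
    (hlim : ∀ t x v,
      Filter.Tendsto (fun n => picard ν K F₀ n t x v) Filter.atTop (nhds (F t x v)))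
    (hfin : totEnt F₀ ≠ ⊤) {t : ℝ} (ht : 0 ≤ t) : totEnt (F t) ≤ totEnt F₀ := by
  have htr := traj_picard h hG hβ hc hν1 hν2 hK hG0
  have hexp : ∀ s, 0 ≤ s → totEnt (F s) ≤ totEnt F₀ * ENNReal.ofReal (Real.exp (K * s)) := by
    intro s hs
    calc totEnt (F s) = ∫⁻ p : E3 × E3, Filter.liminf
          (fun n => ENNReal.ofReal (hent (Mw p.2) (picard ν K F₀ n s p.1 p.2))) Filter.atTop := by
          refine lintegral_congr fun p => (Filter.Tendsto.liminf_eq ?_).symm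
          exact ENNReal.tendsto_ofReal (((continuous_hent _).tendsto _).comp (hlim s p.1 p.2))
      _ ≤ Filter.liminf (fun n => totEnt (picard ν K F₀ n s)) Filter.atTop :=
          lintegral_liminf_le fun n => measurable_ofReal_hent measurable_snd ((htr n).meas.slice s)
      _ ≤ Filter.liminf (fun _ : ℕ => totEnt F₀ * ENNReal.ofReal (Real.exp (K * s)))
            Filter.atTop :=
          Filter.liminf_le_liminf (.of_forall fun n =>
            totEnt_picard_le h hG hβ hc hν1 hν2 hK hG0 n s hs)
      _ = _ := Filter.liminf_const _
  have hFm := hF.meas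
  have hmF : Measurable fun q : (E3 × E3) × ℝ =>
      ENNReal.ofReal (hent (Mw q.1.2) (F q.2 (q.1.1 + q.2 • q.1.2) q.1.2)) :=
    measurable_ofReal_hent (w := fun q : (E3 × E3) × ℝ => q.1.2) (by fun_prop) hFm.along
  have hA := (hFm.freqOn ν K).ennreal_ofReal
  set X := ∫⁻ s in Set.Ioc 0 t, ∫⁻ p : E3 × E3, ENNReal.ofReal (freqOn ν K F p.1 p.2 s) *
    ENNReal.ofReal (hent (Mw p.2) (F s (p.1 + s • p.2) p.2)) with hX
  have hXfin : X ≠ ⊤ := by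
    refine ne_top_of_le_ne_top (ENNReal.mul_ne_top hfin
      (ENNReal.ofReal_ne_top (r := Real.exp (K * t)))) ?_
    rw [← lintegral_exp_growth hK _ ht]
    refine le_trans ?_ le_add_self
    refine setLIntegral_mono' measurableSet_Ioc fun s hs => ?_
    calc _ ≤ ∫⁻ p : E3 × E3, ENNReal.ofReal K *
          ENNReal.ofReal (hent (Mw p.2) (F s (p.1 + s • p.2) p.2)) := by
          refine lintegral_mono fun p => ?_
          gcongr
          exact (hFm.freq ν hK p.1 p.2).le s
      _ = ENNReal.ofReal K * totEnt (F s) := by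
          rw [lintegral_const_mul, totEnt_transport (hFm.slice s) s]
          exact hmF.comp (f := fun p : E3 × E3 => (p, s)) (by fun_prop)
      _ ≤ _ := by gcongr; exact hexp s hs.1.le
  have hY : ∫⁻ s in Set.Ioc 0 t, ∫⁻ p : E3 × E3, ENNReal.ofReal (freqOn ν K F p.1 p.2 s) *
      ENNReal.ofReal (hent (Mw p.2) (gainOn ν F p.1 p.2 s)) ≤ X := by
    refine setLIntegral_mono' measurableSet_Ioc fun s hs => ?_
    refine lintegral_hent_gainOn_le (A := fun x => ENNReal.ofReal
      (max 0 (min (collFreq (F s x) ν) K))) hF h hβ hν1 hν2 hc ?_ hs.1.le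
    exact (measurable_const.max (((hFm.collFreq ν).comp
      (f := fun x : E3 => (s, x)) (by fun_prop)).min measurable_const)).ennreal_ofReal
  have hpt : ∀ p : E3 × E3, ENNReal.ofReal (hent (Mw p.2) (F t (p.1 + t • p.2) p.2))
      + (∫⁻ s in Set.Ioc 0 t, ENNReal.ofReal (freqOn ν K F p.1 p.2 s) *
          ENNReal.ofReal (hent (Mw p.2) (F s (p.1 + s • p.2) p.2)))
      ≤ ENNReal.ofReal (hent (Mw p.2) (F₀ p.1 p.2))
        + ∫⁻ s in Set.Ioc 0 t, ENNReal.ofReal (freqOn ν K F p.1 p.2 s) *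
          ENNReal.ofReal (hent (Mw p.2) (gainOn ν F p.1 p.2 s)) := fun p => by
    have hfr := hFm.freq ν hK p.1 p.2
    have := hent_duh_add_lintegral_le (Mw_pos p.2) hfr
      (hFm.measurable_gainOn ν p.1 p.2) ht (h.nonneg p.1 p.2)
      (hF.gainOn_mem hG h hβ hν1 hν2 hK hG0 hc p.1 p.2 t)
    have he : ∀ s, duh (freqOn ν K F p.1 p.2) (gainOn ν F p.1 p.2) 0 (F₀ p.1 p.2) s
        = F s (p.1 + s • p.2) p.2 := fun s => by
      rw [← hfix s, mildStep, add_sub_cancel_right]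
    simpa only [he, ENNReal.ofReal_mul (hfr.nonneg _)] using this
  have hmt : Measurable fun p : E3 × E3 =>
      ENNReal.ofReal (hent (Mw p.2) (F t (p.1 + t • p.2) p.2)) :=
    hmF.comp (f := fun p : E3 × E3 => (p, t)) (by fun_prop)
  have hmain : totEnt (F t) + X ≤ totEnt F₀ + X := by
    calc totEnt (F t) + X = ∫⁻ p : E3 × E3,
          (ENNReal.ofReal (hent (Mw p.2) (F t (p.1 + t • p.2) p.2))
          + (∫⁻ s in Set.Ioc 0 t, ENNReal.ofReal (freqOn ν K F p.1 p.2 s) *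
          ENNReal.ofReal (hent (Mw p.2) (F s (p.1 + s • p.2) p.2)))) := by
          rw [lintegral_add_left hmt, totEnt_transport (hFm.slice t) t, lintegral_lintegral_swap (hA.mul hmF).aemeasurable]
      _ ≤ _ := lintegral_mono hpt
      _ = totEnt F₀ + ∫⁻ s in Set.Ioc 0 t, ∫⁻ p : E3 × E3,
          ENNReal.ofReal (freqOn ν K F p.1 p.2 s) *
          ENNReal.ofReal (hent (Mw p.2) (gainOn ν F p.1 p.2 s)) := by
          rw [lintegral_add_left (measurable_ofReal_hent measurable_snd h.meas),
            lintegral_lintegral_swap (hA.mul (hFm.measurable_hent_gainOn ν)).aemeasurable]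
          rfl
      _ ≤ _ := by gcongr
  exact ENNReal.le_of_add_le_add_right hXfin hmain

end ESBGK

namespace ESBGK

/-! ### The weighted sup norm along a truncated solution -/

variable {ν K β M C c G : ℝ} {F₀ : E3 → E3 → ℝ} {F : ℝ → E3 → E3 → ℝ}

theorem wSup_le {f : E3 → E3 → ℝ} {N : ℝ} (h : ∀ x v, (1 + ‖v‖) ^ β * f x v ≤ N) : wSup β f ≤ N :=
  ciSup_le fun p => h p.1 p.2

theorem le_wSup {f : E3 → E3 → ℝ} (h : WBdd β f) (x v : E3) :
    (1 + ‖v‖) ^ β * f x v ≤ wSup β f :=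
  le_ciSup h (x, v)

theorem wBdd_of_le {f : E3 → E3 → ℝ} {N : ℝ} (h : ∀ x v, (1 + ‖v‖) ^ β * f x v ≤ N) : WBdd β f :=
  ⟨N, by rintro _ ⟨p, rfl⟩; exact h p.1 p.2⟩

theorem Traj.wBdd (hF : Traj β M C K F₀ F) {t : ℝ} (ht : 0 ≤ t) : WBdd β (F t) :=
  wBdd_of_le (hF.upper t ht)

theorem Traj.semigroup (hG : GainBound β ν G) (hF : Traj β M (K * G) K F₀ F)
    (hfix : ∀ t x v, ESBGK.mildStep ν K F₀ F t x v = F t x v)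
    (h : Data β M c F₀) (hβ : 5 < β) (hν1 : -(1 / 2 : ℝ) < ν) (hν2 : ν < 1) (hK : 0 ≤ K)
    (hG0 : 0 ≤ G) (hc : 0 < c) {r t : ℝ} (hr : 0 ≤ r) (hrt : r ≤ t) (y v : E3) :
    F t (y + t • v) v
      = duh (freqOn ν K F y v) (gainOn ν F y v) r (F r (y + r • v) v) t := by
  rw [← hfix t, ← hfix r, ESBGK.mildStep, ESBGK.mildStep, add_sub_cancel_right, add_sub_cancel_right]
  exact duh_semigroup (hF.meas.freq ν hK y v) (hF.meas.measurable_gainOn ν y v)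
    (fun τ hτ => by
      have := hF.gainOn_mem hG h hβ hν1 hν2 hK hG0 hc y v t τ hτ
      rw [abs_of_nonneg this.1]; exact this.2) hr hrt

theorem Traj.abs_sub_along_le (hG : GainBound β ν G) (hF : Traj β M (K * G) K F₀ F)
    (hfix : ∀ t x v, ESBGK.mildStep ν K F₀ F t x v = F t x v)
    (h : Data β M c F₀) (hβ : 5 < β) (hν1 : -(1 / 2 : ℝ) < ν) (hν2 : ν < 1) (hK : 0 ≤ K)
    (hG1 : 1 ≤ G) (hc : 0 < c) {r t : ℝ} (hr : 0 ≤ r) (hrt : r ≤ t) (y v : E3) :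
    (1 + ‖v‖) ^ β * |F t (y + t • v) v - F r (y + r • v) v|
      ≤ K * (G * (M * Real.exp (K * G * t))) * (t - r) := by
  have hG0 : 0 ≤ G := by linarith
  have hM := h.M_nonneg
  have hw : 0 < (1 + ‖v‖) ^ β := by positivity
  have hfr := hF.meas.freq ν hK y v
  have hmem := hF.gainOn_mem hG h hβ hν1 hν2 hK hG0 hc y v t
  set P := G * (M * Real.exp (K * G * t)) with hP
  set B := ((1 + ‖v‖) ^ β)⁻¹ * P with hBdef
  set z := F r (y + r • v) v with hz
  have hzm : z ∈ Set.Icc 0 B := by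
    have ha := hF.adm h hr (y + r • v)
    refine ⟨ha.nonneg v, ?_⟩
    rw [hBdef, inv_mul_eq_div, le_div_iff₀ hw, mul_comm]
    refine (ha.le v).trans ((?_ : _ ≤ M * Real.exp (K * G * t)).trans
      (le_mul_of_one_le_left (by positivity) hG1))
    gcongr
  have hsub : ∀ τ ∈ Set.Ioc r t, gainOn ν F y v τ ∈ Set.Icc 0 B := fun τ hτ =>
    hmem τ ⟨hr.trans_lt hτ.1, hτ.2⟩
  have e := duh_sub_const hfr (hF.meas.measurable_gainOn ν y v) (r := r) (t := t) (y := z) (B := B)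
    (fun τ hτ => by rw [abs_of_nonneg (hsub τ hτ).1]; exact (hsub τ hτ).2) hrt z
  rw [sub_self, zero_mul, zero_add, ← hF.semigroup hG hfix h hβ hν1 hν2 hK hG0 hc hr hrt y v] at e
  rw [e]
  have hIntegral : ‖∫ s in Set.Ioc r t, expI (freqOn ν K F y v) s t * freqOn ν K F y v s *
      (gainOn ν F y v s - z)‖ ≤ K * B * volume.real (Set.Ioc r t) := by
    refine norm_setIntegral_le_of_norm_le_const (by simp) fun s hs => ?_
    rw [Real.norm_eq_abs, abs_mul, abs_mul, abs_of_pos (hfr.expI_pos s t),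
      abs_of_nonneg (hfr.nonneg s)]
    have h1 : |gainOn ν F y v s - z| ≤ B := by
      have := hsub s hs
      rw [abs_le]; constructor <;> linarith [this.1, this.2, hzm.1, hzm.2]
    have h2 : expI (freqOn ν K F y v) s t * freqOn ν K F y v s ≤ K :=
      (mul_le_of_le_one_left (hfr.nonneg s) (hfr.expI_le_one s t)).trans (hfr.le s)
    exact mul_le_mul h2 h1 (_root_.abs_nonneg _) hK
  rw [Real.volume_real_Ioc_of_le hrt, Real.norm_eq_abs] at hIntegral
  calc _ ≤ (1 + ‖v‖) ^ β * (K * B * (t - r)) := by gcongr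
    _ = K * P * (t - r) := by rw [hBdef]; field_simp

theorem Traj.continuousOn_wSup (hG : GainBound β ν G) (hF : Traj β M (K * G) K F₀ F)
    (hfix : ∀ t x v, ESBGK.mildStep ν K F₀ F t x v = F t x v)
    (h : Data β M c F₀) (hβ : 5 < β) (hν1 : -(1 / 2 : ℝ) < ν) (hν2 : ν < 1) (hK : 0 ≤ K)
    (hG1 : 1 ≤ G) (hc : 0 < c) : ContinuousOn (fun t => wSup β (F t)) (Set.Ici 0) := by
  have hG0 : 0 ≤ G := by linarith
  have hM := h.M_nonneg
  have key : ∀ T, 0 ≤ T → ContinuousOn (fun t => wSup β (F t)) (Set.Icc 0 T) := by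
    intro T hT
    set Λ := K * (G * (M * Real.exp (K * G * T))) with hΛ
    have hΛ0 : 0 ≤ Λ := by positivity
    have hle : ∀ r t, 0 ≤ r → r ≤ t → t ≤ T →
        |wSup β (F t) - wSup β (F r)| ≤ Λ * (t - r) := by
      intro r t hr hrt htT
      have hd : ∀ y v, (1 + ‖v‖) ^ β * |F t (y + t • v) v - F r (y + r • v) v| ≤ Λ * (t - r) :=
        fun y v => (hF.abs_sub_along_le hG hfix h hβ hν1 hν2 hK hG1 hc hr hrt y v).trans (by
          have : 0 ≤ t - r := by linarith
          rw [hΛ]; gcongr)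
      rw [abs_le]
      constructor
      · have : wSup β (F r) ≤ wSup β (F t) + Λ * (t - r) := wSup_le fun x v => by
          have hw : 0 < (1 + ‖v‖) ^ β := by positivity
          have h1 := hd (x - r • v) v
          have h2 := le_wSup (hF.wBdd (hr.trans hrt)) (x - r • v + t • v) v
          rw [sub_add_cancel] at h1
          nlinarith [neg_abs_le (F t (x - r • v + t • v) v - F r x v)]
        linarith
      · have : wSup β (F t) ≤ wSup β (F r) + Λ * (t - r) := wSup_le fun x v => by
          have hw : 0 < (1 + ‖v‖) ^ β := by positivity
          have h1 := hd (x - t • v) v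
          have h2 := le_wSup (hF.wBdd hr) (x - t • v + r • v) v
          rw [sub_add_cancel] at h1
          nlinarith [le_abs_self (F t x v - F r (x - t • v + r • v) v)]
        linarith
    refine LipschitzOnWith.continuousOn (K := ⟨Λ, hΛ0⟩) (LipschitzOnWith.of_dist_le_mul ?_)
    intro t ht r hr
    rw [Real.dist_eq, Real.dist_eq]
    rcases le_total r t with hrt | hrt
    · rw [abs_of_nonneg (sub_nonneg.2 hrt)]
      exact hle r t hr.1 hrt ht.2
    · rw [abs_sub_comm, abs_sub_comm t r, abs_of_nonneg (sub_nonneg.2 hrt)]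
      exact hle t r ht.1 hrt hr.2
  intro t ht
  have h0 : (0 : ℝ) ≤ t := ht
  refine (key (t + 1) (by linarith) t ⟨h0, by linarith⟩).mono_of_mem_nhdsWithin ?_
  rw [← Set.Ici_inter_Iic]
  exact Filter.inter_mem self_mem_nhdsWithin
    (mem_nhdsWithin_of_mem_nhds (Iic_mem_nhds (by linarith)))

/-- A continuity argument: a bound that improves itself holds for all times. -/
theorem forall_le_of_bootstrap {f : ℝ → ℝ} {a b : ℝ} (hf : ContinuousOn f (Set.Ici 0)) (hab : a < b)
    (h0 : f 0 ≤ a) (h : ∀ t, 0 ≤ t → (∀ s ∈ Set.Icc 0 t, f s ≤ b) → f t ≤ a) :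
    ∀ t, 0 ≤ t → f t ≤ a := by
  have hlt : ∀ t, 0 ≤ t → f t < b := by
    by_contra! hcon
    obtain ⟨t₀, ht₀, hbt⟩ := hcon
    set S := Set.Ici 0 ∩ f ⁻¹' Set.Ici b with hS
    have hclosed : IsClosed S := hf.preimage_isClosed_of_isClosed isClosed_Ici isClosed_Ici
    have hbdd : BddBelow S := ⟨0, fun s hs => hs.1⟩
    have hmem : sInf S ∈ S := hclosed.csInf_mem ⟨t₀, ht₀, hbt⟩ hbdd
    set τ := sInf S
    have hτ0 : (0 : ℝ) ≤ τ := hmem.1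
    have hτ : b ≤ f τ := hmem.2
    have hbefore : ∀ s, 0 ≤ s → s < τ → f s < b := fun s hs hsτ => by
      by_contra! hbs
      exact absurd (csInf_le hbdd ⟨hs, hbs⟩) (not_le.2 hsτ)
    rcases hτ0.eq_or_lt with h00 | hpos
    · rw [← h00] at hτ; linarith
    have hle : f τ ≤ b := by
      have hc : ContinuousWithinAt f (Set.Ioo 0 τ) τ := (hf τ hτ0).mono fun s hs => hs.1.le
      have : (nhdsWithin τ (Set.Ioo 0 τ)).NeBot := by
        rw [nhdsWithin_Ioo_eq_nhdsLT hpos]; infer_instance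
      refine le_of_tendsto hc ?_
      filter_upwards [self_mem_nhdsWithin] with s hs
      exact (hbefore s hs.1.le hs.2).le
    have := h τ hτ0 fun s hs => by
      rcases hs.2.eq_or_lt with rfl | hlt
      · exact hle
      · exact (hbefore s hs.1 hlt).le
    linarith
  exact fun t ht => h t ht fun s hs => (hlt s hs.1).le

end ESBGK

namespace ESBGK

/-! ### Averaging the distance to equilibrium over velocities -/

variable {ν K β M C c G : ℝ} {F₀ : E3 → E3 → ℝ} {F : ℝ → E3 → E3 → ℝ}

theorem measurable_Mw : Measurable Mw := kin_Mw.meas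

theorem JMeas.vdist (h : JMeas F) : Measurable fun z : ℝ × E3 => ESBGK.vdist (F z.1 z.2) Mw := by
  refine measurable_integral_snd (f := fun (z : ℝ × E3) v => (1 + ‖v‖) ^ 2 * |F z.1 z.2 v - Mw v|) ?_
  have h1 : Measurable fun p : (ℝ × E3) × E3 => F p.1.1 p.1.2 p.2 := h.uncurry
  have h2 : Measurable fun p : (ℝ × E3) × E3 => Mw p.2 := measurable_Mw.comp measurable_snd
  have h3 : Measurable fun p : (ℝ × E3) × E3 => (1 + ‖p.2‖) ^ 2 := by fun_prop
  exact h3.mul (h1.sub h2).abs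

theorem lintegral_ray {k : E3 → ℝ≥0∞} (hk : Measurable k) (x : E3) {s t : ℝ} (hst : s < t) :
    ∫⁻ v, k (x - t • v + s • v) = ENNReal.ofReal (((t - s) ^ 3)⁻¹) * ∫⁻ y, k y := by
  have hr : t - s ≠ 0 := by linarith
  have e : ∀ v : E3, k (x - t • v + s • v) = k (x - (t - s) • v) := fun v => by
    congr 1; rw [sub_smul]; abel
  have hk' : Measurable fun y => k (x - y) := by fun_prop
  simp only [e]
  rw [← lintegral_map (f := fun y => k (x - y)) hk' (measurable_const_smul (t - s)),
    Measure.map_addHaar_smul _ hr, lintegral_smul_measure, lintegral_sub_left_eq_self]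
  have : Module.finrank ℝ E3 = 3 := by simp
  rw [this, abs_of_nonneg (inv_nonneg.2 (pow_nonneg (by linarith) 3)), smul_eq_mul]

theorem lintegral_weight {β : ℝ} (hβ : 5 < β) :
    ∫⁻ v : E3, ENNReal.ofReal ((1 + ‖v‖) ^ (-(β - 2))) = ENNReal.ofReal (wInt β) :=
  (ofReal_integral_eq_lintegral_ofReal (integrable_weight (by linarith))
    (Filter.Eventually.of_forall fun v => by positivity)).symm

theorem lintegral_rays_le (hβ : 5 < β) {k h : ℝ → E3 → ℝ≥0∞}
    (hk : Measurable fun z : ℝ × E3 => k z.1 z.2) {r t D κ Q ε l : ℝ}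
    (hrt : r ≤ t) (hD : 0 ≤ D) (hκ : 0 ≤ κ) (hQ : 0 ≤ Q) (hε : 0 ≤ ε) (hl : 0 < l)
    (hkD : ∀ s ∈ Set.Ioc r t, ∀ y, k s y ≤ ENNReal.ofReal D)
    (hh : ∀ s ∈ Set.Ioc r t, Measurable (h s))
    (hkh : ∀ s ∈ Set.Ioc r t, ∀ y, k s y ≤ ENNReal.ofReal κ + ENNReal.ofReal Q * h s y)
    (hhε : ∀ s ∈ Set.Ioc r t, ∫⁻ y, h s y ≤ ENNReal.ofReal ε) (x : E3) :
    ∫⁻ v, ENNReal.ofReal ((1 + ‖v‖) ^ (-(β - 2))) *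
        ∫⁻ s in Set.Ioc r t, k s (x - t • v + s • v)
      ≤ ENNReal.ofReal (wInt β * D * l + (κ * wInt β + Q * (l ^ 3)⁻¹ * ε) * (t - r)) := by
  have hw0 := wInt_nonneg β
  have hwm : Measurable fun v : E3 => ENNReal.ofReal ((1 + ‖v‖) ^ (-(β - 2))) := by fun_prop
  have hkm : Measurable fun p : E3 × ℝ => k p.2 (x - t • p.1 + p.2 • p.1) :=
    hk.comp (f := fun p : E3 × ℝ => (p.2, x - t • p.1 + p.2 • p.1)) (by fun_prop)
  have hkv : ∀ v, Measurable fun s => k s (x - t • v + s • v) := fun v =>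
    hkm.comp (f := fun s => (v, s)) (by fun_prop)
  have e1 : ∫⁻ v, ENNReal.ofReal ((1 + ‖v‖) ^ (-(β - 2))) *
        ∫⁻ s in Set.Ioc r t, k s (x - t • v + s • v)
      = ∫⁻ s in Set.Ioc r t, ∫⁻ v, ENNReal.ofReal ((1 + ‖v‖) ^ (-(β - 2))) *
          k s (x - t • v + s • v) := by
    rw [← lintegral_lintegral_swap
      (f := fun v s => ENNReal.ofReal ((1 + ‖v‖) ^ (-(β - 2))) * k s (x - t • v + s • v))
      ((hwm.comp measurable_fst).mul hkm).aemeasurable]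
    exact lintegral_congr fun v => (lintegral_const_mul _ (hkv v)).symm
  have hJ : ∀ s ∈ Set.Ioc r t, ∫⁻ v, ENNReal.ofReal ((1 + ‖v‖) ^ (-(β - 2))) *
      k s (x - t • v + s • v) ≤ (Set.Ioc (t - l) t).indicator
        (fun _ => ENNReal.ofReal (wInt β * D)) s
        + ENNReal.ofReal (κ * wInt β + Q * (l ^ 3)⁻¹ * ε) := by
    intro s hs
    by_cases hsl : t - l < s
    · rw [Set.indicator_of_mem (show s ∈ Set.Ioc (t - l) t from ⟨hsl, hs.2⟩)]
      refine le_trans ?_ le_self_add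
      rw [ENNReal.ofReal_mul hw0, ← lintegral_weight hβ, ← lintegral_mul_const _ hwm]
      exact lintegral_mono fun v => mul_le_mul' le_rfl (hkD s hs _)
    · have hst : s < t := by linarith
      have hls : l ≤ t - s := by linarith
      refine le_trans ?_ le_add_self
      have hb : ∀ v : E3, ENNReal.ofReal ((1 + ‖v‖) ^ (-(β - 2))) * k s (x - t • v + s • v)
          ≤ ENNReal.ofReal κ * ENNReal.ofReal ((1 + ‖v‖) ^ (-(β - 2)))
            + ENNReal.ofReal Q * h s (x - t • v + s • v) := fun v => by
        have hw1 : ENNReal.ofReal ((1 + ‖v‖) ^ (-(β - 2))) ≤ 1 := by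
          rw [ENNReal.ofReal_le_one]
          exact Real.rpow_le_one_of_one_le_of_nonpos (by linarith [norm_nonneg v]) (by linarith)
        refine (mul_le_mul' le_rfl (hkh s hs _)).trans ?_
        rw [mul_add, mul_comm (ENNReal.ofReal κ)]
        exact add_le_add le_rfl (mul_le_of_le_one_left' hw1)
      refine (lintegral_mono hb).trans ?_
      have hm1 : Measurable fun v : E3 =>
          ENNReal.ofReal κ * ENNReal.ofReal ((1 + ‖v‖) ^ (-(β - 2))) := hwm.const_mul _
      have hm2 : Measurable fun v : E3 => h s (x - t • v + s • v) :=
        (hh s hs).comp (f := fun v => x - t • v + s • v) (by fun_prop)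
      rw [lintegral_add_left hm1, lintegral_const_mul _ hwm, lintegral_const_mul _ hm2,
        lintegral_weight hβ, lintegral_ray (hh s hs) x hst,
        ENNReal.ofReal_add (by positivity) (by positivity), ENNReal.ofReal_mul hκ,
        ENNReal.ofReal_mul (by positivity : 0 ≤ Q * (l ^ 3)⁻¹), ENNReal.ofReal_mul hQ, mul_assoc]
      refine add_le_add le_rfl (mul_le_mul' le_rfl (mul_le_mul' ?_ (hhε s hs)))
      exact ENNReal.ofReal_le_ofReal (by gcongr)
  have hB0 : 0 ≤ κ * wInt β + Q * (l ^ 3)⁻¹ * ε := by positivity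
  rw [e1]
  generalize κ * wInt β + Q * (l ^ 3)⁻¹ * ε = B at hJ hB0 ⊢
  refine (setLIntegral_mono' measurableSet_Ioc hJ).trans ?_
  rw [lintegral_add_right _ measurable_const, lintegral_const, Measure.restrict_apply_univ,
    Real.volume_Ioc, ENNReal.ofReal_add (by positivity)
      (mul_nonneg hB0 (by linarith)), ENNReal.ofReal_mul hB0]
  refine add_le_add ?_ le_rfl
  refine (setLIntegral_le_lintegral _ _).trans ?_
  rw [lintegral_indicator_const measurableSet_Ioc, Real.volume_Ioc, _root_.sub_sub_cancel,
    ENNReal.ofReal_mul (by positivity : 0 ≤ wInt β * D)]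

end ESBGK

namespace ESBGK

/-! ### Relaxation towards equilibrium along characteristics -/

variable {ν K β M C c G N L : ℝ} {F₀ : E3 → E3 → ℝ} {F : ℝ → E3 → E3 → ℝ}

theorem Adm.weight_mul_abs_sub_le {f g : E3 → ℝ} (hf : Adm β N f) (hg : Adm β N g) (v : E3) :
    (1 + ‖v‖) ^ β * |f v - g v| ≤ N := by
  have hw : 0 ≤ (1 + ‖v‖) ^ β := by positivity
  rw [← abs_of_nonneg hw, ← abs_mul, mul_sub, abs_le]
  have h1 := mul_nonneg hw (hf.nonneg v)
  have h2 := mul_nonneg hw (hg.nonneg v)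
  constructor <;> linarith [hf.le v, hg.le v]

theorem Adm.vdist_le {f g : E3 → ℝ} (hβ : 5 < β) (hf : Adm β N f) (hg : Adm β N g) :
    vdist f g ≤ wInt β * N :=
  ESBGK.vdist_le hβ (hf.weight_mul_abs_sub_le hg)

theorem JMeas.vdist_along (h : JMeas F) (y v : E3) :
    Measurable fun s : ℝ => ESBGK.vdist (F s (y + s • v)) Mw :=
  h.vdist.comp (f := fun s : ℝ => (s, y + s • v)) (by fun_prop)

theorem expI_const (a : ℝ) {r t : ℝ} (hrt : r ≤ t) :
    expI (fun _ => a) r t = Real.exp (-(a * (t - r))) := by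
  rw [expI, setIntegral_const, smul_eq_mul, measureReal_def, Real.volume_Ioc,
    ENNReal.toReal_ofReal (by linarith), mul_comm]

theorem Traj.abs_sub_relax_le (hG : GainBound β ν G) (hF : Traj β M (K * G) K F₀ F)
    (hfix : ∀ t x v, ESBGK.mildStep ν K F₀ F t x v = F t x v)
    (h : Data β M c F₀) (hβ : 5 < β) (hν1 : -(1 / 2 : ℝ) < ν) (hν2 : ν < 1) (hK : 1 / (1 - ν) ≤ K)
    (hG0 : 0 ≤ G) (hc : 0 < c) {r t : ℝ} (hr : 0 ≤ r) (hrt : r ≤ t)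
    (hN : ∀ s ∈ Set.Icc r t, ∀ y, Adm β N (F s y)) (hNM : Adm β N Mw)
    (hL : ∀ g, Adm β N g → 0 < dens g →
      |collFreq g ν - 1 / (1 - ν)| ≤ L * vdist g Mw ∧
      ∀ v, (1 + ‖v‖) ^ β * |aGauss g ν v - Mw v| ≤ L * vdist g Mw) (y v : E3) :
    (1 + ‖v‖) ^ β * |F t (y + t • v) v - Mw v
        - Real.exp (-(1 / (1 - ν) * (t - r))) * (F r (y + r • v) v - Mw v)|
      ≤ (N + K) * L * ∫ s in Set.Ioc r t, vdist (F s (y + s • v)) Mw := by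
  have hβ0 : 0 ≤ 1 / (1 - ν) := by
    have : 0 < 1 - ν := by linarith
    positivity
  have hK0 : 0 ≤ K := hβ0.trans hK
  have hw : 0 < (1 + ‖v‖) ^ β := by positivity
  have hfr := hF.meas.freq ν hK0 y v
  have hfc : Freq K fun _ : ℝ => 1 / (1 - ν) := ⟨measurable_const, fun _ => hβ0, fun _ => hK⟩
  have hgm := hF.meas.measurable_gainOn ν y v
  have hmem := hF.gainOn_mem hG h hβ hν1 hν2 hK0 hG0 hc y v t
  have hI : ∀ τ ∈ Set.Ioc r t, τ ∈ Set.Icc r t := fun τ hτ => ⟨hτ.1.le, hτ.2⟩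
  set V : ℝ → ℝ := fun s => vdist (F s (y + s • v)) Mw with hV
  have hV0 : ∀ s, 0 ≤ V s := fun s => vdist_nonneg _ _
  have hVi : IntegrableOn V (Set.Ioc r t) := integrableOn_Ioc_of_bdd (hF.meas.vdist_along y v)
    fun τ hτ => by
      rw [abs_of_nonneg (hV0 τ)]
      exact (hN τ (hI τ hτ) _).vdist_le hβ hNM
  have hLs : ∀ s ∈ Set.Ioc r t, _ := fun s hs =>
    hL (F s (y + s • v)) (hN s (hI s hs) _) (hF.dens_pos h hβ hc (hr.trans hs.1.le) _)
  have hgB : ∀ τ ∈ Set.Ioc r t, |gainOn ν F y v τ| ≤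
      ((1 + ‖v‖) ^ β)⁻¹ * (G * (M * Real.exp (K * G * t))) := fun τ hτ => by
    have := hmem τ ⟨hr.trans_lt hτ.1, hτ.2⟩
    rw [abs_of_nonneg this.1]; exact this.2
  have hexp : |expI (freqOn ν K F y v) r t - expI (fun _ => 1 / (1 - ν)) r t|
      ≤ ∫ τ in Set.Ioc r t, L * V τ := by
    refine abs_expI_sub_expI_le hfr hfc (hVi.const_mul L) fun τ hτ => ?_
    have h1 : freqOn ν K F y v τ - 1 / (1 - ν) = max 0 (min (collFreq (F τ (y + τ • v)) ν) K)
        - max 0 (min (1 / (1 - ν)) K) := by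
      rw [min_eq_left hK, max_eq_right hβ0, freqOn]
    rw [h1]
    exact (abs_truncate_sub_le _ _ K).trans (hLs τ hτ).1
  have hz := (hN r ⟨le_rfl, hrt⟩ (y + r • v)).weight_mul_abs_sub_le hNM v
  rw [integral_const_mul] at hexp
  have hIntegral : |∫ s in Set.Ioc r t, expI (freqOn ν K F y v) s t * freqOn ν K F y v s *
      (gainOn ν F y v s - Mw v)| ≤ ∫ s in Set.Ioc r t, ((1 + ‖v‖) ^ β)⁻¹ * (K * L) * V s := by
    rw [← Real.norm_eq_abs]
    refine norm_integral_le_of_norm_le (hVi.const_mul _)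
      ((ae_restrict_iff' measurableSet_Ioc).2 (Filter.Eventually.of_forall fun s hs => ?_))
    rw [Real.norm_eq_abs, abs_mul, abs_mul, abs_of_pos (hfr.expI_pos s t)]
    have h1 : expI (freqOn ν K F y v) s t * |freqOn ν K F y v s| ≤ 1 * K :=
      mul_le_mul (hfr.expI_le_one s t) (hfr.abs_le s) (abs_nonneg _) zero_le_one
    have h2 : |gainOn ν F y v s - Mw v| ≤ ((1 + ‖v‖) ^ β)⁻¹ * (L * V s) := by
      rw [inv_mul_eq_div, le_div_iff₀ hw, mul_comm]
      exact (hLs s hs).2 v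
    calc _ ≤ 1 * K * (((1 + ‖v‖) ^ β)⁻¹ * (L * V s)) :=
          mul_le_mul h1 h2 (abs_nonneg _) (by linarith)
      _ = _ := by ring
  rw [integral_const_mul] at hIntegral
  set X := ∫ s in Set.Ioc r t, V s with hX
  rw [hF.semigroup hG hfix h hβ hν1 hν2 hK0 hG0 hc hr hrt y v,
    duh_sub_const hfr hgm hgB hrt (Mw v), ← expI_const _ hrt]
  set z := F r (y + r • v) v - Mw v
  set J := ∫ s in Set.Ioc r t, expI (freqOn ν K F y v) s t * freqOn ν K F y v s *
      (gainOn ν F y v s - Mw v)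
  set e₁ := expI (freqOn ν K F y v) r t
  set e₂ := expI (fun _ => 1 / (1 - ν)) r t
  have hNn : 0 ≤ N := hNM.N_nonneg
  calc (1 + ‖v‖) ^ β * |z * e₁ + J - e₂ * z|
      = (1 + ‖v‖) ^ β * |z * (e₁ - e₂) + J| := by congr 2; ring
    _ ≤ (1 + ‖v‖) ^ β * (|z| * |e₁ - e₂| + |J|) := by
        rw [← abs_mul]; gcongr; exact abs_add_le _ _
    _ = ((1 + ‖v‖) ^ β * |z|) * |e₁ - e₂| + (1 + ‖v‖) ^ β * |J| := by ring
    _ ≤ N * (L * X) + (1 + ‖v‖) ^ β * (((1 + ‖v‖) ^ β)⁻¹ * (K * L) * X) :=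
        add_le_add (mul_le_mul hz hexp (abs_nonneg _) hNn) (by gcongr)
    _ = (N + K) * L * X := by field_simp

theorem Traj.abs_moment_le (hG : GainBound β ν G) (hF : Traj β M (K * G) K F₀ F)
    (hfix : ∀ t x v, ESBGK.mildStep ν K F₀ F t x v = F t x v)
    (h : Data β M c F₀) (hβ : 5 < β) (hν1 : -(1 / 2 : ℝ) < ν) (hν2 : ν < 1) (hK : 1 / (1 - ν) ≤ K)
    (hG0 : 0 ≤ G) (hc : 0 < c) {r t : ℝ} (hr : 0 ≤ r) (hrt : r ≤ t)
    (hN : ∀ s ∈ Set.Icc r t, ∀ y, Adm β N (F s y)) (hNM : Adm β N Mw) (hL0 : 0 ≤ L)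
    (hL : ∀ g, Adm β N g → 0 < dens g →
      |collFreq g ν - 1 / (1 - ν)| ≤ L * vdist g Mw ∧
      ∀ v, (1 + ‖v‖) ^ β * |aGauss g ν v - Mw v| ≤ L * vdist g Mw) (x : E3) {q : ℝ}
    (hq : ∫⁻ v, ENNReal.ofReal ((1 + ‖v‖) ^ (-(β - 2))) * ∫⁻ s in Set.Ioc r t,
      ENNReal.ofReal (vdist (F s (x - t • v + s • v)) Mw) ≤ ENNReal.ofReal q) (hq0 : 0 ≤ q)
    {φ : E3 → ℝ} (hφm : Measurable φ) (hφ : ∀ v, |φ v| ≤ (1 + ‖v‖) ^ 2) :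
    |∫ v, φ v * (F t x v - Mw v)|
      ≤ Real.exp (-(1 / (1 - ν) * (t - r))) *
          |∫ v, φ v * (F r (x - t • v + r • v) v - Mw v)| + (N + K) * L * q := by
  have hβ0 : 0 ≤ 1 / (1 - ν) := by
    have : 0 < 1 - ν := by linarith
    positivity
  have hK0 : 0 ≤ K := hβ0.trans hK
  have hNn : 0 ≤ N := hNM.N_nonneg
  have hφ' : ∀ v, |φ v| ≤ 1 * (1 + ‖v‖) ^ 2 := by simpa using hφ
  have hm := kin_Mw.integrable_mul hφm hφ'
  have hA1 := hN t ⟨hrt, le_rfl⟩ x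
  have hA2 : Adm β N fun v => F r (x - t • v + r • v) v := by
    refine ⟨?_, fun v => (hN r ⟨le_rfl, hrt⟩ _).nonneg v, fun v => (hN r ⟨le_rfl, hrt⟩ _).le v⟩
    exact (hF.meas.slice r).comp (f := fun v : E3 => (x - t • v + r • v, v)) (by fun_prop)
  have h1 : Integrable fun v => φ v * (F t x v - Mw v) := by
    simp only [mul_sub]; exact ((hA1.kin hβ).integrable_mul hφm hφ').sub hm
  have h2 : Integrable fun v => φ v * (F r (x - t • v + r • v) v - Mw v) := by
    simp only [mul_sub]; exact ((hA2.kin hβ).integrable_mul hφm hφ').sub hm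
  set e := Real.exp (-(1 / (1 - ν) * (t - r)))
  have hpt := fun v => hF.abs_sub_relax_le hG hfix h hβ hν1 hν2 hK hG0 hc hr hrt hN hNM hL
    (x - t • v) v
  simp only [sub_add_cancel] at hpt
  set R : E3 → ℝ := fun v => F t x v - Mw v - e * (F r (x - t • v + r • v) v - Mw v) with hR
  have e1 : ∫ v, φ v * (F t x v - Mw v)
      = e * (∫ v, φ v * (F r (x - t • v + r • v) v - Mw v)) + ∫ v, φ v * R v := by
    rw [← integral_const_mul, ← integral_add (h2.const_mul e) (by
      refine (h1.sub (h2.const_mul e)).congr (Filter.Eventually.of_forall fun v => ?_)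
      simp only [Pi.sub_apply, hR]; ring)]
    exact integral_congr_ae (Filter.Eventually.of_forall fun v => by simp only [hR]; ring)
  have h3 : |∫ v, φ v * R v| ≤ (N + K) * L * q := by
    have hc0 : 0 ≤ (N + K) * L := by positivity
    refine (ENNReal.ofReal_le_ofReal_iff (by positivity)).1 ?_
    rw [← Real.enorm_eq_ofReal_abs]
    refine (enorm_integral_le_lintegral_enorm _).trans ?_
    have hb : ∀ v, ‖φ v * R v‖ₑ ≤ ENNReal.ofReal ((N + K) * L) *
        (ENNReal.ofReal ((1 + ‖v‖) ^ (-(β - 2))) * ∫⁻ s in Set.Ioc r t,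
          ENNReal.ofReal (vdist (F s (x - t • v + s • v)) Mw)) := fun v => by
      have hVi : IntegrableOn (fun s => vdist (F s (x - t • v + s • v)) Mw) (Set.Ioc r t) :=
        integrableOn_Ioc_of_bdd (hF.meas.vdist_along _ v) (B := wInt β * N) fun τ hτ => by
          rw [abs_of_nonneg (vdist_nonneg _ _)]
          exact (hN τ ⟨hτ.1.le, hτ.2⟩ _).vdist_le hβ hNM
      rw [← ofReal_integral_eq_lintegral_ofReal hVi
        (Filter.Eventually.of_forall fun s => vdist_nonneg _ _), Real.enorm_eq_ofReal_abs,
        ← ENNReal.ofReal_mul (by positivity), ← ENNReal.ofReal_mul hc0, abs_mul]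
      refine ENNReal.ofReal_le_ofReal ?_
      have hw : 0 < (1 + ‖v‖) ^ β := by positivity
      have hX : |R v| ≤ (1 + ‖v‖) ^ (-β) *
          ((N + K) * L * ∫ s in Set.Ioc r t, vdist (F s (x - t • v + s • v)) Mw) := by
        rw [Real.rpow_neg (by positivity), inv_mul_eq_div, le_div_iff₀ hw, mul_comm]
        exact hpt v
      have hw2 : (1 + ‖v‖) ^ (-(β - 2)) = (1 + ‖v‖) ^ 2 * (1 + ‖v‖) ^ (-β) := by
        rw [← Real.rpow_natCast, ← Real.rpow_add (by positivity)]; congr 1; push_cast; ring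
      calc _ ≤ _ := mul_le_mul (hφ v) hX (abs_nonneg _) (by positivity)
        _ = _ := by rw [hw2]; ring
    refine (lintegral_mono hb).trans ?_
    rw [lintegral_const_mul' _ _ ENNReal.ofReal_ne_top, ENNReal.ofReal_mul hc0]
    exact mul_le_mul' le_rfl hq
  rw [e1]
  refine (abs_add_le _ _).trans (add_le_add ?_ h3)
  rw [abs_mul, abs_of_pos (Real.exp_pos _)]

end ESBGK

namespace ESBGK

/-! ### Smallness of the moments -/

variable {ν K β M c G N L : ℝ} {F₀ : E3 → E3 → ℝ} {F : ℝ → E3 → E3 → ℝ}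

theorem Adm.abs_moment_sub_le {f g : E3 → ℝ} (hβ : 5 < β) (hf : Adm β N f) (hg : Adm β N g)
    {φ : E3 → ℝ} (hφ : ∀ v, |φ v| ≤ (1 + ‖v‖) ^ 2) :
    |∫ v, φ v * (f v - g v)| ≤ wInt β * N := by
  refine le_trans ?_ (hf.vdist_le hβ hg)
  rw [← Real.norm_eq_abs]
  refine norm_integral_le_of_norm_le (hf.integrable_vdist hβ hg)
    (Filter.Eventually.of_forall fun v => ?_)
  rw [Real.norm_eq_abs, abs_mul]
  exact mul_le_mul_of_nonneg_right (hφ v) (abs_nonneg _)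

theorem exists_length (X : ℝ) {a η : ℝ} (ha : 0 < a) (hη : 0 < η) (hX : 0 ≤ X) :
    ∃ l, 0 < l ∧ Real.exp (-(a * l)) * X ≤ η := by
  refine ⟨(X / η + 1) / a, by positivity, ?_⟩
  have h1 := Real.add_one_le_exp (X / η + 1)
  rw [mul_div_cancel₀ _ ha.ne', Real.exp_neg, inv_mul_eq_div, div_le_iff₀ (Real.exp_pos _)]
  have h2 : X = η * (X / η) := by field_simp
  nlinarith [Real.exp_pos (X / η + 1)]

theorem exists_small_parameter (X : ℝ) {η : ℝ} (hη : 0 < η) (hX : 0 ≤ X) :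
    ∃ l, 0 < l ∧ X * l ≤ η :=
  ⟨η / (X + 1), by positivity, by
    rw [mul_div_assoc', div_le_iff₀ (by positivity)]; nlinarith⟩

theorem exists_moment_small (hβ : 7 < β) (hν1 : -(1 / 2 : ℝ) < ν) (hν2 : ν < 1)
    (hK : 1 / (1 - ν) ≤ K) (hNM : Adm β N Mw) :
    ∃ ε, 0 < ε ∧ ∀ {M c G : ℝ} {F₀ : E3 → E3 → ℝ} {F : ℝ → E3 → E3 → ℝ}, GainBound β ν G →
      Traj β M (K * G) K F₀ F → (∀ t x v, mildStep ν K F₀ F t x v = F t x v) →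
      Data β M c F₀ → 0 ≤ G → 0 < c → ∀ {t : ℝ}, 0 ≤ t →
      (∀ s ∈ Set.Icc 0 t, ∀ y, Adm β N (F s y)) →
      (∀ s ∈ Set.Icc 0 t, totEnt (F s) ≤ ENNReal.ofReal ε) →
      ∀ x, ∀ φ : E3 → ℝ, Measurable φ → (∀ v, |φ v| ≤ (1 + ‖v‖) ^ 2) →
      Real.exp (-t / (1 - ν)) * |∫ v, φ v * (F₀ (x - t • v) v - Mw v)| ≤ ε →
      |∫ v, φ v * (F t x v - Mw v)| ≤ 1 / 8 := by
  have hν : 0 < 1 - ν := by linarith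
  have ha : 0 < 1 / (1 - ν) := by positivity
  have hK0 : 0 ≤ K := ha.le.trans hK
  have hNn := hNM.N_nonneg
  have hw0 := wInt_nonneg β
  have hη : (0 : ℝ) < 1 / 64 := by norm_num
  obtain ⟨L, hL0, hL⟩ := exists_lipschitz_Mw (by linarith : 5 < β) hν1 hν2 N
  set P := (N + K) * L with hP
  have hP0 : 0 ≤ P := by positivity
  obtain ⟨T, hT0, hT⟩ := exists_length (wInt β * N) ha hη (by positivity)
  obtain ⟨l, hl0, hl⟩ := exists_small_parameter (P * (wInt β * (wInt β * N))) hη (by positivity)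
  obtain ⟨κ, hκ0, hκ⟩ := exists_small_parameter (P * wInt β * T) hη (by positivity)
  obtain ⟨Q, hQ0, hQ⟩ := exists_vdist_le_hent (by linarith : 6 < β) N hκ0
  obtain ⟨ε, hε0, hε⟩ := exists_small_parameter (P * (Q * (l ^ 3)⁻¹) * T) hη (by positivity)
  refine ⟨min ε (1 / 64), by positivity, ?_⟩
  intro M c G F₀ F hG hF hfix h hG0 hc t ht hN hE x φ hφm hφ hgap
  set r := max 0 (t - T) with hr
  have hr0 : 0 ≤ r := le_max_left _ _
  have hrt : r ≤ t := max_le ht (by linarith)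
  have htr : t - r ≤ T := by linarith [le_max_right 0 (t - T)]
  have htr0 : 0 ≤ t - r := by linarith
  have hN' : ∀ s ∈ Set.Icc r t, ∀ y, Adm β N (F s y) := fun s hs => hN s ⟨hr0.trans hs.1, hs.2⟩
  have hIoc : ∀ s ∈ Set.Ioc r t, s ∈ Set.Icc 0 t := fun s hs => ⟨hr0.trans hs.1.le, hs.2⟩
  have hq := lintegral_rays_le (β := β) (by linarith)
    (k := fun s y => ENNReal.ofReal (vdist (F s y) Mw))
    (h := fun s y => ∫⁻ v, ENNReal.ofReal (hent (Mw v) (F s y v)))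
    hF.meas.vdist.ennreal_ofReal hrt (D := wInt β * N) (by positivity) hκ0.le hQ0 hε0.le hl0
    (fun s hs y => ENNReal.ofReal_le_ofReal ((hN s (hIoc s hs) y).vdist_le (by linarith) hNM))
    (fun s hs => (measurable_ofReal_hent measurable_snd (hF.meas.slice s)).lintegral_prod_right')
    (fun s hs y => hQ _ (hN s (hIoc s hs) y))
    (fun s hs => by
      rw [← totEnt_eq_lintegral_lintegral (hF.meas.slice s)]
      exact (hE s (hIoc s hs)).trans (ENNReal.ofReal_le_ofReal (min_le_left _ _))) x
  have hmain := hF.abs_moment_le hG hfix h (by linarith) hν1 hν2 hK hG0 hc hr0 hrt hN' hNM hL0 hL x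
    hq (by positivity) hφm hφ
  have hsmall : (N + K) * L * (wInt β * (wInt β * N) * l +
      (κ * wInt β + Q * (l ^ 3)⁻¹ * ε) * (t - r)) ≤ 3 / 64 := by
    rw [← hP]
    have h1 : P * wInt β * (t - r) * κ ≤ P * wInt β * T * κ := by gcongr
    have h2 : P * (Q * (l ^ 3)⁻¹) * (t - r) * ε ≤ P * (Q * (l ^ 3)⁻¹) * T * ε := by gcongr
    calc _ = P * (wInt β * (wInt β * N)) * l + P * wInt β * (t - r) * κ
          + P * (Q * (l ^ 3)⁻¹) * (t - r) * ε := by ring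
      _ ≤ _ := by linarith
  have hfirst : Real.exp (-(1 / (1 - ν) * (t - r))) *
      |∫ v, φ v * (F r (x - t • v + r • v) v - Mw v)| ≤ 1 / 64 := by
    rcases le_total t T with htT | hTt
    · have hr' : r = 0 := max_eq_left (by linarith)
      have hF0 : ∀ y v, F 0 y v = F₀ y v := fun y v => by
        rw [← hfix, mildStep_of_nonpos F le_rfl, zero_smul, sub_zero]
      simp only [hr', zero_smul, add_zero, hF0, sub_zero]
      refine le_trans (le_of_eq ?_) (hgap.trans (min_le_right _ _))
      congr 2; ring
    · have hr' : t - r = T := by rw [hr, max_eq_right (by linarith)]; ring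
      rw [hr']
      refine le_trans (mul_le_mul_of_nonneg_left ?_ (Real.exp_pos _).le) hT
      refine Adm.abs_moment_sub_le (by linarith) ?_ hNM hφ
      refine ⟨?_, fun v => (hN' r ⟨le_rfl, hrt⟩ _).nonneg v, fun v => (hN' r ⟨le_rfl, hrt⟩ _).le v⟩
      exact (hF.meas.slice r).comp (f := fun v : E3 => (x - t • v + r • v, v)) (by fun_prop)
  linarith

end ESBGK

namespace ESBGK

/-! ### Uniform bounds and global existence for the truncated equation -/

variable {ν K β M c G N L : ℝ} {F₀ : E3 → E3 → ℝ} {F : ℝ → E3 → E3 → ℝ}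

theorem norm_sq_le_weight (v : E3) : |‖v‖ ^ 2| ≤ (1 + ‖v‖) ^ 2 := by
  rw [abs_of_nonneg (by positivity)]
  nlinarith [norm_nonneg v]

theorem coord_le_weight (v : E3) (i : Fin 3) : |v i| ≤ (1 + ‖v‖) ^ 2 := by
  nlinarith [norm_nonneg v, abs_coord_le v i]

theorem one_le_weight (v : E3) : |(1 : ℝ)| ≤ (1 + ‖v‖) ^ 2 := by
  rw [abs_one]
  nlinarith [norm_nonneg v]

/-- The hypothesis that the first, second and trace moments of `g - μ` are at most `δ`. -/
def MomentsLe (δ : ℝ) (g : E3 → ℝ) : Prop :=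
  |∫ v, (g v - Mw v)| ≤ δ ∧ (∀ i, |∫ v, v i * (g v - Mw v)| ≤ δ) ∧
    |∫ v, ‖v‖ ^ 2 * (g v - Mw v)| ≤ δ

theorem exists_momentsLe (hβ : 7 < β) (hν1 : -(1 / 2 : ℝ) < ν) (hν2 : ν < 1)
    (hK : 1 / (1 - ν) ≤ K) (hNM : Adm β N Mw) :
    ∃ ε, 0 < ε ∧ ∀ {M c G : ℝ} {F₀ : E3 → E3 → ℝ} {F : ℝ → E3 → E3 → ℝ}, GainBound β ν G →
      Traj β M (K * G) K F₀ F → (∀ t x v, mildStep ν K F₀ F t x v = F t x v) →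
      Data β M c F₀ → 0 ≤ G → 0 < c → ∀ {t : ℝ}, 0 ≤ t →
      (∀ s ∈ Set.Icc 0 t, ∀ y, Adm β N (F s y)) →
      (∀ s ∈ Set.Icc 0 t, totEnt (F s) ≤ ENNReal.ofReal ε) →
      ∀ x, Real.exp (-t / (1 - ν)) * momentGap (fun v => F₀ (x - t • v) v) ≤ ε →
      MomentsLe (1 / 8) (F t x) := by
  obtain ⟨ε, hε, H⟩ := exists_moment_small hβ hν1 hν2 hK hNM
  refine ⟨ε, hε, ?_⟩
  intro M c G F₀ F hG hF hfix h hG0 hc t ht hN hE x hgap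
  have H' := H hG hF hfix h hG0 hc ht hN hE x
  obtain ⟨g1, g2, g3⟩ := abs_integral_le_momentGap fun v => F₀ (x - t • v) v
  have hle : ∀ {z}, z ≤ momentGap (fun v => F₀ (x - t • v) v) →
      Real.exp (-t / (1 - ν)) * z ≤ ε := fun hz =>
    (mul_le_mul_of_nonneg_left hz (Real.exp_pos _).le).trans hgap
  refine ⟨?_, fun i => H' _ (measurable_coord i) (fun v => coord_le_weight v i) (hle (g2 i)),
    H' _ (by fun_prop) norm_sq_le_weight (hle g3)⟩
  have := H' (fun _ => 1) measurable_const one_le_weight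
  simp only [one_mul] at this
  exact this (hle g1)

theorem exists_truncated_solution (hβ : 7 < β) (hν1 : -(1 / 2 : ℝ) < ν) (hν2 : ν < 1) (hc : 0 < c)
    (hM : 0 < M) (hG : GainBound β ν G) (hG1 : 1 ≤ G) :
    ∃ ε N C₁ : ℝ, 0 < ε ∧ 0 < N ∧ 1 ≤ C₁ ∧ ∀ F₀, Data β M c F₀ → 0 ≤ entE F₀ →
      totEnt F₀ = ENNReal.ofReal (entE F₀) →
      (∀ t : ℝ, (C₁ * M)⁻¹ ≤ t → ∀ x : E3,
        entE F₀ + Real.exp (-t / (1 - ν)) * momentGap (fun v => F₀ (x - t • v) v) ≤ ε) →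
      ∃ F, Traj β M (G * N * G) (G * N) F₀ F ∧
        (∀ t x v, mildStep ν (G * N) F₀ F t x v = F t x v) ∧
        ContinuousOn (fun t => wSup β (F t)) (Set.Ici 0) ∧
        ∀ t, 0 ≤ t → wSup β (F t) ≤ N := by
  have hν : 0 < 1 - ν := by linarith
  have hG0 : 0 ≤ G := by linarith
  have hβ5 : 5 < β := by linarith
  obtain ⟨NM, hNM⟩ := exists_adm_Mw (β := β) (by linarith)
  obtain ⟨Cs, hCs0, hCs⟩ := exists_aGauss_le_of_moments hβ5 hν1 hν2
  set N₁ := max (2 * M) (max Cs NM) with hN₁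
  have h1 : 2 * M ≤ N₁ := le_max_left _ _
  have h2 : Cs ≤ N₁ := (le_max_left _ _).trans (le_max_right _ _)
  have h3 : NM ≤ N₁ := (le_max_right _ _).trans (le_max_right _ _)
  set N := N₁ + 1 with hNdef
  have hN0 : 0 < N := by linarith
  have hNM' : Adm β N Mw := hNM.mono (by linarith)
  set K := G * N with hKdef
  have hK0 : 0 < K := by positivity
  have hK : 1 / (1 - ν) ≤ K := by
    rw [← collFreq_Mw]
    exact (hG hNM' (by rw [dens_Mw]; exact one_pos)).1
  obtain ⟨ε, hε, H⟩ := exists_momentsLe hβ hν1 hν2 hK hNM'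
  set t₁ := Real.log 2 / (K * G) with ht₁
  have hKG : 0 < K * G := by positivity
  have ht₁0 : 0 < t₁ := div_pos (Real.log_pos one_lt_two) hKG
  refine ⟨ε, N, max 1 (t₁ * M)⁻¹, hε, hN0, le_max_left _ _, fun F₀ h hE0 hE hgap => ?_⟩
  have hgap' : ∀ t, t₁ ≤ t → ∀ x : E3,
      entE F₀ + Real.exp (-t / (1 - ν)) * momentGap (fun v => F₀ (x - t • v) v) ≤ ε := by
    refine fun t ht => hgap t (le_trans ?_ ht)
    refine inv_le_of_inv_le₀ ht₁0 ?_
    calc t₁⁻¹ = (t₁ * M)⁻¹ * M := by field_simp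
      _ ≤ _ := mul_le_mul_of_nonneg_right (le_max_right _ _) hM.le
  obtain ⟨F, hF, hfix, hlim⟩ := exists_fixed_point h hG hβ5 hc hν1 hν2 hK0.le hG0
  have hcont := hF.continuousOn_wSup hG hfix h hβ5 hν1 hν2 hK0.le hG1 hc
  refine ⟨F, hF, hfix, hcont, ?_⟩
  have hent : ∀ s, 0 ≤ s → totEnt (F s) ≤ ENNReal.ofReal ε := fun s hs => by
    refine (totEnt_le h hG hβ5 hc hν1 hν2 hK0.le hG0 hF hfix hlim
      (by rw [hE]; exact ENNReal.ofReal_ne_top) hs).trans ?_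
    rw [hE]
    refine ENNReal.ofReal_le_ofReal ?_
    have := hgap' t₁ le_rfl 0
    have := mul_nonneg (Real.exp_pos (-t₁ / (1 - ν))).le
      (momentGap_nonneg fun v => F₀ (0 - t₁ • v) v)
    linarith
  have hshort : ∀ t, 0 ≤ t → t ≤ t₁ → ∀ x v, (1 + ‖v‖) ^ β * F t x v ≤ 2 * M := by
    intro t ht htt x v
    refine (hF.upper t ht x v).trans ?_
    have he : Real.exp (K * G * t) ≤ 2 := by
      rw [← Real.exp_log two_pos]
      refine Real.exp_le_exp.2 ?_
      calc K * G * t ≤ K * G * t₁ := by gcongr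
        _ = Real.log 2 := mul_div_cancel₀ _ hKG.ne'
    nlinarith
  have hboot := forall_le_of_bootstrap hcont (a := N₁) (b := N) (by linarith)
    (wSup_le fun x v => (hshort 0 le_rfl ht₁0.le x v).trans h1) fun t ht hs => by
      have hadm : ∀ s ∈ Set.Icc 0 t, ∀ y, Adm β N (F s y) := fun s hs' y =>
        ⟨(hF.adm h hs'.1 y).meas, (hF.adm h hs'.1 y).nonneg, fun v =>
          (le_wSup (hF.wBdd hs'.1) y v).trans (hs s hs')⟩
      rcases le_total t t₁ with htt | htt
      · exact wSup_le fun x v => (hshort t ht htt x v).trans h1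
      refine wSup_le fun x v => ?_
      have hw : 0 < (1 + ‖v‖) ^ β := by positivity
      have hmem := hF.gainOn_mem hG h hβ5 hν1 hν2 hK0.le hG0 hc (x - t • v) v t
      have e := hF.semigroup hG hfix h hβ5 hν1 hν2 hK0.le hG0 hc ht₁0.le htt (x - t • v) v
      rw [sub_add_cancel] at e
      rw [e, mul_comm, ← le_div_iff₀ hw]
      refine duh_le_const (hF.meas.freq ν hK0.le _ v) (hF.meas.measurable_gainOn ν _ v)
        (B := ((1 + ‖v‖) ^ β)⁻¹ * (G * (M * Real.exp (K * G * t))))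
        (fun τ hτ => ?_) htt ?_ fun τ hτ => ?_
      · have := hmem τ ⟨ht₁0.trans hτ.1, hτ.2⟩
        rw [abs_of_nonneg this.1]; exact this.2
      · rw [le_div_iff₀ hw, mul_comm]
        exact (hshort t₁ ht₁0.le le_rfl _ v).trans h1
      · have hτ0 : 0 ≤ τ := ht₁0.le.trans hτ.1.le
        have hm := H hG hF hfix h hG0 hc hτ0 (fun s hs' => hadm s ⟨hs'.1, hs'.2.trans hτ.2⟩)
          (fun s hs' => hent s hs'.1) (x - t • v + τ • v)
          (by linarith [hgap' τ hτ.1.le (x - t • v + τ • v)])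
        rw [gainOn, le_div_iff₀ hw, mul_comm]
        exact ((hCs _ ((hadm τ ⟨hτ0, hτ.2⟩ _).kin hβ5) hm.1 hm.2.1 hm.2.2).2 v).trans h2
  exact fun t ht => (hboot t ht).trans (by linarith)

end ESBGK

namespace ESBGK

/-! ### From the truncated equation to mild solutions -/

variable {ν K β M c G N C : ℝ} {F₀ : E3 → E3 → ℝ} {F : ℝ → E3 → E3 → ℝ}

theorem sub_smul_sub_smul (x v : E3) (t τ : ℝ) : x - (t - τ) • v = x - t • v + τ • v := by
  rw [sub_smul]; abel

theorem Kin.collFreq_nonneg {g : E3 → ℝ} (h : Kin g) (hρ : 0 < dens g) (hν2 : ν < 1) :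
    0 ≤ collFreq g ν :=
  div_nonneg (mul_nonneg hρ.le (h.temp_pos hρ).le) (by linarith)

theorem freqOn_eq {y v : E3} {τ : ℝ} (h0 : 0 ≤ collFreq (F τ (y + τ • v)) ν)
    (hK : collFreq (F τ (y + τ • v)) ν ≤ K) :
    freqOn ν K F y v τ = collFreq (F τ (y + τ • v)) ν := by
  rw [freqOn, min_eq_left hK, max_eq_right h0]

theorem mildStep_eq {t : ℝ} (ht : 0 ≤ t) (x v : E3)
    (h : ∀ τ ∈ Set.Ioc 0 t, ∀ y, 0 ≤ collFreq (F τ y) ν ∧ collFreq (F τ y) ν ≤ K) :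
    mildStep ν K F₀ F t x v = F₀ (x - t • v) v *
        Real.exp (-(∫ τ in (0 : ℝ)..t, collFreq (F τ (x - (t - τ) • v)) ν))
      + ∫ s in (0 : ℝ)..t,
          Real.exp (-(∫ τ in s..t, collFreq (F τ (x - (t - τ) • v)) ν)) *
            collFreq (F s (x - (t - s) • v)) ν * aGauss (F s (x - (t - s) • v)) ν v := by
  have he : ∀ s, 0 ≤ s → s ≤ t → Real.exp (-(∫ τ in s..t, collFreq (F τ (x - (t - τ) • v)) ν))
      = expI (freqOn ν K F (x - t • v) v) s t := fun s hs hst => by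
    rw [expI, intervalIntegral.integral_of_le hst]
    congr 2
    refine setIntegral_congr_fun measurableSet_Ioc fun τ hτ => ?_
    have := h τ ⟨hs.trans_lt hτ.1, hτ.2⟩ (x - t • v + τ • v)
    simp only [sub_smul_sub_smul]
    rw [freqOn_eq this.1 this.2]
  rw [mildStep, duh, he 0 le_rfl ht, intervalIntegral.integral_of_le ht]
  congr 1
  refine setIntegral_congr_fun measurableSet_Ioc fun s hs => ?_
  have := h s hs (x - t • v + s • v)
  rw [he s hs.1.le hs.2, sub_smul_sub_smul, freqOn_eq this.1 this.2, gainOn]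

theorem Traj.isMildSolution (hG : GainBound β ν G) (hF : Traj β M C (G * N) F₀ F)
    (hfix : ∀ t x v, ESBGK.mildStep ν (G * N) F₀ F t x v = F t x v) (h : Data β M c F₀)
    (hβ : 5 < β) (hν2 : ν < 1) (hc : 0 < c)
    (hcont : ContinuousOn (fun t => wSup β (F t)) (Set.Ici 0))
    (hN : ∀ t, 0 ≤ t → wSup β (F t) ≤ N) : IsMildSolution ν β F₀ F := by
  have hadm : ∀ t, 0 ≤ t → ∀ x, Adm β N (F t x) := fun t ht x =>
    ⟨(hF.adm h ht x).meas, (hF.adm h ht x).nonneg, fun v =>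
      (le_wSup (hF.wBdd ht) x v).trans (hN t ht)⟩
  have hd : ∀ t, 0 ≤ t → ∀ x, 0 < dens (F t x) := fun t ht x => hF.dens_pos h hβ hc ht x
  have hk : ∀ t, 0 ≤ t → ∀ x, Kin (F t x) := fun t ht x => (hadm t ht x).kin hβ
  exact
    { nonneg := fun t ht x => (hadm t ht x).nonneg
      meas := fun t _ => hF.meas.slice t
      integrable := fun t ht x => (hk t ht x).integrable
      moment2 := fun t ht x => (hk t ht x).integrable_norm_sq
      dens_pos := hd
      temp_pos := fun t ht x => (hk t ht x).temp_pos (hd t ht x)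
      wnorm_bdd := fun t ht => hF.wBdd ht
      wnorm_cont := hcont
      mild := fun t ht x v => by
        rw [← hfix t x v]
        exact mildStep_eq ht x v fun τ hτ y =>
          ⟨(hk τ hτ.1.le y).collFreq_nonneg (hd τ hτ.1.le y) hν2,
            (hG (hadm τ hτ.1.le y) (hd τ hτ.1.le y)).1⟩ }

end ESBGK

namespace ESBGK

/-! ### Left continuity of Duhamel's formula without measurability -/

variable {a m p : ℝ → ℝ} {K B r t y : ℝ} {u : ℕ → ℝ}

theorem integrableOn_of_integrableOn_mul {e : ℝ → ℝ} {S : Set ℝ} (hS : MeasurableSet S)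
    (hfin : volume S ≠ ⊤) (hB : ∀ s ∈ S, |p s| ≤ B) (he : Measurable e) (hpos : ∀ s, 0 < e s)
    (h : IntegrableOn (fun s => e s * p s) S) : IntegrableOn p S := by
  have h1 : AEStronglyMeasurable p (volume.restrict S) := by
    refine (he.inv.aestronglyMeasurable.mul h.aestronglyMeasurable).congr
      (Filter.Eventually.of_forall fun s => ?_)
    have := (hpos s).ne'
    simp only [Pi.mul_apply, Pi.inv_apply]
    field_simp
  have : IsFiniteMeasure (volume.restrict S) := ⟨by
    rw [Measure.restrict_apply_univ]; exact hfin.lt_top⟩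
  exact Integrable.of_bound h1 B ((ae_restrict_iff' hS).2 (Filter.Eventually.of_forall hB))

theorem eventually_not_integrableOn (hB : ∀ s ∈ Set.Ioo r t, |p s| ≤ B) (hu : ∀ n, u n < t)
    (hlim : Filter.Tendsto u Filter.atTop (nhds t)) (hp : ¬IntegrableOn p (Set.Ioo r t)) :
    ∀ᶠ n in Filter.atTop, ¬IntegrableOn p (Set.Ioc r (u n)) := by
  by_contra hcon
  rw [Filter.not_eventually] at hcon
  simp only [not_not] at hcon
  refine hp ?_
  set S := {n | IntegrableOn p (Set.Ioc r (u n))} with hS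
  have hU : Set.Ioo r t = ⋃ n : S, Set.Ioc r (u n) := by
    ext s
    simp only [Set.mem_Ioo, Set.mem_iUnion, Set.mem_Ioc, Subtype.exists, exists_prop]
    constructor
    · rintro ⟨h1, h2⟩
      obtain ⟨n, hn, hsn⟩ := (hcon.and_eventually (hlim.eventually (lt_mem_nhds h2))).exists
      exact ⟨n, hn, h1, hsn.le⟩
    · rintro ⟨n, -, h1, h2⟩
      exact ⟨h1, h2.trans_lt (hu n)⟩
  have hm : AEStronglyMeasurable p (volume.restrict (Set.Ioo r t)) := by
    rw [hU, aestronglyMeasurable_iUnion_iff]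
    exact fun n => n.2.aestronglyMeasurable
  exact Integrable.of_bound hm B
    ((ae_restrict_iff' measurableSet_Ioo).2 (Filter.Eventually.of_forall hB))

theorem tendsto_setIntegral_left {e : ℕ → ℝ → ℝ} {e' : ℝ → ℝ}
    (hB : ∀ s ∈ Set.Ioo r t, |p s| ≤ B) (hu : ∀ n, u n < t)
    (hlim : Filter.Tendsto u Filter.atTop (nhds t)) (he : ∀ n, Measurable (e n))
    (he' : Measurable e') (hpos : ∀ n s, 0 < e n s) (hpos' : ∀ s, 0 < e' s)
    (hle : ∀ n s, e n s ≤ 1)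
    (hee : ∀ s ∈ Set.Ioo r t, Filter.Tendsto (fun n => e n s) Filter.atTop (nhds (e' s))) :
    Filter.Tendsto (fun n => ∫ s in Set.Ioc r (u n), e n s * p s) Filter.atTop
      (nhds (∫ s in Set.Ioc r t, e' s * p s)) := by
  rw [integral_Ioc_eq_integral_Ioo]
  have hsub : ∀ n, Set.Ioc r (u n) ⊆ Set.Ioo r t := fun n s hs => ⟨hs.1, hs.2.trans_lt (hu n)⟩
  by_cases hp : IntegrableOn p (Set.Ioo r t)
  · have e1 : ∀ n, ∫ s in Set.Ioc r (u n), e n s * p s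
        = ∫ s in Set.Ioo r t, (Set.Ioc r (u n)).indicator (fun s => e n s * p s) s := fun n => by
      rw [setIntegral_indicator measurableSet_Ioc, Set.inter_eq_right.2 (hsub n)]
    simp only [e1]
    refine tendsto_integral_of_dominated_convergence (fun s => |p s|) (fun n => ?_) hp.abs
      (fun n => ?_) ((ae_restrict_iff' measurableSet_Ioo).2 (Filter.Eventually.of_forall ?_))
    · exact ((he n).aestronglyMeasurable.mul hp.aestronglyMeasurable).indicator measurableSet_Ioc
    · refine Filter.Eventually.of_forall fun s => ?_
      rw [Set.indicator_apply]
      split_ifs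
      · rw [Real.norm_eq_abs, abs_mul, abs_of_pos (hpos n s)]
        exact mul_le_of_le_one_left (abs_nonneg _) (hle n s)
      · rw [norm_zero]; exact abs_nonneg _
    · intro s hs
      refine ((hee s hs).mul_const (p s)).congr' ?_
      filter_upwards [hlim.eventually (lt_mem_nhds hs.2)] with n hn
      rw [Set.indicator_of_mem (show s ∈ Set.Ioc r (u n) from ⟨hs.1, hn.le⟩)]
  · rw [integral_undef fun hi => hp (integrableOn_of_integrableOn_mul measurableSet_Ioo
      (by simp) hB he' hpos' hi)]
    refine tendsto_const_nhds.congr' ?_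
    filter_upwards [eventually_not_integrableOn hB hu hlim hp] with n hn
    rw [integral_undef fun hi => hn (integrableOn_of_integrableOn_mul measurableSet_Ioc
      (by simp) (fun s hs => hB s (hsub n hs)) (he n) (hpos n) hi)]

theorem expI_le_one_of_nonneg (ha : ∀ s, 0 ≤ a s) (s t : ℝ) : expI a s t ≤ 1 :=
  Real.exp_le_one_iff.2 (neg_nonpos.2 (integral_nonneg ha))

theorem measurable_expI_of_nonneg (ha : ∀ s, 0 ≤ a s) (t : ℝ) : Measurable fun s => expI a s t := by
  classical
  set S := {s | IntegrableOn a (Set.Ioc s t)} with hS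
  have hup : IsUpperSet S := fun s s' hs h => h.mono_set (Set.Ioc_subset_Ioc_left hs)
  have hmono : Monotone fun s => if s ∈ S then expI a s t else 0 := by
    intro s s' hs
    by_cases h : s ∈ S
    · have h' : s' ∈ S := hup hs h
      simp only [h, h', if_true]
      refine Real.exp_le_exp.2 (neg_le_neg ?_)
      exact setIntegral_mono_set h (Filter.Eventually.of_forall ha)
        (Set.Ioc_subset_Ioc_left hs).eventuallyLE
    · simp only [h, if_false]
      split_ifs
      · exact (Real.exp_pos _).le
      · exact le_rfl
  have : (fun s => expI a s t) = fun s => if s ∈ S then (if s ∈ S then expI a s t else 0) else 1 := by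
    funext s
    by_cases h : s ∈ S
    · simp [h]
    · simp only [h, if_false]
      rw [expI, integral_undef h, neg_zero, Real.exp_zero]
  rw [this]
  exact Measurable.ite hup.ordConnected.measurableSet hmono.measurable measurable_const

theorem tendsto_expI_left (h0 : ∀ s, 0 ≤ a s) (hK : ∀ s, a s ≤ K) (hu : ∀ n, u n < t)
    (hlim : Filter.Tendsto u Filter.atTop (nhds t)) (r : ℝ) :
    Filter.Tendsto (fun n => expI a r (u n)) Filter.atTop (nhds (expI a r t)) := by
  have := tendsto_setIntegral_left (p := a) (B := K) (r := r) (e := fun _ _ => 1) (e' := fun _ => 1)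
    (fun s _ => by rw [abs_of_nonneg (h0 s)]; exact hK s) hu hlim (fun _ => measurable_const)
    measurable_const (fun _ _ => one_pos) (fun _ => one_pos) (fun _ _ => le_rfl)
    fun _ _ => tendsto_const_nhds
  simp only [one_mul] at this
  exact (Real.continuous_exp.tendsto _).comp this.neg

theorem tendsto_duh_left (h0 : ∀ s, 0 ≤ a s) (hK : ∀ s, a s ≤ K)
    (hB : ∀ s ∈ Set.Ioo r t, |m s| ≤ B) (hu : ∀ n, u n < t)
    (hlim : Filter.Tendsto u Filter.atTop (nhds t)) (y : ℝ) :
    Filter.Tendsto (fun n => duh a m r y (u n)) Filter.atTop (nhds (duh a m r y t)) := by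
  refine ((tendsto_expI_left h0 hK hu hlim r).const_mul y).add ?_
  simp only [mul_assoc]
  refine tendsto_setIntegral_left (p := fun s => a s * m s) (B := K * B) (fun s hs => ?_) hu hlim
    (fun n => measurable_expI_of_nonneg h0 (u n)) (measurable_expI_of_nonneg h0 t)
    (fun n s => Real.exp_pos _) (fun s => Real.exp_pos _)
    (fun n s => expI_le_one_of_nonneg h0 s (u n)) fun s _ => tendsto_expI_left h0 hK hu hlim s
  rw [abs_mul, abs_of_nonneg (h0 s)]
  exact mul_le_mul (hK s) (hB s hs) (abs_nonneg _) ((h0 s).trans (hK s))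

end ESBGK

namespace ESBGK

/-! ### Uniqueness of mild solutions -/

variable {ν K β M c G B T : ℝ} {F₀ : E3 → E3 → ℝ} {F H : ℝ → E3 → E3 → ℝ}

/-- The largest multiple of `1 / (n + 1)` below `t > 0`. -/
noncomputable def gridBelow (n : ℕ) (t : ℝ) : ℝ := (⌈(n + 1) * t⌉₊ - 1 : ℕ) / (n + 1)

theorem gridBelow_nonneg (n : ℕ) (t : ℝ) : 0 ≤ gridBelow n t := by
  rw [gridBelow]; positivity

theorem gridBelow_bounds (n : ℕ) {t : ℝ} (ht : 0 < t) :
    gridBelow n t < t ∧ t - 1 / (n + 1) ≤ gridBelow n t := by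
  have hn : (0 : ℝ) < n + 1 := by positivity
  have h1 : 0 < ⌈(n + 1) * t⌉₊ := Nat.ceil_pos.2 (by positivity)
  have h2 := Nat.ceil_lt_add_one (show 0 ≤ (n + 1) * t by positivity)
  have h3 := Nat.le_ceil ((n + 1) * t)
  have e : ((⌈(n + 1) * t⌉₊ - 1 : ℕ) : ℝ) = ⌈(n + 1) * t⌉₊ - 1 := by
    rw [Nat.cast_sub h1, Nat.cast_one]
  rw [gridBelow, e]
  constructor
  · rw [div_lt_iff₀ hn]; linarith
  · rw [le_div_iff₀ hn, sub_mul, one_div, inv_mul_cancel₀ hn.ne']; linarith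

theorem tendsto_gridBelow {t : ℝ} (ht : 0 < t) :
    Filter.Tendsto (fun n => gridBelow n t) Filter.atTop (nhds t) := by
  have h1 : Filter.Tendsto (fun n : ℕ => t - 1 / ((n : ℝ) + 1)) Filter.atTop (nhds t) := by
    simpa using tendsto_const_nhds.sub (tendsto_one_div_add_atTop_nhds_zero_nat (𝕜 := ℝ))
  exact tendsto_of_tendsto_of_tendsto_of_le_of_le h1 tendsto_const_nhds
    (fun n => (gridBelow_bounds n ht).2) fun n => (gridBelow_bounds n ht).1.le

theorem measurable_gridBelow_along (hH : ∀ t, 0 ≤ t → Measurable fun p : E3 × E3 => H t p.1 p.2)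
    (n : ℕ) : Measurable fun z : ℝ × E3 × E3 =>
      H (gridBelow n z.1) (z.2.1 - z.1 • z.2.2 + gridBelow n z.1 • z.2.2) z.2.2 := by
  have h1 : Measurable fun q : ℕ × E3 × E3 => H ((q.1 : ℝ) / (n + 1)) q.2.1 q.2.2 :=
    measurable_from_prod_countable_right fun k =>
      hH ((k : ℝ) / (n + 1)) (by positivity)
  have h2 : Measurable fun t : ℝ => ⌈((n : ℝ) + 1) * t⌉₊ - 1 :=
    (Measurable.of_discrete (f := fun k : ℕ => k - 1)).comp
      (Nat.measurable_ceil.comp (measurable_const.mul measurable_id))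
  have h3 : Measurable fun t : ℝ => gridBelow n t :=
    ((Measurable.of_discrete (f := fun k : ℕ => (k : ℝ))).comp h2).div_const _
  have h4 : Measurable fun z : ℝ × E3 × E3 =>
      ((⌈((n : ℝ) + 1) * z.1⌉₊ - 1, z.2.1 - z.1 • z.2.2 + gridBelow n z.1 • z.2.2, z.2.2) :
        ℕ × E3 × E3) := by
    refine (h2.comp measurable_fst).prodMk (Measurable.prodMk ?_ (by fun_prop))
    exact (by fun_prop : Measurable fun z : ℝ × E3 × E3 => z.2.1 - z.1 • z.2.2).add
      ((h3.comp measurable_fst).smul (by fun_prop : Measurable fun z : ℝ × E3 × E3 => z.2.2))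
  exact h1.comp h4

theorem aGauss_nonneg {g : E3 → ℝ} (h : 0 ≤ dens g) (v : E3) : 0 ≤ aGauss g ν v :=
  mul_nonneg (div_nonneg h (Real.sqrt_nonneg _)) (Real.exp_pos _).le

theorem _root_.IsMildSolution.adm (hH : IsMildSolution ν β F₀ H) (hB : ∀ t ∈ Set.Icc 0 T, wSup β (H t) ≤ B)
    {t : ℝ} (ht : t ∈ Set.Icc 0 T) (x : E3) : Adm β B (H t x) where
  meas := (hH.meas t ht.1).comp (f := fun v => (x, v)) (by fun_prop)
  nonneg := hH.nonneg t ht.1 x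
  le v := (le_wSup (hH.wnorm_bdd t ht.1) x v).trans (hB t ht)

theorem _root_.IsMildSolution.freq_bounds (hH : IsMildSolution ν β F₀ H) (hG : GainBound β ν G)
    (hβ : 5 < β) (hν2 : ν < 1) (hB : ∀ t ∈ Set.Icc 0 T, wSup β (H t) ≤ B) (hK : G * B ≤ K)
    {t : ℝ} (ht : t ∈ Set.Icc 0 T) (x : E3) :
    0 ≤ collFreq (H t x) ν ∧ collFreq (H t x) ν ≤ K :=
  ⟨((hH.adm hB ht x).kin hβ).collFreq_nonneg (hH.dens_pos t ht.1 x) hν2,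
    (hG (hH.adm hB ht x) (hH.dens_pos t ht.1 x)).1.trans hK⟩

theorem _root_.IsMildSolution.mildStep_eq (hH : IsMildSolution ν β F₀ H) (hG : GainBound β ν G)
    (hβ : 5 < β) (hν2 : ν < 1) (hB : ∀ t ∈ Set.Icc 0 T, wSup β (H t) ≤ B) (hK : G * B ≤ K)
    {t : ℝ} (ht : t ∈ Set.Icc 0 T) (x v : E3) : mildStep ν K F₀ H t x v = H t x v := by
  rw [hH.mild t ht.1]
  exact ESBGK.mildStep_eq ht.1 x v fun τ hτ y =>
    hH.freq_bounds hG hβ hν2 hB hK ⟨hτ.1.le, hτ.2.trans ht.2⟩ y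

theorem _root_.IsMildSolution.along_eq (hH : IsMildSolution ν β F₀ H) (hG : GainBound β ν G)
    (hβ : 5 < β) (hν2 : ν < 1) (hB : ∀ t ∈ Set.Icc 0 T, wSup β (H t) ≤ B) (hK : G * B ≤ K)
    {t : ℝ} (ht : t ∈ Set.Icc 0 T) (y v : E3) :
    H t (y + t • v) v = duh (freqOn ν K H y v) (gainOn ν H y v) 0 (F₀ y v) t := by
  rw [← hH.mildStep_eq hG hβ hν2 hB hK ht, mildStep, add_sub_cancel_right]

theorem _root_.IsMildSolution.abs_gainOn_le (hH : IsMildSolution ν β F₀ H) (hG : GainBound β ν G)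
    (hβ : 5 < β) (hB : ∀ t ∈ Set.Icc 0 T, wSup β (H t) ≤ B)
    {t : ℝ} (ht : t ∈ Set.Icc 0 T) (y v : E3) : |gainOn ν H y v t| ≤ G * B := by
  have h1 := hH.adm hB ht (y + t • v)
  have h2 := (hG h1 (hH.dens_pos t ht.1 _)).2 v
  have h3 : 0 ≤ gainOn ν H y v t :=
    aGauss_nonneg (hH.dens_pos t ht.1 _).le v
  rw [abs_of_nonneg h3]
  have h4 : 1 ≤ (1 + ‖v‖) ^ β :=
    Real.one_le_rpow (le_add_of_nonneg_right (norm_nonneg v)) (by linarith)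
  exact (le_mul_of_one_le_left h3 h4).trans h2

/-- Free transport outside `(0, T]`, and `H` on it. -/
noncomputable def patch (F₀ : E3 → E3 → ℝ) (H : ℝ → E3 → E3 → ℝ) (T t : ℝ) (x v : E3) : ℝ :=
  open Classical in if t ∈ Set.Ioc 0 T then H t x v else F₀ (x - t • v) v

theorem patch_of_mem {t : ℝ} (ht : t ∈ Set.Ioc 0 T) : patch F₀ H T t = H t := by
  funext x v; rw [patch, if_pos ht]

theorem patch_of_not_mem {t : ℝ} (ht : t ∉ Set.Ioc 0 T) (x v : E3) :
    patch F₀ H T t x v = F₀ (x - t • v) v := by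
  rw [patch, if_neg ht]

theorem _root_.IsMildSolution.patch_eq (hH : IsMildSolution ν β F₀ H) {t : ℝ} (ht : t ∈ Set.Icc 0 T)
    (x v : E3) : patch F₀ H T t x v = H t x v := by
  rcases ht.1.eq_or_lt with h | h
  · rw [patch_of_not_mem (by simp [← h]), ← h, hH.mild 0 le_rfl]
    simp
  · rw [patch_of_mem ⟨h, ht.2⟩]

theorem _root_.IsMildSolution.jMeas_patch (hH : IsMildSolution ν β F₀ H) (hG : GainBound β ν G)
    (h : Data β M c F₀) (hβ : 5 < β) (hν2 : ν < 1)
    (hB : ∀ t ∈ Set.Icc 0 T, wSup β (H t) ≤ B) (hK : G * B ≤ K) (hK0 : 0 ≤ K) :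
    JMeas (patch F₀ H T) := by
  classical
  have hF₀ : Measurable fun z : ℝ × E3 × E3 => F₀ (z.2.1 - z.1 • z.2.2) z.2.2 :=
    h.meas.comp (f := fun z : ℝ × E3 × E3 => (z.2.1 - z.1 • z.2.2, z.2.2)) (by fun_prop)
  have hS : MeasurableSet {z : ℝ × E3 × E3 | z.1 ∈ Set.Ioc 0 T} :=
    measurable_fst measurableSet_Ioc
  refine measurable_of_tendsto_metrizable (f := fun n (z : ℝ × E3 × E3) =>
      if z.1 ∈ Set.Ioc 0 T then
        H (gridBelow n z.1) (z.2.1 - z.1 • z.2.2 + gridBelow n z.1 • z.2.2) z.2.2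
      else F₀ (z.2.1 - z.1 • z.2.2) z.2.2)
    (fun n => Measurable.ite hS (measurable_gridBelow_along hH.meas n) hF₀) ?_
  rw [tendsto_pi_nhds]
  rintro ⟨t, x, v⟩
  by_cases ht : t ∈ Set.Ioc 0 T
  · have hlt := fun n => (gridBelow_bounds n ht.1).1
    have hI : ∀ n, gridBelow n t ∈ Set.Icc 0 T := fun n =>
      ⟨gridBelow_nonneg n t, (hlt n).le.trans ht.2⟩
    simp only [ht, if_true, patch_of_mem]
    have e := hH.along_eq hG hβ hν2 hB hK ⟨ht.1.le, ht.2⟩ (x - t • v) v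
    rw [sub_add_cancel] at e
    rw [e]
    simp only [hH.along_eq hG hβ hν2 hB hK (hI _)]
    exact tendsto_duh_left (K := K) (B := G * B) (fun s => le_max_left _ _)
      (fun s => max_le hK0 (min_le_right _ _))
      (fun s hs => hH.abs_gainOn_le hG hβ hB ⟨hs.1.le, hs.2.le.trans ht.2⟩ _ v) hlt
      (tendsto_gridBelow ht.1) _
  · simp only [ht, if_false, patch_of_not_mem ht]
    exact tendsto_const_nhds

theorem _root_.IsMildSolution.lower (hH : IsMildSolution ν β F₀ H) (hG : GainBound β ν G)
    (h : Data β M c F₀) (hβ : 5 < β) (hν2 : ν < 1)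
    (hB : ∀ t ∈ Set.Icc 0 T, wSup β (H t) ≤ B) (hK : G * B ≤ K)
    {t : ℝ} (ht : t ∈ Set.Icc 0 T) (x v : E3) :
    F₀ (x - t • v) v * Real.exp (-(K * t)) ≤ H t x v := by
  have hf := fun τ (hτ : τ ∈ Set.Ioc 0 t) y =>
    hH.freq_bounds hG hβ hν2 hB hK (t := τ) ⟨hτ.1.le, hτ.2.trans ht.2⟩ y
  rw [hH.mild t ht.1, intervalIntegral.integral_of_le ht.1, intervalIntegral.integral_of_le ht.1]
  have h1 : 0 ≤ ∫ s in Set.Ioc 0 t,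
      Real.exp (-(∫ τ in s..t, collFreq (H τ (x - (t - τ) • v)) ν)) *
        collFreq (H s (x - (t - s) • v)) ν * aGauss (H s (x - (t - s) • v)) ν v :=
    setIntegral_nonneg measurableSet_Ioc fun s hs =>
      mul_nonneg (mul_nonneg (Real.exp_pos _).le (hf s hs _).1)
        (aGauss_nonneg (hH.dens_pos s hs.1.le _).le v)
  have h2 : ∫ τ in Set.Ioc 0 t, collFreq (H τ (x - (t - τ) • v)) ν ≤ K * t := by
    have := norm_setIntegral_le_of_norm_le_const (μ := volume) (s := Set.Ioc 0 t) (C := K)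
      (f := fun τ => collFreq (H τ (x - (t - τ) • v)) ν) (by simp) fun τ hτ => by
        rw [Real.norm_eq_abs, abs_of_nonneg (hf τ hτ _).1]; exact (hf τ hτ _).2
    rw [Real.volume_real_Ioc_of_le ht.1, sub_zero] at this
    exact (le_abs_self _).trans this
  have h3 := mul_le_mul_of_nonneg_left (Real.exp_le_exp.2 (neg_le_neg h2)) (h.nonneg (x - t • v) v)
  linarith

theorem _root_.IsMildSolution.traj_patch (hH : IsMildSolution ν β F₀ H) (hG : GainBound β ν G)
    (h : Data β B c F₀) (hβ : 5 < β) (hν2 : ν < 1)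
    (hB : ∀ t ∈ Set.Icc 0 T, wSup β (H t) ≤ B) (hK : G * B ≤ K) (hK0 : 0 ≤ K) :
    Traj β B 0 K F₀ (patch F₀ H T) where
  meas := hH.jMeas_patch hG h hβ hν2 hB hK hK0
  lower t ht x v := by
    by_cases hm : t ∈ Set.Ioc 0 T
    · rw [patch_of_mem hm]
      exact hH.lower hG h hβ hν2 hB hK ⟨ht, hm.2⟩ x v
    · rw [patch_of_not_mem hm]
      exact (h.traj_transport le_rfl hK0).lower t ht x v
  upper t ht x v := by
    by_cases hm : t ∈ Set.Ioc 0 T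
    · rw [patch_of_mem hm, zero_mul, Real.exp_zero, mul_one]
      exact (hH.adm hB ⟨ht, hm.2⟩ x).le v
    · rw [patch_of_not_mem hm]
      exact (h.traj_transport le_rfl hK0).upper t ht x v

theorem _root_.IsMildSolution.mildStep_patch (hH : IsMildSolution ν β F₀ H) (hG : GainBound β ν G)
    (hβ : 5 < β) (hν2 : ν < 1) (hB : ∀ t ∈ Set.Icc 0 T, wSup β (H t) ≤ B) (hK : G * B ≤ K)
    {t : ℝ} (ht : t ∈ Set.Icc 0 T) (x v : E3) :
    mildStep ν K F₀ (patch F₀ H T) t x v = patch F₀ H T t x v := by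
  have hp : ∀ τ ∈ Set.Ioc 0 t, patch F₀ H T τ = H τ := fun τ hτ =>
    patch_of_mem ⟨hτ.1, hτ.2.trans ht.2⟩
  rw [hH.patch_eq ht, ← hH.mildStep_eq hG hβ hν2 hB hK ht]
  have hf : ∀ τ ∈ Set.Ioc 0 t, ∀ y, 0 ≤ collFreq (H τ y) ν ∧ collFreq (H τ y) ν ≤ K :=
    fun τ hτ y => hH.freq_bounds hG hβ hν2 hB hK ⟨hτ.1.le, hτ.2.trans ht.2⟩ y
  simp only [mildStep, duh, expI]
  congr 1
  · congr 3
    exact setIntegral_congr_fun measurableSet_Ioc fun τ hτ => by simp only [freqOn, hp τ hτ]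
  · refine setIntegral_congr_fun measurableSet_Ioc fun s hs => ?_
    simp only [freqOn, gainOn, hp s hs]
    congr 4
    exact setIntegral_congr_fun measurableSet_Ioc fun τ hτ => by
      simp only [hp τ ⟨hs.1.trans hτ.1, hτ.2⟩]

theorem _root_.IsMildSolution.exists_wSup_le (hH : IsMildSolution ν β F₀ H) (T : ℝ) :
    ∃ B, ∀ t ∈ Set.Icc 0 T, wSup β (H t) ≤ B := by
  obtain ⟨B, hB⟩ := (isCompact_Icc (a := (0 : ℝ)) (b := T)).bddAbove_image
    (hH.wnorm_cont.mono fun t ht => ht.1)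
  exact ⟨B, fun t ht => hB ⟨t, ht, rfl⟩⟩

theorem _root_.IsMildSolution.unique (hH : IsMildSolution ν β F₀ H) (hF : IsMildSolution ν β F₀ F)
    (hG : GainBound β ν G) (hG0 : 0 ≤ G) (h : Data β M c F₀) (hβ : 5 < β)
    (hν1 : -(1 / 2 : ℝ) < ν) (hν2 : ν < 1) (hc : 0 < c) {t : ℝ} (ht : 0 ≤ t) (x v : E3) :
    H t x v = F t x v := by
  obtain ⟨B₁, hB₁⟩ := hH.exists_wSup_le t
  obtain ⟨B₂, hB₂⟩ := hF.exists_wSup_le t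
  set B := max M (max B₁ B₂) with hBdef
  have hB1 : ∀ s ∈ Set.Icc 0 t, wSup β (H s) ≤ B := fun s hs =>
    (hB₁ s hs).trans ((le_max_left _ _).trans (le_max_right _ _))
  have hB2 : ∀ s ∈ Set.Icc 0 t, wSup β (F s) ≤ B := fun s hs =>
    (hB₂ s hs).trans ((le_max_right _ _).trans (le_max_right _ _))
  have hd : Data β B c F₀ :=
    ⟨h.meas, h.nonneg, fun x v => (h.le x v).trans (le_max_left _ _), h.le_dens⟩
  have hK : 0 ≤ G * B := mul_nonneg hG0 hd.M_nonneg
  have h1 := hH.traj_patch hG hd hβ hν2 hB1 le_rfl hK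
  have h2 := hF.traj_patch hG hd hβ hν2 hB2 le_rfl hK
  have key := eq_of_mildStep_eq hβ (mul_pos hc (Real.exp_pos (-(G * B * t)))) hν1 hν2 hK ht
    (N := B * Real.exp (0 * t)) h.nonneg (by simpa using hd.le) h1.meas h2.meas
    (fun s hs x => h1.reg hd hβ le_rfl hK hc hs.1 hs.2 x)
    (fun s hs x => h2.reg hd hβ le_rfl hK hc hs.1 hs.2 x)
    (fun s hs => hH.mildStep_patch hG hβ hν2 hB1 le_rfl hs)
    (fun s hs => hF.mildStep_patch hG hβ hν2 hB2 le_rfl hs) t ⟨ht, le_rfl⟩ x v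
  rwa [hH.patch_eq ⟨ht, le_rfl⟩, hF.patch_eq ⟨ht, le_rfl⟩] at key

end ESBGK

/-- Theorem 1.1: global existence and uniqueness of mild solutions
to the ES-BGK model for initial data with large oscillations. -/
theorem esbgk_global_existence
    (ν β : ℝ) (hν1 : -(1 / 2 : ℝ) < ν) (hν2 : ν < 1) (hβ : 7 < β)
    (C₀ : ℝ) (hC₀ : 0 < C₀) (M : ℝ) :
    ∃ ε₀ > (0 : ℝ), ∃ C1 ≥ (1 : ℝ), ∃ C2 ≥ (1 : ℝ),
      ∀ F₀ : E3 → E3 → ℝ,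
        (∀ x v, 0 ≤ F₀ x v) →
        Measurable (fun p : E3 × E3 => F₀ p.1 p.2) →
        WBdd β F₀ →
        wSup β F₀ = M →
        Integrable (fun p : E3 × E3 =>
          F₀ p.1 p.2 * Real.log (F₀ p.1 p.2) - Mw p.2 * Real.log (Mw p.2)) →
        Integrable (fun p : E3 × E3 => F₀ p.1 p.2 - Mw p.2) →
        Integrable (fun p : E3 × E3 => ‖p.2‖ ^ 2 * (F₀ p.1 p.2 - Mw p.2)) →
        (∀ t : ℝ, 0 ≤ t → ∀ x : E3, C₀ ≤ ∫ v, F₀ (x - t • v) v) →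
        (∀ t : ℝ, (C1 * wSup β F₀)⁻¹ ≤ t → ∀ x : E3,
          entE F₀ + Real.exp (-t / (1 - ν)) * momentGap (fun v => F₀ (x - t • v) v) ≤ ε₀) →
        ∃ F : ℝ → E3 → E3 → ℝ,
          IsMildSolution ν β F₀ F ∧
          (∀ t, 0 ≤ t → wSup β (F t) ≤ C2) ∧
          (∀ F' : ℝ → E3 → E3 → ℝ, IsMildSolution ν β F₀ F' →
            ∀ t, 0 ≤ t → ∀ x v, F' t x v = F t x v) := by
  obtain ⟨G, hG1, hG⟩ := ESBGK.Adm.exists_bounds (β := β) (by linarith) hν1 hν2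
  rcases le_or_gt M 0 with hM | hM
  · refine ⟨1, one_pos, 1, le_rfl, 1, le_rfl, fun F₀ h0 hm hb hw _ _ _ hd _ => ?_⟩
    have h : ESBGK.Data β M C₀ F₀ := ⟨hm, h0, fun x v => hw ▸ ESBGK.le_wSup hb x v, hd⟩
    exact absurd (h.M_pos hC₀) hM.not_gt
  · obtain ⟨ε, N, C₁, hε, -, hC₁, key⟩ :=
      ESBGK.exists_truncated_solution hβ hν1 hν2 hC₀ hM hG hG1
    refine ⟨ε, hε, C₁, hC₁, max 1 N, le_max_left _ _,
      fun F₀ h0 hm hb hw h1 h2 h3 hd hsmall => ?_⟩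
    have h : ESBGK.Data β M C₀ F₀ := ⟨hm, h0, fun x v => hw ▸ ESBGK.le_wSup hb x v, hd⟩
    obtain ⟨hE, hE'⟩ := ESBGK.totEnt_eq_ofReal_entE h0 h1 h2 h3
    rw [hw] at hsmall
    obtain ⟨F, hF, hfix, hcont, hN⟩ := key F₀ h hE hE' hsmall
    have hsol := hF.isMildSolution hG hfix h (by linarith) hν2 hC₀ hcont hN
    exact ⟨F, hsol, fun t ht => (hN t ht).trans (le_max_right _ _), fun F' hF' t ht x v =>
      hF'.unique hsol hG (by linarith) h (by linarith) hν1 hν2 hC₀ ht x v⟩
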